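/- arXiv:2307.14836 — 2 statements merged into one kernel-verified Lean document; each statement's English description precedes it below -/
import Mathlib

section
/- Let N ≥ 1, let J be an N×N GOE random matrix, let β > 0, let v ∈ ℝ^N be a unit vector, and let f : [-1,1] → ℝ be continuous. Define the ground state L_N = sup_{σ ∈ ℝ^N, |σ|=1} { β H_N(σ) + N f(v·σ) } where H_N(σ) = √N σᵀ J σ, and define 𝓑(α) = f(α) + β√(2(1-α²)) for α ∈ [-1,1]. Then L_N/N converges in probability, as N → ∞, to sup_{α ∈ [-1,1]} 𝓑(α). -/
open MeasureTheory ProbabilityTheory Filter Matrix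

/-- A GOE random matrix: symmetric, with independent centered Gaussian entries `J i j` for
`i ≤ j`, of variance `1` on the diagonal and `1/2` off the diagonal. -/
def IsGOE {N : ℕ} {Ω : Type*} [MeasurableSpace Ω] (P : Measure Ω)
    (J : Ω → Matrix (Fin N) (Fin N) ℝ) : Prop :=
  (∀ ω, (J ω).IsSymm) ∧
  (∀ i j : Fin N, Measurable fun ω => J ω i j) ∧
  iIndepFun
    (fun p : {p : Fin N × Fin N // p.1 ≤ p.2} => fun ω => J ω p.1.1 p.1.2) P ∧
  ∀ i j : Fin N, i ≤ j →
    Measure.map (fun ω => J ω i j) P = gaussianReal 0 (if i = j then 1 else 1 / 2)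


namespace GoePf

abbrev M (n : ℕ) := Fin n → Fin n → ℝ

/-- The characteristic function characterisation of the GOE law. -/
def IsG {n : ℕ} (μ : Measure (M n)) : Prop :=
  ∀ T : M n, ∫ x, Complex.exp (((∑ i, ∑ j, T i j * x i j : ℝ) : ℂ) * Complex.I) ∂μ =
    Complex.exp ((-(∑ i, ∑ j, (T i j + T j i) ^ 2) / 8 : ℝ) : ℂ)

lemma IsG.unique {n : ℕ} {μ ν : Measure (M n)} [IsProbabilityMeasure μ] [IsProbabilityMeasure ν]
    (hμ : IsG μ) (hν : IsG ν) : μ = ν := by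
  apply Measure.ext_of_charFunDual
  ext L
  have key : ∀ x : M n, L x = ∑ i, ∑ j, L (Pi.single i (Pi.single j 1)) * x i j := by
    intro x
    have hx : x = ∑ i, ∑ j, x i j • (Pi.single i (Pi.single j (1 : ℝ)) : M n) := by
      ext a b
      simp only [Finset.sum_apply, Pi.smul_apply, Pi.single_apply]
      rw [Finset.sum_eq_single a]
      · rw [Finset.sum_eq_single b]
        · simp
        · intro j _ hj; simp [hj.symm]
        · simp
      · intro i _ hi; simp [hi.symm]
      · simp
    conv_lhs => rw [hx]
    simp only [map_sum, map_smul, smul_eq_mul]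
    exact Finset.sum_congr rfl fun i _ => Finset.sum_congr rfl fun j _ => mul_comm _ _
  rw [charFunDual_apply, charFunDual_apply]
  have hfun : (fun x : M n => Complex.exp ((L x : ℂ) * Complex.I)) = fun x : M n =>
      Complex.exp (((∑ i, ∑ j, L (Pi.single i (Pi.single j 1)) * x i j : ℝ) : ℂ) * Complex.I) :=
    funext fun x => by rw [← key x]
  rw [hfun, hμ (fun i j => L (Pi.single i (Pi.single j 1))),
    hν (fun i j => L (Pi.single i (Pi.single j 1)))]

def conj {n : ℕ} (O : Matrix (Fin n) (Fin n) ℝ) (x : M n) : M n := O * (Matrix.of x) * Oᵀ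

lemma sum_eq_trace {n : ℕ} (T x : Matrix (Fin n) (Fin n) ℝ) :
    ∑ i, ∑ j, T i j * x i j = Matrix.trace (Tᵀ * x) := by
  simp only [Matrix.trace, Matrix.diag, Matrix.mul_apply, Matrix.transpose_apply]
  rw [Finset.sum_comm]

lemma measurable_conj {n : ℕ} (O : Matrix (Fin n) (Fin n) ℝ) : Measurable (conj O) := by
  refine measurable_pi_lambda _ fun i => measurable_pi_lambda _ fun j => ?_
  simp only [conj, Matrix.mul_apply, Matrix.of_apply]
  fun_prop

lemma continuous_conj {n : ℕ} (O : Matrix (Fin n) (Fin n) ℝ) : Continuous (conj O) := by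
  refine continuous_pi fun i => continuous_pi fun j => ?_
  simp only [conj, Matrix.mul_apply, Matrix.of_apply]
  fun_prop

lemma IsG.conj {n : ℕ} {μ : Measure (M n)} (hμ : IsG μ) (O : Matrix (Fin n) (Fin n) ℝ)
    (hO : O * Oᵀ = 1) : IsG (μ.map (conj O)) := by
  intro T
  rw [integral_map (measurable_conj O).aemeasurable]
  swap
  · apply Continuous.aestronglyMeasurable; fun_prop
  set S : Matrix (Fin n) (Fin n) ℝ := Oᵀ * Matrix.of T * O with hS
  have h1 : ∀ x : M n, ∑ i, ∑ j, T i j * GoePf.conj O x i j = ∑ i, ∑ j, S i j * x i j := by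
    intro x
    have e1 := sum_eq_trace (Matrix.of T) (O * (Matrix.of x) * Oᵀ)
    have e2 := sum_eq_trace S (Matrix.of x)
    simp only [Matrix.of_apply] at e1 e2
    unfold GoePf.conj
    rw [e1, e2, hS]
    simp only [Matrix.transpose_mul, Matrix.transpose_transpose]
    rw [← Matrix.mul_assoc, Matrix.trace_mul_comm]
    simp only [Matrix.mul_assoc]
  simp only [h1]
  rw [hμ S]
  have h2 : ∀ A : Matrix (Fin n) (Fin n) ℝ, ∑ i, ∑ j, (A i j + A j i)^2 = Matrix.trace ((A + Aᵀ) * (A + Aᵀ)) := by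
    intro A
    have := sum_eq_trace (A + Aᵀ) (A + Aᵀ)
    simp only [Matrix.add_apply, Matrix.transpose_apply, Matrix.transpose_add, Matrix.transpose_transpose] at this
    rw [add_comm Aᵀ A] at this
    rw [← this]
    simp only [pow_two]
  have h3 : ∑ i, ∑ j, (S i j + S j i)^2 = ∑ i, ∑ j, (T i j + T j i)^2 := by
    rw [h2 S]
    have := h2 (Matrix.of T)
    simp only [Matrix.of_apply] at this
    rw [this]
    have hS' : S + Sᵀ = Oᵀ * (Matrix.of T + (Matrix.of T)ᵀ) * O := by
      simp only [hS, Matrix.transpose_mul, Matrix.transpose_transpose, Matrix.mul_add, Matrix.add_mul,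
        Matrix.mul_assoc]
    rw [hS']
    set W := Matrix.of T + (Matrix.of T)ᵀ
    calc Matrix.trace (Oᵀ * W * O * (Oᵀ * W * O)) = Matrix.trace (Oᵀ * (W * (O * Oᵀ) * W * O)) := by
          simp only [Matrix.mul_assoc]
      _ = Matrix.trace (W * (O * Oᵀ) * W * (O * Oᵀ)) := by
          rw [Matrix.trace_mul_comm]; simp only [Matrix.mul_assoc]
      _ = _ := by rw [hO]; simp
  rw [h3]

/-- bordered matrix -/
def asm {n : ℕ} (p : ℝ × (Fin n → ℝ) × M n) : M (n + 1) :=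
  Fin.cons (Fin.cons p.1 p.2.1) (fun i => Fin.cons (p.2.1 i) (p.2.2 i))

lemma measurable_asm {n : ℕ} : Measurable (asm (n := n)) := by
  refine measurable_pi_lambda _ fun i => measurable_pi_lambda _ fun j => ?_
  refine Fin.cases ?_ (fun i => ?_) i <;> refine Fin.cases ?_ (fun j => ?_) j <;>
    simp only [asm, Fin.cons_zero, Fin.cons_succ] <;> fun_prop

noncomputable def g1 : Measure ℝ := gaussianReal 0 1
noncomputable def gb (n : ℕ) : Measure (Fin n → ℝ) := Measure.pi (fun _ => gaussianReal 0 (1/2))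

instance : IsProbabilityMeasure g1 := by unfold g1; infer_instance
instance (n : ℕ) : IsProbabilityMeasure (gb n) := by unfold gb; infer_instance

noncomputable def goe : ∀ n : ℕ, Measure (M n)
  | 0 => Measure.dirac 0
  | n + 1 => (g1.prod ((gb n).prod (goe n))).map asm

instance goe_prob (n : ℕ) : IsProbabilityMeasure (goe n) := by
  induction n with
  | zero => unfold goe; infer_instance
  | succ n ih =>
    unfold goe
    exact Measure.isProbabilityMeasure_map measurable_asm.aemeasurable

lemma gauss_char (v : NNReal) (t : ℝ) : ∫ x, Complex.exp ((t * x : ℝ) * Complex.I) ∂(gaussianReal 0 v) =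
    Complex.exp ((-(v * t ^ 2 / 2) : ℝ) : ℂ) := by
  have := charFun_gaussianReal (μ := 0) (v := v) t
  rw [charFun_apply_real] at this
  push_cast
  rw [this]
  congr 1
  push_cast
  ring

lemma pi_char {ι : Type*} [Fintype ι] (v : ι → NNReal) (t : ι → ℝ) :
    ∫ x, Complex.exp ((∑ i, t i * x i : ℝ) * Complex.I) ∂(Measure.pi fun i => gaussianReal 0 (v i)) =
    Complex.exp ((-(∑ i, v i * t i ^ 2 / 2) : ℝ) : ℂ) := by
  have : ∀ x : ι → ℝ, Complex.exp ((∑ i, t i * x i : ℝ) * Complex.I)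
      = ∏ i, Complex.exp ((t i * x i : ℝ) * Complex.I) := by
    intro x
    rw [← Complex.exp_sum]
    push_cast
    rw [Finset.sum_mul]
  simp only [this]
  rw [integral_fintype_prod_eq_prod (μ := fun i => gaussianReal 0 (v i))
    (f := fun i x => Complex.exp ((t i * x : ℝ) * Complex.I))]
  simp only [gauss_char]
  rw [← Complex.exp_sum]
  push_cast
  rw [Finset.sum_neg_distrib]

lemma goe_isG (n : ℕ) : IsG (goe n) := by
  induction n with
  | zero => intro T; simp [goe]
  | succ n ih =>
    intro T
    unfold goe
    rw [integral_map measurable_asm.aemeasurable]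
    swap
    · apply Continuous.aestronglyMeasurable; fun_prop
    have h1 : ∀ p : ℝ × (Fin n → ℝ) × M n,
        Complex.exp (((∑ i, ∑ j, T i j * asm p i j : ℝ) : ℂ) * Complex.I) =
        Complex.exp ((T 0 0 * p.1 : ℝ) * Complex.I) *
        (Complex.exp ((∑ i : Fin n, (T 0 i.succ + T i.succ 0) * p.2.1 i : ℝ) * Complex.I) *
         Complex.exp ((∑ i : Fin n, ∑ j : Fin n, T i.succ j.succ * p.2.2 i j : ℝ) * Complex.I)) := by
      intro p
      rw [← Complex.exp_add, ← Complex.exp_add, ← add_mul, ← add_mul, ← Complex.ofReal_add,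
        ← Complex.ofReal_add]
      congr 3
      simp only [asm, Fin.sum_univ_succ, Fin.cons_zero, Fin.cons_succ, Finset.sum_add_distrib, add_mul]
      ring
    simp only [h1]
    rw [integral_prod_mul (μ := g1) (ν := (gb n).prod (goe n))
      (f := fun a => Complex.exp ((T 0 0 * a : ℝ) * Complex.I))
      (g := fun p => (Complex.exp ((∑ i : Fin n, (T 0 i.succ + T i.succ 0) * p.1 i : ℝ) * Complex.I) *
         Complex.exp ((∑ i : Fin n, ∑ j : Fin n, T i.succ j.succ * p.2 i j : ℝ) * Complex.I)))]
    rw [integral_prod_mul (μ := gb n) (ν := goe n)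
      (f := fun p => Complex.exp ((∑ i : Fin n, (T 0 i.succ + T i.succ 0) * p i : ℝ) * Complex.I))
      (g := fun p => Complex.exp ((∑ i : Fin n, ∑ j : Fin n, T i.succ j.succ * p i j : ℝ) * Complex.I))]
    rw [ih (fun i j => T i.succ j.succ)]
    unfold g1 gb
    rw [gauss_char, pi_char, ← Complex.exp_add, ← Complex.exp_add, ← Complex.ofReal_add,
        ← Complex.ofReal_add]
    congr 2
    simp only [Fin.sum_univ_succ, Finset.sum_add_distrib]
    have : ∀ i : Fin n, (T i.succ 0 + T 0 i.succ)^2 = (T 0 i.succ + T i.succ 0)^2 := by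
      intro i; ring
    simp only [this]
    have h2 : ∑ i : Fin n, ((1/2 : NNReal) : ℝ) * (T 0 i.succ + T i.succ 0)^2 / 2
      = (∑ i : Fin n, (T 0 i.succ + T i.succ 0)^2) / 4 := by
      rw [Finset.sum_div]
      apply Finset.sum_congr rfl; intro i _
      push_cast; ring
    rw [h2]
    push_cast
    ring

lemma goe_conj {n : ℕ} (O : Matrix (Fin n) (Fin n) ℝ) (hO : O * Oᵀ = 1) :
    (goe n).map (conj O) = goe n := by
  have : IsProbabilityMeasure ((goe n).map (conj O)) :=
    Measure.isProbabilityMeasure_map (measurable_conj O).aemeasurable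
  exact ((goe_isG n).conj O hO).unique (goe_isG n)

lemma sum_tri {N : ℕ} {A : Type*} [AddCommMonoid A] (F : Fin N → Fin N → A) :
    ∑ i, ∑ j, F i j = ∑ p : {p : Fin N × Fin N // p.1 ≤ p.2},
      (if p.1.1 = p.1.2 then F p.1.1 p.1.1 else F p.1.1 p.1.2 + F p.1.2 p.1.1) := by
  have e : ∑ p : {p : Fin N × Fin N // p.1 ≤ p.2},
      (if p.1.1 = p.1.2 then F p.1.1 p.1.1 else F p.1.1 p.1.2 + F p.1.2 p.1.1) =
      ∑ p : Fin N × Fin N, if p.1 ≤ p.2 then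
        (if p.1 = p.2 then F p.1 p.1 else F p.1 p.2 + F p.2 p.1) else 0 := by
    rw [← Finset.sum_filter]
    symm
    apply Finset.sum_subtype
    simp
  rw [e]
  have e2 : ∀ p : Fin N × Fin N, (if p.1 ≤ p.2 then
        (if p.1 = p.2 then F p.1 p.1 else F p.1 p.2 + F p.2 p.1) else 0) =
        (if p.1 ≤ p.2 then F p.1 p.2 else 0) + (if p.1 < p.2 then F p.2 p.1 else 0) := by
    rintro ⟨i, j⟩
    rcases lt_trichotomy i j with h | h | h
    · simp [h, h.le, h.ne]
    · subst h; simp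
    · simp [h.not_ge, h.not_gt]
  simp only [e2]
  rw [Finset.sum_add_distrib]
  rw [Fintype.sum_prod_type, Fintype.sum_prod_type]
  conv_rhs => rw [Finset.sum_comm (f := fun i j => if i < j then F j i else 0)]
  rw [← Finset.sum_add_distrib]
  apply Finset.sum_congr rfl; intro i _
  rw [← Finset.sum_add_distrib]
  apply Finset.sum_congr rfl; intro j _
  rcases le_or_gt i j with h | h
  · simp [h, h.not_gt]
  · simp [h, h.not_ge]

lemma law {N : ℕ} {Ω : Type*} [MeasurableSpace Ω] (P : Measure Ω) [IsProbabilityMeasure P]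
    (J : Ω → Matrix (Fin N) (Fin N) ℝ) (h : IsGOE P J) :
    P.map (fun ω => (fun i j => J ω i j : M N)) = goe N := by
  obtain ⟨hs, hm, hi, hg⟩ := h
  have hmJ : Measurable (fun ω => (fun i j => J ω i j : M N)) :=
    measurable_pi_lambda _ fun i => measurable_pi_lambda _ fun j => hm i j
  have : IsProbabilityMeasure (P.map (fun ω => (fun i j => J ω i j : M N))) :=
    Measure.isProbabilityMeasure_map hmJ.aemeasurable
  refine IsG.unique ?_ (goe_isG N)
  intro T
  rw [integral_map hmJ.aemeasurable]
  swap
  · apply Continuous.aestronglyMeasurable; fun_prop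
  rw [iIndepFun_iff_map_fun_eq_pi_map (fun p => (hm _ _).aemeasurable)] at hi
  have hg' : ∀ p : {p : Fin N × Fin N // p.1 ≤ p.2}, P.map (fun ω => J ω p.1.1 p.1.2) =
    gaussianReal 0 (if p.1.1 = p.1.2 then 1 else 1 / 2) := fun p => hg _ _ p.2
  simp only [hg'] at hi
  set s : {p : Fin N × Fin N // p.1 ≤ p.2} → ℝ := fun p =>
    if p.1.1 = p.1.2 then T p.1.1 p.1.1 else T p.1.1 p.1.2 + T p.1.2 p.1.1 with hsdef
  have h1 : ∀ ω, ∑ i, ∑ j, T i j * J ω i j = ∑ p, s p * J ω p.1.1 p.1.2 := by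
    intro ω
    rw [sum_tri]
    apply Finset.sum_congr rfl; intro p _
    simp only [hsdef]
    split_ifs with hp
    · rw [← hp]
    · rw [(hs ω).apply p.1.1 p.1.2]; ring
  simp only [h1]
  have h2 := pi_char (fun p : {p : Fin N × Fin N // p.1 ≤ p.2} => if p.1.1 = p.1.2 then 1 else 1 / 2) s
  rw [← hi, integral_map (by
    exact (measurable_pi_lambda _ fun p => hm _ _).aemeasurable)] at h2
  swap
  · apply Continuous.aestronglyMeasurable; fun_prop
  rw [h2]
  congr 2
  rw [sum_tri, neg_div, Finset.sum_div]
  congr 1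
  apply Finset.sum_congr rfl; intro p _
  simp only [hsdef]
  split_ifs with hp
  · push_cast; ring
  · push_cast; ring

end GoePf

namespace GoePf

def q {n : ℕ} (x : M n) (σ : Fin n → ℝ) : ℝ := σ ⬝ᵥ (Matrix.of x *ᵥ σ)

lemma q_conj {n : ℕ} (O : Matrix (Fin n) (Fin n) ℝ) (x : M n) (σ : Fin n → ℝ) :
    q (conj O x) σ = q x (Oᵀ *ᵥ σ) := by
  have : Matrix.of (conj O x) = O * (Matrix.of x) * Oᵀ := rfl
  unfold q
  rw [this, ← Matrix.mulVec_mulVec, ← Matrix.mulVec_mulVec, Matrix.dotProduct_mulVec,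
    ← Matrix.mulVec_transpose]

lemma dot_O {n : ℕ} (O : Matrix (Fin n) (Fin n) ℝ) (u σ : Fin n → ℝ) :
    (O *ᵥ u) ⬝ᵥ σ = u ⬝ᵥ (Oᵀ *ᵥ σ) := by
  rw [dotProduct_comm, Matrix.dotProduct_mulVec, ← Matrix.mulVec_transpose, dotProduct_comm]

lemma dot_OO {n : ℕ} (O : Matrix (Fin n) (Fin n) ℝ) (hO : Oᵀ * O = 1) (u σ : Fin n → ℝ) :
    (O *ᵥ u) ⬝ᵥ (O *ᵥ σ) = u ⬝ᵥ σ := by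
  rw [dot_O, Matrix.mulVec_mulVec, hO, Matrix.one_mulVec]

/-- first basis vector -/
def e0 (n : ℕ) : Fin (n + 1) → ℝ := Fin.cons 1 0

lemma e0_dot {n : ℕ} (w : Fin (n + 1) → ℝ) : e0 n ⬝ᵥ w = w 0 := by
  simp [e0, dotProduct, Fin.sum_univ_succ]

lemma exists_rot {n : ℕ} (v : Fin (n + 1) → ℝ) (hv : v ⬝ᵥ v = 1) :
    ∃ O : Matrix (Fin (n + 1)) (Fin (n + 1)) ℝ, O * Oᵀ = 1 ∧ Oᵀ * O = 1 ∧ O *ᵥ (e0 n) = v := by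
  set w := e0 n - v with hw
  have hww : w ⬝ᵥ w = 2 - 2 * v 0 := by
    rw [hw, sub_dotProduct, dotProduct_sub, dotProduct_sub, hv, e0_dot, e0_dot, dotProduct_comm v, e0_dot]
    simp [e0]; ring
  have hwe : w ⬝ᵥ e0 n = 1 - v 0 := by
    rw [hw, sub_dotProduct, dotProduct_comm v, e0_dot, e0_dot]; simp [e0]
  by_cases hz : w ⬝ᵥ w = 0
  · have : w = 0 := dotProduct_self_eq_zero.1 hz
    refine ⟨1, by simp, by simp, ?_⟩
    rw [Matrix.one_mulVec]
    exact sub_eq_zero.1 this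
  set c := 2 / (w ⬝ᵥ w) with hc
  have hcw : c * (w ⬝ᵥ w) = 2 := by rw [hc]; field_simp
  have ht : (1 - c • Matrix.vecMulVec w w)ᵀ = 1 - c • Matrix.vecMulVec w w := by
    rw [Matrix.transpose_sub, Matrix.transpose_smul, Matrix.transpose_one, Matrix.transpose_vecMulVec]
  have hsq : (1 - c • Matrix.vecMulVec w w) * (1 - c • Matrix.vecMulVec w w) = 1 := by
    ext i j
    simp only [Matrix.sub_mul, Matrix.mul_sub, Matrix.one_mul, Matrix.mul_one, Matrix.smul_mul, Matrix.mul_smul,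
      Matrix.vecMulVec_mul_vecMulVec, Matrix.sub_apply, Matrix.smul_apply, Matrix.vecMulVec_apply, smul_eq_mul,
      Pi.smul_apply]
    linear_combination c * (w i * w j) * hcw
  refine ⟨1 - c • Matrix.vecMulVec w w, by rw [ht, hsq], by rw [ht, hsq], ?_⟩
  rw [Matrix.sub_mulVec, Matrix.one_mulVec, Matrix.smul_mulVec, Matrix.vecMulVec_mulVec, hwe]
  have h1 : c * (1 - v 0) = 1 := by rw [hww] at hcw; linarith
  ext i
  simp only [Pi.sub_apply, Pi.smul_apply, smul_eq_mul, MulOpposite.smul_eq_mul_unop, MulOpposite.unop_op]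
  have : w i = e0 n i - v i := rfl
  linear_combination (-w i) * h1 - this

open Classical in
noncomputable def ub {m : ℕ} (b : Fin (m + 1) → ℝ) : Fin (m + 1) → ℝ :=
  if b = 0 then e0 m else (√(b ⬝ᵥ b))⁻¹ • b

lemma meas_dot {m : ℕ} : Measurable fun b : Fin m → ℝ => b ⬝ᵥ b := by
  unfold dotProduct; fun_prop

lemma measurable_ub {m : ℕ} : Measurable (ub (m := m)) := by
  classical
  unfold ub
  refine Measurable.ite (measurableSet_singleton 0) measurable_const ?_
  have h : Measurable fun b : Fin (m + 1) → ℝ => (√(b ⬝ᵥ b))⁻¹ :=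
    (Real.continuous_sqrt.measurable.comp meas_dot).inv
  refine measurable_pi_lambda _ fun i => ?_
  exact h.mul (measurable_pi_apply i)

lemma dot_nonneg {m : ℕ} (b : Fin m → ℝ) : 0 ≤ b ⬝ᵥ b := by
  unfold dotProduct; exact Finset.sum_nonneg fun i _ => mul_self_nonneg _

lemma ub_unit {m : ℕ} (b : Fin (m + 1) → ℝ) : ub b ⬝ᵥ ub b = 1 := by
  unfold ub
  split_ifs with h
  · rw [e0_dot]; simp [e0]
  · have hb : b ⬝ᵥ b ≠ 0 := fun h' => h (dotProduct_self_eq_zero.1 h')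
    have hb' : 0 < b ⬝ᵥ b := lt_of_le_of_ne (dot_nonneg b) hb.symm
    rw [smul_dotProduct, dotProduct_smul, smul_eq_mul, smul_eq_mul, ← mul_assoc, ← mul_inv,
      Real.mul_self_sqrt hb'.le]
    field_simp

lemma ub_smul {m : ℕ} (b : Fin (m + 1) → ℝ) : b = √(b ⬝ᵥ b) • ub b := by
  unfold ub
  split_ifs with h
  · subst h; simp
  · have hb : b ⬝ᵥ b ≠ 0 := fun h' => h (dotProduct_self_eq_zero.1 h')
    have hb' : 0 < b ⬝ᵥ b := lt_of_le_of_ne (dot_nonneg b) hb.symm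
    rw [smul_smul, mul_inv_cancel₀ (Real.sqrt_pos.2 hb').ne', one_smul]

lemma step {m : ℕ} (A : Set ((Fin (m + 1) → ℝ) × M (m + 1))) (hA : MeasurableSet A)
    (A' : Set ((Fin (m + 2) → ℝ) × M (m + 2))) (hA' : MeasurableSet A')
    (hrot : ∀ O : Matrix (Fin (m + 2)) (Fin (m + 2)) ℝ, O * Oᵀ = 1 → Oᵀ * O = 1 →
      ∀ v x, (v, x) ∈ A' → (O *ᵥ v, conj O x) ∈ A')
    (SA : Set ℝ) (SB : Set (Fin (m + 1) → ℝ))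
    (hdet : ∀ a b x u, a ∈ SA → b ∈ SB → u ⬝ᵥ u = 1 → b = √(b ⬝ᵥ b) • u → (u, x) ∈ A →
      (e0 (m + 1), asm (a, b, x)) ∈ A')
    (p : ENNReal) (hp : ∀ u, u ⬝ᵥ u = 1 → goe (m + 1) {x | (u, x) ∉ A} ≤ p)
    (v : Fin (m + 2) → ℝ) (hv : v ⬝ᵥ v = 1) :
    goe (m + 2) {x | (v, x) ∉ A'} ≤ g1 SAᶜ + gb (m + 1) SBᶜ + p := by
  obtain ⟨O, hO1, hO2, hOv⟩ := exists_rot v hv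
  have hmeas : ∀ w : Fin (m + 2) → ℝ, MeasurableSet {x | (w, x) ∉ A'} := by
    intro w
    exact (measurable_prodMk_left hA').compl
  calc goe (m + 2) {x | (v, x) ∉ A'} = (goe (m + 2)).map (conj O) {x | (v, x) ∉ A'} := by
        rw [goe_conj O hO1]
    _ = goe (m + 2) (conj O ⁻¹' {x | (v, x) ∉ A'}) := Measure.map_apply (measurable_conj O) (hmeas v)
    _ ≤ goe (m + 2) {x | (e0 (m + 1), x) ∉ A'} := by
        apply measure_mono
        intro x hx h
        apply hx
        have := hrot O hO1 hO2 _ _ h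
        rwa [hOv] at this
    _ = (g1.prod ((gb (m + 1)).prod (goe (m + 1)))) (asm ⁻¹' {x | (e0 (m + 1), x) ∉ A'}) := by
        conv_lhs => rw [goe]
        exact Measure.map_apply measurable_asm (hmeas _)
    _ ≤ (g1.prod ((gb (m + 1)).prod (goe (m + 1)))) ((SAᶜ ×ˢ Set.univ) ∪
          (Set.univ ×ˢ (SBᶜ ×ˢ Set.univ)) ∪ (Set.univ ×ˢ {p | (ub p.1, p.2) ∉ A})) := by
        apply measure_mono
        rintro ⟨a, b, x⟩ hx
        by_contra hcon
        simp only [Set.mem_union, Set.mem_prod, Set.mem_compl_iff, Set.mem_univ, and_true, true_and,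
          Set.mem_ofPred_eq, not_or, not_not] at hcon
        exact hx (hdet a b x (ub b) hcon.1.1 hcon.1.2 (ub_unit b) (ub_smul b) hcon.2)
    _ ≤ _ := by
        refine (measure_union_le _ _).trans (add_le_add ((measure_union_le _ _).trans (add_le_add ?_ ?_)) ?_)
        · simp [Measure.prod_prod]
        · simp [Measure.prod_prod]
        · rw [Measure.prod_prod, measure_univ, one_mul]
          have hm : MeasurableSet {p : (Fin (m + 1) → ℝ) × M (m + 1) | (ub p.1, p.2) ∉ A} := by
            have : Measurable fun p : (Fin (m + 1) → ℝ) × M (m + 1) => (ub p.1, p.2) :=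
              (measurable_ub.comp measurable_fst).prodMk measurable_snd
            exact (this hA).compl
          rw [Measure.prod_apply hm]
          calc ∫⁻ b, goe (m + 1) (Prod.mk b ⁻¹' {p | (ub p.1, p.2) ∉ A}) ∂(gb (m + 1))
              ≤ ∫⁻ b, p ∂(gb (m + 1)) := by
                apply lintegral_mono
                intro b
                exact hp (ub b) (ub_unit b)
            _ = p := by simp

lemma q_asm {n : ℕ} (a : ℝ) (b : Fin n → ℝ) (x : M n) (σ : Fin (n + 1) → ℝ) :
    q (asm (a, b, x)) σ = a * σ 0 ^ 2 + 2 * σ 0 * (b ⬝ᵥ Fin.tail σ) + q x (Fin.tail σ) := by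
  simp only [q, asm, dotProduct, Matrix.mulVec, Fin.sum_univ_succ, Matrix.of_apply, Fin.cons_zero,
    Fin.cons_succ, Fin.tail, mul_add, Finset.sum_add_distrib, Finset.mul_sum]
  have : ∑ i : Fin n, σ i.succ * (b i * σ 0) = ∑ i : Fin n, σ 0 * (b i * σ i.succ) :=
    Finset.sum_congr rfl fun i _ => by ring
  rw [this]
  have : ∑ i : Fin n, 2 * σ 0 * (b i * σ i.succ) = ∑ i : Fin n, σ 0 * (b i * σ i.succ) + ∑ i : Fin n, σ 0 * (b i * σ i.succ) := by
    rw [← Finset.sum_add_distrib]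
    exact Finset.sum_congr rfl fun i _ => by ring
  rw [this]
  ring

lemma dot_succ {n : ℕ} (σ : Fin (n + 1) → ℝ) : σ ⬝ᵥ σ = σ 0 ^ 2 + Fin.tail σ ⬝ᵥ Fin.tail σ := by
  simp only [dotProduct, Fin.sum_univ_succ, Fin.tail]; ring

lemma cs {n : ℕ} (u τ : Fin n → ℝ) : (u ⬝ᵥ τ) ^ 2 ≤ (u ⬝ᵥ u) * (τ ⬝ᵥ τ) := by
  simp only [dotProduct, ← pow_two]
  exact Finset.sum_mul_sq_le_sq_mul_sq _ _ _

def AU (n : ℕ) (D B : ℝ) : Set ((Fin n → ℝ) × M n) :=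
  {p | ∀ σ : Fin n → ℝ, |q p.2 σ| ≤ D * (σ ⬝ᵥ σ) + 2 * B * (√(σ ⬝ᵥ σ) * √(σ ⬝ᵥ σ - (p.1 ⬝ᵥ σ) ^ 2))}

def AL (n : ℕ) (α c : ℝ) : Set ((Fin n → ℝ) × M n) :=
  {p | ∃ σ : Fin n → ℝ, σ ⬝ᵥ σ = 1 ∧ p.1 ⬝ᵥ σ = α ∧ c ≤ q p.2 σ}

lemma AU_closed (n : ℕ) (D B : ℝ) : IsClosed (AU n D B) := by
  unfold AU
  rw [Set.ofPred_forall]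
  refine isClosed_iInter fun σ => isClosed_le ?_ ?_
  · simp only [q, dotProduct, Matrix.mulVec, Matrix.of_apply]; fun_prop
  · simp only [dotProduct]; fun_prop

lemma AL_closed (n : ℕ) (α c : ℝ) : IsClosed (AL n α c) := by
  let K : Set (Fin n → ℝ) := {σ | σ ⬝ᵥ σ = 1}
  have hK : IsCompact K := by
    apply Metric.isCompact_of_isClosed_isBounded
    · apply isClosed_eq
      · simp only [dotProduct]; fun_prop
      · fun_prop
    · refine (Metric.isBounded_closedBall (x := (0 : Fin n → ℝ)) (r := 1)).subset ?_
      intro σ hσ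
      rw [mem_closedBall_zero_iff, pi_norm_le_iff_of_nonneg zero_le_one]
      intro i
      have h1 : σ i * σ i ≤ σ ⬝ᵥ σ :=
        Finset.single_le_sum (f := fun i => σ i * σ i) (fun i _ => mul_self_nonneg _) (Finset.mem_univ i)
      have h2 : σ ⬝ᵥ σ = 1 := hσ
      rw [Real.norm_eq_abs]
      apply abs_le_one_iff_mul_self_le_one.2
      linarith
  have : CompactSpace K := isCompact_iff_compactSpace.1 hK
  have hcl : IsClosed {z : K × ((Fin n → ℝ) × M n) | z.2.1 ⬝ᵥ z.1.1 = α ∧ c ≤ q z.2.2 z.1.1} := by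
    have hv : ∀ i, Continuous fun z : K × ((Fin n → ℝ) × M n) => z.1.1 i := fun i =>
      (continuous_apply i).comp (continuous_subtype_val.comp continuous_fst)
    have c1 : IsClosed {z : K × ((Fin n → ℝ) × M n) | z.2.1 ⬝ᵥ z.1.1 = α} := by
      apply isClosed_eq
      · simp only [dotProduct]
        exact continuous_finsetSum _ fun i _ => Continuous.mul (by fun_prop) (hv i)
      · fun_prop
    have c2 : IsClosed {z : K × ((Fin n → ℝ) × M n) | c ≤ q z.2.2 z.1.1} := by
      apply isClosed_le
      · fun_prop
      · simp only [q, dotProduct, Matrix.mulVec, Matrix.of_apply]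
        exact continuous_finsetSum _ fun i _ => Continuous.mul (hv i)
          (continuous_finsetSum _ fun j _ => Continuous.mul (by fun_prop) (hv j))
    exact c1.inter c2
  have := isClosedMap_snd_of_compactSpace _ hcl
  convert this using 1
  ext p
  constructor
  · rintro ⟨σ, h1, h2, h3⟩
    exact ⟨(⟨σ, h1⟩, p), ⟨h2, h3⟩, rfl⟩
  · rintro ⟨⟨⟨σ, h1⟩, p'⟩, ⟨h2, h3⟩, rfl⟩
    exact ⟨σ, h1, h2, h3⟩

lemma AU_rot {n : ℕ} (D B : ℝ) (O : Matrix (Fin n) (Fin n) ℝ) (h1 : O * Oᵀ = 1)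
    (v : Fin n → ℝ) (x : M n) (h : (v, x) ∈ AU n D B) : (O *ᵥ v, conj O x) ∈ AU n D B := by
  intro σ
  have := h (Oᵀ *ᵥ σ)
  simp only at this ⊢
  rw [q_conj, dot_O]
  rwa [dot_OO Oᵀ (by rwa [Matrix.transpose_transpose])] at this

lemma AL_rot {n : ℕ} (α c : ℝ) (O : Matrix (Fin n) (Fin n) ℝ) (h2 : Oᵀ * O = 1)
    (v : Fin n → ℝ) (x : M n) (h : (v, x) ∈ AL n α c) : (O *ᵥ v, conj O x) ∈ AL n α c := by
  obtain ⟨σ, a1, a2, a3⟩ := h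
  refine ⟨O *ᵥ σ, by rw [dot_OO O h2, a1], by simp only at a2 ⊢; rw [dot_OO O h2, a2], ?_⟩
  simp only at a3 ⊢
  rw [q_conj, Matrix.mulVec_mulVec, h2, Matrix.one_mulVec]
  exact a3

lemma AU_det {n : ℕ} (D B : ℝ) (a : ℝ) (b u : Fin n → ℝ) (x : M n) (ha : |a| ≤ D) (hb : √(b ⬝ᵥ b) ≤ B)
    (hu : u ⬝ᵥ u = 1) (hbu : b = √(b ⬝ᵥ b) • u) (h : (u, x) ∈ AU n D B) :
    (e0 n, asm (a, b, x)) ∈ AU (n + 1) D B := by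
  intro σ
  simp only
  rw [e0_dot, q_asm, dot_succ]
  set τ := Fin.tail σ
  set s := σ 0
  have hq := h τ
  simp only at hq
  have hbt : b ⬝ᵥ τ = √(b ⬝ᵥ b) * (u ⬝ᵥ τ) := by
    conv_lhs => rw [hbu]
    rw [smul_dotProduct, smul_eq_mul]
  rw [hbt]
  set r := √(b ⬝ᵥ b)
  have hr : 0 ≤ r := Real.sqrt_nonneg _
  set c := u ⬝ᵥ τ with hc
  have hcT : c ^ 2 ≤ τ ⬝ᵥ τ := by have := cs u τ; rw [hu, one_mul] at this; exact this
  set T := τ ⬝ᵥ τ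
  have hT : 0 ≤ T := (sq_nonneg c).trans hcT
  have e1 : s ^ 2 + T - s ^ 2 = T := by ring
  rw [e1]
  have key : |s| * |c| + √T * √(T - c ^ 2) ≤ √(s ^ 2 + T) * √T := by
    rw [← Real.sqrt_mul (show 0 ≤ s ^ 2 + T by positivity)]
    apply Real.le_sqrt_of_sq_le
    have h1 : √T ^ 2 = T := Real.sq_sqrt hT
    have h2 : √(T - c ^ 2) ^ 2 = T - c ^ 2 := Real.sq_sqrt (by linarith)
    have h3 := sq_nonneg (|s| * √(T - c ^ 2) - √T * |c|)
    have h4 := sq_abs s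
    have h5 := sq_abs c
    have : (|s| * |c| + √T * √(T - c ^ 2)) ^ 2 + (|s| * √(T - c ^ 2) - √T * |c|) ^ 2 = (s ^ 2 + T) * T := by
      calc _ = (|s|^2 + √T^2) * (|c|^2 + √(T - c ^ 2)^2) := by ring
        _ = _ := by rw [h1, h2, h4, h5]; ring
    linarith
  have t1 : |a * s ^ 2| ≤ D * s ^ 2 := by
    rw [abs_mul, abs_of_nonneg (sq_nonneg s)]
    exact mul_le_mul_of_nonneg_right ha (sq_nonneg s)
  have t2 : |2 * s * (r * c)| ≤ 2 * B * (|s| * |c|) := by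
    have : |2 * s * (r * c)| = 2 * r * (|s| * |c|) := by
      rw [abs_mul, abs_mul, abs_mul, abs_of_nonneg hr, abs_two]; ring
    rw [this]
    have : 0 ≤ |s| * |c| := by positivity
    nlinarith
  have t3 := abs_add_three (a * s ^ 2) (2 * s * (r * c)) (q x τ)
  have hB : 0 ≤ B := hr.trans hb
  have t4 := mul_le_mul_of_nonneg_left key (show 0 ≤ 2 * B by linarith)
  linarith

lemma AL_det {n : ℕ} (D B c α : ℝ) (hα : α ^ 2 ≤ 1) (a : ℝ) (b u : Fin n → ℝ) (x : M n) (ha : |a| ≤ D)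
    (hb : B ≤ √(b ⬝ᵥ b)) (hbu : b = √(b ⬝ᵥ b) • u) (h : (u, x) ∈ AL n α c) :
    (e0 n, asm (a, b, x)) ∈ AL (n + 1) α (α ^ 2 * (2 * √(1 - α ^ 2) * B - D) + (1 - α ^ 2) * c) := by
  obtain ⟨τ, h1, h2, h3⟩ := h
  simp only at h2 h3
  set s := √(1 - α ^ 2) with hs
  have hs2 : s ^ 2 = 1 - α ^ 2 := Real.sq_sqrt (by linarith)
  have hs0 : 0 ≤ s := Real.sqrt_nonneg _
  refine ⟨Fin.cons α (s • τ), ?_, ?_, ?_⟩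
  · rw [dot_succ, Fin.tail_cons, Fin.cons_zero, smul_dotProduct, dotProduct_smul, h1]
    simp only [smul_eq_mul]; linarith [hs2]
  · simp only [e0_dot, Fin.cons_zero]
  · simp only
    rw [q_asm, Fin.tail_cons, Fin.cons_zero]
    have hbt : b ⬝ᵥ (s • τ) = √(b ⬝ᵥ b) * s * α := by
      conv_lhs => rw [hbu]
      rw [smul_dotProduct, dotProduct_smul, h2, smul_eq_mul, smul_eq_mul]; ring
    have hqs : q x (s • τ) = (1 - α ^ 2) * q x τ := by
      unfold q
      rw [Matrix.mulVec_smul, dotProduct_smul, smul_dotProduct, ← hs2]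
      simp only [smul_eq_mul]; ring
    rw [hbt, hqs]
    have k1 : (1 - α ^ 2) * c ≤ (1 - α ^ 2) * q x τ := mul_le_mul_of_nonneg_left h3 (by linarith)
    have k2 : -D * α ^ 2 ≤ a * α ^ 2 := mul_le_mul_of_nonneg_right (abs_le.1 ha).1 (sq_nonneg _)
    have k3 : (2 * α ^ 2 * s) * B ≤ (2 * α ^ 2 * s) * √(b ⬝ᵥ b) := mul_le_mul_of_nonneg_left hb (by positivity)
    linarith

/-- base of the lower bound -/
lemma AL_base {n : ℕ} (D B α : ℝ) (hB : 0 ≤ B) (hα : α ^ 2 ≤ 1) (v : Fin (n + 2) → ℝ)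
    (hv : v ⬝ᵥ v = 1) (x : M (n + 2)) (h : (v, x) ∈ AU (n + 2) D B) :
    (v, x) ∈ AL (n + 2) α (-(D + 2 * B)) := by
  obtain ⟨O, hO1, hO2, hOv⟩ := exists_rot v hv
  set w := O *ᵥ (Fin.cons 0 (e0 n) : Fin (n + 2) → ℝ) with hw
  have hww : w ⬝ᵥ w = 1 := by
    rw [hw, dot_OO O hO2, dot_succ, Fin.tail_cons, e0_dot]; simp [e0]
  have hvw : v ⬝ᵥ w = 0 := by
    rw [← hOv, hw, dot_OO O hO2, e0_dot]; simp
  set s := √(1 - α ^ 2) with hs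
  have hs2 : s ^ 2 = 1 - α ^ 2 := Real.sq_sqrt (by linarith)
  have hσ : (α • v + s • w) ⬝ᵥ (α • v + s • w) = 1 := by
    simp only [add_dotProduct, dotProduct_add, smul_dotProduct, dotProduct_smul, hv, hww, hvw,
      dotProduct_comm w v, smul_eq_mul]
    linarith
  have hvσ : v ⬝ᵥ (α • v + s • w) = α := by
    simp only [dotProduct_add, dotProduct_smul, hv, hvw, smul_eq_mul]; ring
  refine ⟨α • v + s • w, hσ, hvσ, ?_⟩
  have := h (α • v + s • w)
  simp only at this ⊢
  rw [hσ, hvσ, Real.sqrt_one, ← hs] at this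
  have hs1 : s ≤ 1 := by rw [hs]; apply Real.sqrt_le_one.2; nlinarith
  have := (abs_le.1 this).1
  nlinarith

end GoePf

namespace GoePf

lemma gint (v : NNReal) (hv : v ≠ 0) (t : ℝ) (ht : 0 < 1 / (2 * (v : ℝ)) - t) :
    Integrable (fun x => Real.exp (t * x ^ 2)) (gaussianReal 0 v) ∧
    ∫ x, Real.exp (t * x ^ 2) ∂(gaussianReal 0 v) =
      (√(2 * Real.pi * v))⁻¹ * √(Real.pi / (1 / (2 * (v : ℝ)) - t)) := by
  have hv' : (v : ℝ) ≠ 0 := by exact_mod_cast hv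
  have e : ∀ x : ℝ, gaussianPDFReal 0 v x • Real.exp (t * x ^ 2) =
      (√(2 * Real.pi * v))⁻¹ * Real.exp (-(1 / (2 * (v : ℝ)) - t) * x ^ 2) := by
    intro x
    rw [gaussianPDFReal_def, smul_eq_mul, mul_assoc, ← Real.exp_add]
    congr 2
    field_simp
    ring
  constructor
  · rw [gaussianReal_of_var_ne_zero _ hv, integrable_withDensity_iff_integrable_smul'
      (measurable_gaussianPDF _ _) (ae_of_all _ fun _ => gaussianPDF_lt_top)]
    simp only [toReal_gaussianPDF, e]
    exact (integrable_exp_neg_mul_sq ht).const_mul _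
  · rw [integral_gaussianReal_eq_integral_smul hv]
    simp only [e]
    rw [integral_const_mul, integral_gaussian]

lemma gint_half (t : ℝ) (ht : t < 1) :
    Integrable (fun x => Real.exp (t * x ^ 2)) (gaussianReal 0 (1/2)) ∧
    ∫ x, Real.exp (t * x ^ 2) ∂(gaussianReal 0 (1/2)) = (√(1 - t))⁻¹ := by
  have h := gint (1/2) (by norm_num) t (by push_cast; norm_num; linarith)
  refine ⟨h.1, ?_⟩
  rw [h.2]
  have e1 : 2 * Real.pi * ((1/2 : NNReal) : ℝ) = Real.pi := by push_cast; ring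
  have e2 : 1 / (2 * ((1/2 : NNReal) : ℝ)) - t = 1 - t := by push_cast; norm_num
  rw [e1, e2, Real.sqrt_div Real.pi_pos.le]
  have := (Real.sqrt_pos.2 Real.pi_pos).ne'
  field_simp

lemma chern (m : ℕ) (t s : ℝ) (ht : t < 1) :
    gb m {b | s ≤ t * (b ⬝ᵥ b)} ≤ ENNReal.ofReal (Real.exp (-s) * ((√(1 - t))⁻¹) ^ m) := by
  have hfun : ∀ b : Fin m → ℝ, Real.exp (t * (b ⬝ᵥ b)) = ∏ i, Real.exp (t * b i ^ 2) := by
    intro b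
    rw [← Real.exp_sum, ← Finset.mul_sum]
    simp only [dotProduct, pow_two]
  have hint : Integrable (fun b : Fin m → ℝ => Real.exp (t * (b ⬝ᵥ b))) (gb m) := by
    simp only [hfun]
    unfold gb
    exact Integrable.fintype_prod (f := fun _ x => Real.exp (t * x ^ 2)) fun i => (gint_half t ht).1
  have hval : ∫ b, Real.exp (t * (b ⬝ᵥ b)) ∂(gb m) = ((√(1 - t))⁻¹) ^ m := by
    simp only [hfun]
    unfold gb
    rw [integral_fintype_prod_eq_prod (μ := fun _ => gaussianReal 0 (1/2))
      (f := fun _ x => Real.exp (t * x ^ 2)), Finset.prod_const, (gint_half t ht).2]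
    simp
  have hmk := mul_meas_ge_le_integral_of_nonneg (μ := gb m) (ae_of_all _ fun b => (Real.exp_pos _).le) hint (Real.exp s)
  rw [hval] at hmk
  simp only [Real.exp_le_exp] at hmk
  rw [← ofReal_measureReal]
  apply ENNReal.ofReal_le_ofReal
  rw [Real.exp_neg, ← div_eq_inv_mul, le_div_iff₀ (Real.exp_pos _), mul_comm]
  exact hmk

lemma tailA (ε : ℝ) (hε : 0 < ε) : ∃ C r : ℝ, 0 ≤ C ∧ 0 ≤ r ∧ r < 1 ∧ ∀ N : ℕ,
    g1 {a | |a| ≤ ε * √N}ᶜ ≤ ENNReal.ofReal (C * r ^ N) := by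
  have h := gint 1 (by norm_num) (1/4) (by push_cast; norm_num)
  refine ⟨∫ x, Real.exp (1/4 * x ^ 2) ∂(gaussianReal 0 1), Real.exp (-(ε ^ 2 / 4)),
    integral_nonneg fun x => (Real.exp_pos _).le, (Real.exp_pos _).le,
    Real.exp_lt_one_iff.2 (by nlinarith [sq_pos_of_pos hε]), fun N => ?_⟩
  have hmk := mul_meas_ge_le_integral_of_nonneg (ae_of_all _ fun b => (Real.exp_pos _).le) h.1
    (Real.exp (N * (ε ^ 2 / 4)))
  calc g1 {a | |a| ≤ ε * √N}ᶜ ≤ g1 {a | Real.exp (N * (ε ^ 2 / 4)) ≤ Real.exp (1/4 * a ^ 2)} := by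
        apply measure_mono
        intro a ha
        have ha' : ε * √N < |a| := not_le.1 ha
        have h2 : (ε * √N) ^ 2 ≤ |a| ^ 2 := by
          apply pow_le_pow_left₀ (by positivity) ha'.le
        rw [sq_abs, mul_pow, Real.sq_sqrt (Nat.cast_nonneg N)] at h2
        show Real.exp _ ≤ Real.exp _
        apply Real.exp_le_exp.2
        linarith
    _ ≤ _ := by
        rw [← ofReal_measureReal]
        apply ENNReal.ofReal_le_ofReal
        rw [← Real.exp_nat_mul, mul_neg, Real.exp_neg, ← div_eq_mul_inv, le_div_iff₀ (Real.exp_pos _), mul_comm]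
        exact hmk

lemma tailU (ε : ℝ) (hε : 0 < ε) : ∃ r : ℝ, 0 ≤ r ∧ r < 1 ∧ ∀ N m : ℕ, m ≤ N →
    gb m {b | √(b ⬝ᵥ b) ≤ √(N * (1 + ε) / 2)}ᶜ ≤ ENNReal.ofReal (r ^ N) := by
  set t := ε / (2 * (1 + ε)) with ht
  have ht0 : 0 < t := by positivity
  have hte : t * (1 + ε) = ε / 2 := by rw [ht]; field_simp
  have ht1 : t < 1 := by rw [ht, div_lt_one (by positivity)]; linarith
  have h1t : 0 < 1 - t := by linarith
  have hs : 0 < √(1 - t) := Real.sqrt_pos.2 h1t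
  refine ⟨Real.exp (-(t * (1 + ε) / 2)) * (√(1 - t))⁻¹, by positivity, ?_, fun N m hm => ?_⟩
  · rw [Real.exp_neg, ← mul_inv]
    apply inv_lt_one_of_one_lt₀
    have h1 : 1 < (1 - t) * Real.exp (t * (1 + ε)) := by
      have := Real.add_one_le_exp (t * (1 + ε))
      have h2 : (1 - t) * (t * (1 + ε) + 1) ≤ (1 - t) * Real.exp (t * (1 + ε)) :=
        mul_le_mul_of_nonneg_left this h1t.le
      nlinarith
    have h2 : (Real.exp (t * (1 + ε) / 2) * √(1 - t)) ^ 2 = (1 - t) * Real.exp (t * (1 + ε)) := by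
      rw [mul_pow, Real.sq_sqrt h1t.le, ← Real.exp_nat_mul]
      rw [mul_comm]; congr 2; push_cast; ring
    rw [← h2] at h1
    exact (one_lt_sq_iff₀ (by positivity)).1 h1
  · calc _ ≤ gb m {b | t * (N * (1 + ε) / 2) ≤ t * (b ⬝ᵥ b)} := by
          apply measure_mono
          intro b hb
          have hb' : √(N * (1 + ε) / 2) < √(b ⬝ᵥ b) := not_le.1 hb
          have := (Real.sqrt_lt_sqrt_iff (by positivity)).1 hb'
          exact mul_le_mul_of_nonneg_left this.le ht0.le
      _ ≤ _ := chern m t _ ht1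
      _ ≤ _ := by
          apply ENNReal.ofReal_le_ofReal
          rw [mul_pow, ← Real.exp_nat_mul]
          have e : -(t * (N * (1 + ε) / 2)) = N * -(t * (1 + ε) / 2) := by ring
          rw [e]
          apply mul_le_mul_of_nonneg_left _ (Real.exp_pos _).le
          apply pow_le_pow_right₀ _ hm
          apply (one_le_inv₀ hs).2
          apply Real.sqrt_le_one.2; linarith

lemma tailL (ε : ℝ) (hε : 0 < ε) (hε1 : ε < 1) (K : ℕ) : ∃ C r : ℝ, 0 ≤ C ∧ 0 ≤ r ∧ r < 1 ∧
    ∀ N m : ℕ, N ≤ m + K →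
    gb m {b | √(N * (1 - ε) / 2) ≤ √(b ⬝ᵥ b)}ᶜ ≤ ENNReal.ofReal (C * r ^ N) := by
  have hs : 0 < √(1 + ε) := Real.sqrt_pos.2 (by linarith)
  have hs1 : 1 ≤ √(1 + ε) := Real.one_le_sqrt.2 (by linarith)
  refine ⟨√(1 + ε) ^ K, Real.exp (ε * (1 - ε) / 2) * (√(1 + ε))⁻¹, by positivity, by positivity, ?_,
    fun N m hm => ?_⟩
  · rw [← div_eq_mul_inv, div_lt_one hs]
    apply Real.lt_sqrt_of_sq_lt
    rw [← Real.exp_nat_mul]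
    have e : ((2 : ℕ) : ℝ) * (ε * (1 - ε) / 2) = ε * (1 - ε) := by push_cast; ring
    rw [e]
    set y := ε * (1 - ε) with hy
    have h1 := Real.add_one_le_exp (-y)
    have h2 : Real.exp y * Real.exp (-y) = 1 := by rw [← Real.exp_add]; simp
    have h3 : 1 < (1 + ε) * (1 - y) := by
      have : (1 + ε) * (1 - y) = 1 + ε ^ 3 := by rw [hy]; ring
      rw [this]; have : 0 < ε ^ 3 := by positivity
      linarith
    have h4 : 0 < 1 - y := by nlinarith
    have h5 : Real.exp y * (1 - y) ≤ 1 := by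
      rw [← h2]; exact mul_le_mul_of_nonneg_left (by linarith) (Real.exp_pos _).le
    nlinarith
  · calc _ ≤ gb m {b | (-ε) * (N * (1 - ε) / 2) ≤ (-ε) * (b ⬝ᵥ b)} := by
          apply measure_mono
          intro b hb
          have hb' : √(b ⬝ᵥ b) < √(N * (1 - ε) / 2) := not_le.1 hb
          have := (Real.sqrt_lt_sqrt_iff (dot_nonneg b)).1 hb'
          exact mul_le_mul_of_nonpos_left this.le (by linarith)
      _ ≤ _ := chern m (-ε) _ (by linarith)
      _ ≤ _ := by
          apply ENNReal.ofReal_le_ofReal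
          rw [mul_pow, ← Real.exp_nat_mul, sub_neg_eq_add]
          have e : -(-ε * (N * (1 - ε) / 2)) = N * (ε * (1 - ε) / 2) := by ring
          rw [e, mul_left_comm]
          apply mul_le_mul_of_nonneg_left _ (Real.exp_pos _).le
          rw [inv_pow, inv_pow, ← div_eq_mul_inv, le_div_iff₀ (by positivity), ← div_eq_inv_mul,
            div_le_iff₀ (by positivity), ← pow_add]
          apply pow_le_pow_right₀ hs1; omega

lemma upper (D B : ℝ) (hB : 0 ≤ B) (N : ℕ) (p : ENNReal) (ha : g1 {a | |a| ≤ D}ᶜ ≤ p)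
    (hb : ∀ m ≤ N, gb m {b | √(b ⬝ᵥ b) ≤ B}ᶜ ≤ p) (n : ℕ) (hn : n + 1 ≤ N) (v : Fin (n + 1) → ℝ)
    (hv : v ⬝ᵥ v = 1) : goe (n + 1) {x | (v, x) ∉ AU (n + 1) D B} ≤ (n + 1 : ℕ) * (p + p) := by
  induction n with
  | zero =>
    have hmeas : MeasurableSet {x | (v, x) ∉ AU (0 + 1) D B} :=
      (measurable_prodMk_left (AU_closed 1 D B).measurableSet).compl
    conv_lhs => rw [goe]
    rw [Measure.map_apply measurable_asm hmeas]
    calc _ ≤ (g1.prod ((gb 0).prod (goe 0))) ({a | |a| ≤ D}ᶜ ×ˢ Set.univ) := by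
          apply measure_mono
          rintro ⟨a, b, x⟩ hx
          refine ⟨fun haD => hx ?_, trivial⟩
          have haD' : |a| ≤ D := haD
          intro σ
          simp only
          rw [q_asm]
          have h1 : b ⬝ᵥ Fin.tail σ = 0 := by simp [dotProduct]
          have h2 : q x (Fin.tail σ) = 0 := by simp [q, dotProduct]
          have h3 : σ ⬝ᵥ σ = σ 0 ^ 2 := by rw [dot_succ]; simp [dotProduct]
          rw [h1, h2, h3, mul_zero, add_zero, add_zero, abs_mul, abs_of_nonneg (sq_nonneg (σ 0))]
          have h4 := mul_le_mul_of_nonneg_right haD' (sq_nonneg (σ 0))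
          have h5 : 0 ≤ 2 * B * (√(σ 0 ^ 2) * √(σ 0 ^ 2 - (v ⬝ᵥ σ) ^ 2)) := by positivity
          linarith
      _ ≤ p := by rw [Measure.prod_prod]; simpa using ha
      _ ≤ _ := by simp
  | succ n ih =>
    have := step (AU (n + 1) D B) (AU_closed _ _ _).measurableSet (AU (n + 2) D B)
      (AU_closed _ _ _).measurableSet (fun O h1 _ v x h => AU_rot D B O h1 v x h)
      {a | |a| ≤ D} {b | √(b ⬝ᵥ b) ≤ B}
      (fun a b x u ha hb hu hbu h => AU_det D B a b u x ha hb hu hbu h)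
      _ (fun u hu => ih (by omega) u hu) v hv
    refine this.trans ?_
    calc _ ≤ p + p + (n + 1 : ℕ) * (p + p) := by gcongr; exact hb _ (by omega)
      _ = _ := by push_cast; ring

lemma lower (D B B' α : ℝ) (hB : 0 ≤ B) (hα : α ^ 2 ≤ 1) (N K : ℕ) (p p' : ENNReal)
    (ha : g1 {a | |a| ≤ D}ᶜ ≤ p)
    (hb : ∀ m ≤ N, gb m {b | √(b ⬝ᵥ b) ≤ B}ᶜ ≤ p)
    (hb' : ∀ m, N ≤ m + K → gb m {b | B' ≤ √(b ⬝ᵥ b)}ᶜ ≤ p') (n : ℕ) (hn : n + 2 + K = N)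
    (k : ℕ) (hk : k ≤ K) (d : ℕ) (hd : d = n + 1 + k) (v : Fin (d + 1) → ℝ)
    (hv : v ⬝ᵥ v = 1) : goe (d + 1) {x | (v, x) ∉ AL (d + 1) α
      ((2 * √(1 - α ^ 2) * B' - D) + (1 - α ^ 2) ^ k * (-(D + 2 * B) - (2 * √(1 - α ^ 2) * B' - D)))}
      ≤ N * (p + p) + k * (p + p') := by
  induction k generalizing d with
  | zero =>
    subst hd
    have h := upper D B hB N p ha hb (n + 1) (by omega) v hv
    calc _ ≤ goe (n + 2) {x | (v, x) ∉ AU (n + 2) D B} := by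
          apply measure_mono
          intro x hx h
          apply hx
          have := AL_base D B α hB hα v hv x h
          convert this using 2
          ring
      _ ≤ _ := h
      _ ≤ N * (p + p) := by gcongr; omega
      _ ≤ _ := by simp
  | succ k ih =>
    subst hd
    set g := 2 * √(1 - α ^ 2) * B' - D with hg
    have h := step (m := n + 1 + k)
      (AL (n + 1 + k + 1) α (g + (1 - α ^ 2) ^ k * (-(D + 2 * B) - g)))
      (AL_closed _ _ _).measurableSet
      (AL (n + 1 + k + 2) α (g + (1 - α ^ 2) ^ (k + 1) * (-(D + 2 * B) - g)))
      (AL_closed _ _ _).measurableSet (fun O _ h2 v x h => AL_rot α _ O h2 v x h)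
      {a | |a| ≤ D} {b | B' ≤ √(b ⬝ᵥ b)}
      (fun a b x u ha hb hu hbu h => by
        have := AL_det D B' _ α hα a b u x ha hb hbu h
        convert this using 2
        rw [hg]; ring)
      (N * (p + p) + k * (p + p')) (fun u hu => ih (by omega) _ rfl u hu) v hv
    refine h.trans ?_
    calc _ ≤ p + p' + (N * (p + p) + k * (p + p')) := by gcongr; exact hb' _ (by omega)
      _ = _ := by push_cast; ring

end GoePf

namespace GoePf

lemma real_bounds (δ α : ℝ) (h0 : 0 < δ) (h1 : δ < 1) (hα : α ^ 2 ≤ 1) :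
    √(2 * (1 + δ)) * √(1 - α ^ 2) ≤ √(2 * (1 - α ^ 2)) + 2 * δ ∧
    √(2 * (1 - α ^ 2)) - 2 * δ ≤ √(2 * (1 - δ)) * √(1 - α ^ 2) ∧
    √(2 * (1 + δ)) ≤ 2 ∧ √(2 * (1 - δ)) * √(1 - α ^ 2) ≤ 2 := by
  have hs0 : 0 ≤ √(1 - α ^ 2) := Real.sqrt_nonneg _
  have hs1 : √(1 - α ^ 2) ≤ 1 := by apply Real.sqrt_le_one.2; nlinarith [sq_nonneg α]
  have h2 : √2 ≤ 2 := by rw [Real.sqrt_le_left (by norm_num)]; norm_num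
  have h20 : 0 ≤ √2 := Real.sqrt_nonneg _
  have ha : √(1 + δ) ≤ 1 + δ := by rw [Real.sqrt_le_left (by linarith)]; nlinarith
  have hb : 1 - δ ≤ √(1 - δ) := by apply Real.le_sqrt_of_sq_le; nlinarith
  have hb1 : √(1 - δ) ≤ 1 := by apply Real.sqrt_le_one.2; linarith
  have hb0 : 0 ≤ √(1 - δ) := Real.sqrt_nonneg _
  rw [Real.sqrt_mul (by norm_num), Real.sqrt_mul (by norm_num), Real.sqrt_mul (by norm_num)]
  have hprod : √2 * √(1 - α ^ 2) ≤ 2 := by nlinarith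
  have hprod0 : 0 ≤ √2 * √(1 - α ^ 2) := by positivity
  refine ⟨?_, ?_, ?_, ?_⟩
  · have := mul_le_mul_of_nonneg_left ha hprod0
    nlinarith
  · have := mul_le_mul_of_nonneg_left hb hprod0
    nlinarith
  · rw [← Real.sqrt_mul (by norm_num), Real.sqrt_le_left (by norm_num)]; linarith
  · have := mul_le_mul_of_nonneg_left hb1 hprod0
    nlinarith

lemma det_final (β : ℝ) (hβ : 0 < β) (f : ℝ → ℝ) (Mx ε δ α : ℝ) (K N : ℕ) (hN : 1 ≤ N)
    (hM : ∀ a ∈ Set.Icc (-1 : ℝ) 1, f a + β * √(2 * (1 - a ^ 2)) ≤ Mx)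
    (h0 : 0 < δ) (h1 : δ < 1) (hε : 0 < ε) (hα : α ^ 2 ≤ 1) (hδ : 3 * β * δ ≤ ε / 4)
    (hK : 5 * β * (1 - α ^ 2) ^ K ≤ ε / 4)
    (hαM : Mx - ε / 4 ≤ f α + β * √(2 * (1 - α ^ 2)))
    (v : Fin N → ℝ) (hv : v ⬝ᵥ v = 1) (x : M N)
    (hU : (v, x) ∈ AU N (δ * √N) √(N * (1 + δ) / 2))
    (hL : (v, x) ∈ AL N α ((2 * √(1 - α ^ 2) * √(N * (1 - δ) / 2) - δ * √N) + (1 - α ^ 2) ^ K *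
      (-(δ * √N + 2 * √(N * (1 + δ) / 2)) - (2 * √(1 - α ^ 2) * √(N * (1 - δ) / 2) - δ * √N)))) :
    |sSup {y : ℝ | ∃ σ : Fin N → ℝ, σ ⬝ᵥ σ = 1 ∧
        y = β * (√N * q x σ) + N * f (v ⬝ᵥ σ)} / N - Mx| < ε := by
  have hN0 : (0 : ℝ) < N := by exact_mod_cast hN
  have hsq : √(N : ℝ) * √N = N := Real.mul_self_sqrt hN0.le
  have hs0 : 0 ≤ √(N : ℝ) := Real.sqrt_nonneg _
  have hconv : ∀ z : ℝ, 0 ≤ z → 2 * √(N * z / 2) = √N * √(2 * z) := by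
    intro z hz
    rw [← Real.sqrt_mul hN0.le]
    have : (N : ℝ) * (2 * z) = 2 ^ 2 * (N * z / 2) := by ring
    rw [this, Real.sqrt_mul (by norm_num), Real.sqrt_sq (by norm_num)]
  have c1 := hconv (1 + δ) (by linarith)
  have c2 := hconv (1 - δ) (by linarith)
  set S := {y : ℝ | ∃ σ : Fin N → ℝ, σ ⬝ᵥ σ = 1 ∧ y = β * (√N * q x σ) + N * f (v ⬝ᵥ σ)} with hS
  have ub : ∀ y ∈ S, y ≤ N * (Mx + ε / 4) := by
    rintro y ⟨σ, hσ, rfl⟩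
    have hc := cs v σ
    rw [hv, hσ, one_mul] at hc
    have hq := (abs_le.1 (hU σ)).2
    simp only at hq
    rw [hσ, Real.sqrt_one, c1] at hq
    have hm := hM (v ⬝ᵥ σ) (abs_le.1 ((sq_le_one_iff_abs_le_one _).1 hc))
    have hr := (real_bounds δ (v ⬝ᵥ σ) h0 h1 hc).1
    have hq2 : q x σ ≤ √N * (√(2 * (1 - (v ⬝ᵥ σ) ^ 2)) + 3 * δ) := by
      have := mul_le_mul_of_nonneg_left hr hs0
      linarith
    have hq3 := mul_le_mul_of_nonneg_left hq2 hs0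
    rw [← mul_assoc, hsq] at hq3
    have hq4 := mul_le_mul_of_nonneg_left hq3 hβ.le
    have hm2 := mul_le_mul_of_nonneg_left hm hN0.le
    have hd2 := mul_le_mul_of_nonneg_left hδ hN0.le
    linarith
  have hbdd : BddAbove S := ⟨_, ub⟩
  obtain ⟨σ, hσ, hvσ, hqσ⟩ := hL
  simp only at hvσ hqσ
  have hmem : β * (√N * q x σ) + N * f (v ⬝ᵥ σ) ∈ S := ⟨σ, hσ, rfl⟩
  have hle := le_csSup hbdd hmem
  have hge : sSup S ≤ N * (Mx + ε / 4) := csSup_le ⟨_, hmem⟩ ub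
  have hlow : N * (Mx - 3 * ε / 4) ≤ β * (√N * q x σ) + N * f (v ⬝ᵥ σ) := by
    rw [hvσ]
    obtain ⟨_, r2, r3, r4⟩ := real_bounds δ α h0 h1 hα
    have hρ : 0 ≤ (1 - α ^ 2) ^ K := pow_nonneg (by linarith) _
    have e : (2 * √(1 - α ^ 2) * √(N * (1 - δ) / 2) - δ * √N) + (1 - α ^ 2) ^ K *
      (-(δ * √N + 2 * √(N * (1 + δ) / 2)) - (2 * √(1 - α ^ 2) * √(N * (1 - δ) / 2) - δ * √N))
      = √N * ((√(2 * (1 - δ)) * √(1 - α ^ 2) - δ) + (1 - α ^ 2) ^ K *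
        (-√(2 * (1 + δ)) - √(2 * (1 - δ)) * √(1 - α ^ 2))) := by
      rw [show 2 * √(1 - α ^ 2) * √(N * (1 - δ) / 2) = √(1 - α ^ 2) * (2 * √(N * (1 - δ) / 2)) by ring,
        c1, c2]; ring
    rw [e] at hqσ
    have k1 : (1 - α ^ 2) ^ K * (-5) ≤ (1 - α ^ 2) ^ K *
        (-√(2 * (1 + δ)) - √(2 * (1 - δ)) * √(1 - α ^ 2)) :=
      mul_le_mul_of_nonneg_left (by linarith) hρ
    have k2 : √N * (√(2 * (1 - α ^ 2)) - 3 * δ - 5 * (1 - α ^ 2) ^ K) ≤ q x σ :=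
      le_trans (mul_le_mul_of_nonneg_left (by linarith) hs0) hqσ
    have k3 := mul_le_mul_of_nonneg_left k2 hs0
    rw [← mul_assoc, hsq] at k3
    have k4 := mul_le_mul_of_nonneg_left k3 hβ.le
    have m1 := mul_le_mul_of_nonneg_left hδ hN0.le
    have m2 := mul_le_mul_of_nonneg_left hK hN0.le
    have m3 := mul_le_mul_of_nonneg_left hαM hN0.le
    linarith
  have f1 : sSup S / N ≤ Mx + ε / 4 := by rw [div_le_iff₀ hN0]; linarith
  have f2 : Mx - 3 * ε / 4 ≤ sSup S / N := by rw [le_div_iff₀ hN0]; linarith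
  rw [abs_lt]; constructor <;> linarith

lemma choose_alpha (β : ℝ) (f : ℝ → ℝ) (hf : ContinuousOn f (Set.Icc (-1) 1)) (ε : ℝ) (hε : 0 < ε) :
    ∃ α ∈ Set.Icc (-1 : ℝ) 1, α ≠ 0 ∧
      sSup ((fun α => f α + β * √(2 * (1 - α ^ 2))) '' Set.Icc (-1) 1) - ε ≤ f α + β * √(2 * (1 - α ^ 2)) := by
  set g := fun α => f α + β * √(2 * (1 - α ^ 2)) with hg
  have hgc : ContinuousOn g (Set.Icc (-1) 1) := by
    apply hf.add
    apply Continuous.continuousOn; fun_prop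
  obtain ⟨a, ha, hmax⟩ := isCompact_Icc.exists_isMaxOn (Set.nonempty_Icc.2 (by norm_num : (-1 : ℝ) ≤ 1)) hgc
  have hsup : sSup (g '' Set.Icc (-1) 1) ≤ g a := by
    apply csSup_le ((Set.nonempty_Icc.2 (by norm_num : (-1 : ℝ) ≤ 1)).image g)
    rintro _ ⟨b, hb, rfl⟩
    exact hmax hb
  by_cases h0 : a = 0
  · subst h0
    have hn : Set.Icc (-1 : ℝ) 1 ∈ nhds (0 : ℝ) := Icc_mem_nhds (by norm_num) (by norm_num)
    have hca : ContinuousAt g 0 := hgc.continuousAt hn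
    have h1 : ∀ᶠ b in nhds (0 : ℝ), g 0 - ε < g b := hca.eventually (lt_mem_nhds (by linarith))
    have h2 : ∀ᶠ b in nhdsWithin (0 : ℝ) {0}ᶜ, (g 0 - ε < g b ∧ b ∈ Set.Icc (-1 : ℝ) 1) ∧ b ∈ ({0}ᶜ : Set ℝ) :=
      ((h1.and hn).filter_mono nhdsWithin_le_nhds).and self_mem_nhdsWithin
    obtain ⟨b, ⟨hb1, hb2⟩, hb3⟩ := h2.exists
    exact ⟨b, hb2, hb3, by change _ ≤ g b; linarith⟩
  · exact ⟨a, ha, h0, by change _ ≤ g a; linarith⟩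

end GoePf

/-- Theorem: Maximum on sphere, leading order:
`L_N / N` converges in probability to `sup_{α ∈ [-1,1]} (f α + β √(2(1-α²)))`. -/
theorem stmt_0
    (Ω : ℕ → Type*) [∀ N, MeasurableSpace (Ω N)]
    (P : ∀ N, Measure (Ω N)) (hP : ∀ N, IsProbabilityMeasure (P N))
    (J : ∀ N, Ω N → Matrix (Fin N) (Fin N) ℝ)
    (hJ : ∀ N, 1 ≤ N → IsGOE (P N) (J N))
    (β : ℝ) (hβ : 0 < β)
    (v : ∀ N, Fin N → ℝ) (hv : ∀ N, 1 ≤ N → ∑ i, v N i ^ 2 = 1)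
    (f : ℝ → ℝ) (hf : ContinuousOn f (Set.Icc (-1) 1))
    (L : ∀ N, Ω N → ℝ)
    (hL : ∀ N ω, L N ω =
      sSup {y : ℝ | ∃ σ : Fin N → ℝ, ∑ i, σ i ^ 2 = 1 ∧
        y = β * (Real.sqrt N * (σ ⬝ᵥ (J N ω) *ᵥ σ)) + N * f (v N ⬝ᵥ σ)}) :
    ∀ ε > 0, Tendsto
      (fun N => P N {ω | ε ≤ |L N ω / N -
        sSup ((fun α => f α + β * Real.sqrt (2 * (1 - α ^ 2))) '' Set.Icc (-1) 1)|})
      atTop (nhds 0) := by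
  intro ε hε
  set Mx := sSup ((fun α => f α + β * Real.sqrt (2 * (1 - α ^ 2))) '' Set.Icc (-1) 1) with hMx
  have hM : ∀ a ∈ Set.Icc (-1 : ℝ) 1, f a + β * √(2 * (1 - a ^ 2)) ≤ Mx := by
    intro a ha
    refine le_csSup ?_ (Set.mem_image_of_mem (fun α => f α + β * Real.sqrt (2 * (1 - α ^ 2))) ha)
    apply (isCompact_Icc.image_of_continuousOn _).bddAbove
    apply hf.add
    apply Continuous.continuousOn; fun_prop
  obtain ⟨α, hαI, hα0, hαM⟩ := GoePf.choose_alpha β f hf (ε / 4) (by linarith)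
  rw [← hMx] at hαM
  have hα : α ^ 2 ≤ 1 := by nlinarith [hαI.1, hαI.2]
  obtain ⟨δ, h0, h1, hδ⟩ : ∃ δ : ℝ, 0 < δ ∧ δ < 1 ∧ 3 * β * δ ≤ ε / 4 := by
    refine ⟨min (1/2) (ε / (12 * β)), by positivity, by
      exact lt_of_le_of_lt (min_le_left _ _) (by norm_num), ?_⟩
    calc 3 * β * min (1/2) (ε / (12 * β)) ≤ 3 * β * (ε / (12 * β)) := by
          gcongr; exact min_le_right _ _
      _ = ε / 4 := by field_simp; norm_num
  obtain ⟨K, hK⟩ : ∃ K : ℕ, 5 * β * (1 - α ^ 2) ^ K ≤ ε / 4 := by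
    have hpos : 0 < α ^ 2 := by positivity
    obtain ⟨K, hK⟩ := exists_pow_lt_of_lt_one (show 0 < ε / (20 * β) by positivity)
      (show 1 - α ^ 2 < 1 by linarith)
    refine ⟨K, ?_⟩
    calc 5 * β * (1 - α ^ 2) ^ K ≤ 5 * β * (ε / (20 * β)) := by gcongr
      _ = ε / 4 := by field_simp; norm_num
  obtain ⟨C1, r1, hC1, hr1, hr1', t1⟩ := GoePf.tailA δ h0
  obtain ⟨r2, hr2, hr2', t2⟩ := GoePf.tailU δ h0
  obtain ⟨C3, r3, hC3, hr3, hr3', t3⟩ := GoePf.tailL δ h0 h1 K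
  have hbound : ∀ᶠ N : ℕ in atTop, P N {ω | ε ≤ |L N ω / N - Mx|} ≤
      ENNReal.ofReal (N * ((C1 * r1 ^ N + r2 ^ N) + (C1 * r1 ^ N + r2 ^ N)) +
       (N * ((C1 * r1 ^ N + r2 ^ N) + (C1 * r1 ^ N + r2 ^ N)) +
         K * ((C1 * r1 ^ N + r2 ^ N) + C3 * r3 ^ N))) := by
    filter_upwards [eventually_ge_atTop (K + 2)] with N hN
    obtain ⟨n, rfl⟩ : ∃ n, N = n + 1 + K + 1 := ⟨N - (K + 2), by omega⟩
    set N := n + 1 + K + 1 with hNdef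
    have hN1 : 1 ≤ N := by omega
    have hv' : v N ⬝ᵥ v N = 1 := by
      rw [← hv N hN1]; simp only [dotProduct, pow_two]
    have := hP N
    set p := ENNReal.ofReal (C1 * r1 ^ N + r2 ^ N) with hp
    set p' := ENNReal.ofReal (C3 * r3 ^ N) with hp'
    have s1 : GoePf.g1 {a | |a| ≤ δ * √(N : ℝ)}ᶜ ≤ p :=
      (t1 N).trans (ENNReal.ofReal_le_ofReal (by linarith [pow_nonneg hr2 N]))
    have s2 : ∀ m ≤ N, GoePf.gb m {b | √(b ⬝ᵥ b) ≤ √(N * (1 + δ) / 2)}ᶜ ≤ p := fun m hm =>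
      (t2 N m hm).trans (ENNReal.ofReal_le_ofReal (by linarith [mul_nonneg hC1 (pow_nonneg hr1 N)]))
    have b1 := GoePf.upper (δ * √(N : ℝ)) (√(N * (1 + δ) / 2)) (Real.sqrt_nonneg _) N p s1 s2 (n + 1 + K)
      le_rfl (v N) hv'
    have b2 := GoePf.lower (δ * √(N : ℝ)) (√(N * (1 + δ) / 2)) (√(N * (1 - δ) / 2)) α (Real.sqrt_nonneg _) hα
      N K p p' s1 s2 (fun m hm => t3 N m hm) n (by omega) K le_rfl (n + 1 + K) rfl (v N) hv'
    change GoePf.goe N {x | (v N, x) ∉ GoePf.AU N _ _} ≤ (N : ENNReal) * (p + p) at b1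
    change GoePf.goe N {x | (v N, x) ∉ GoePf.AL N _ _} ≤ _ at b2
    have hE : ENNReal.ofReal (N * ((C1 * r1 ^ N + r2 ^ N) + (C1 * r1 ^ N + r2 ^ N)) +
       (N * ((C1 * r1 ^ N + r2 ^ N) + (C1 * r1 ^ N + r2 ^ N)) +
         K * ((C1 * r1 ^ N + r2 ^ N) + C3 * r3 ^ N))) =
        N * (p + p) + (N * (p + p) + K * (p + p')) := by
      rw [ENNReal.ofReal_add (by positivity) (by positivity), ENNReal.ofReal_add (by positivity) (by positivity),
        ENNReal.ofReal_mul (by positivity), ENNReal.ofReal_mul (by positivity),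
        ENNReal.ofReal_add (by positivity) (by positivity), ENNReal.ofReal_add (p := C1 * r1 ^ N + r2 ^ N) (q := C3 * r3 ^ N) (by positivity) (by positivity),
        ENNReal.ofReal_natCast, ENNReal.ofReal_natCast]
    rw [hE]
    refine le_trans ?_ (add_le_add b1 b2)
    rw [← GoePf.law (P N) (J N) (hJ N hN1)]
    have hmJ : Measurable (fun ω => (fun i j => J N ω i j : GoePf.M N)) :=
      measurable_pi_lambda _ fun i => measurable_pi_lambda _ fun j => (hJ N hN1).2.1 i j
    refine le_trans ?_ (add_le_add (Measure.le_map_apply hmJ.aemeasurable _)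
      (Measure.le_map_apply hmJ.aemeasurable _))
    refine le_trans (measure_mono ?_) (measure_union_le _ _)
    intro ω hω
    by_contra hcon
    simp only [Set.mem_union, Set.mem_preimage, Set.mem_ofPred_eq, not_or, not_not] at hcon
    have hfin := GoePf.det_final β hβ f Mx ε δ α K N hN1 hM h0 h1 hε hα hδ hK hαM (v N) hv' _ hcon.1 hcon.2
    have hω' : ε ≤ |L N ω / N - Mx| := hω
    rw [hL] at hω'
    have hset : {y : ℝ | ∃ σ : Fin N → ℝ, ∑ i, σ i ^ 2 = 1 ∧
        y = β * (Real.sqrt N * (σ ⬝ᵥ (J N ω) *ᵥ σ)) + N * f (v N ⬝ᵥ σ)} =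
        {y : ℝ | ∃ σ : Fin N → ℝ, σ ⬝ᵥ σ = 1 ∧
        y = β * (√N * GoePf.q (fun i j => J N ω i j) σ) + N * f (v N ⬝ᵥ σ)} := by
      ext y
      simp only [Set.mem_ofPred_eq, dotProduct, pow_two]
      rfl
    rw [hset] at hω'
    exact absurd hω' (not_le.2 hfin)
  refine tendsto_of_tendsto_of_tendsto_of_le_of_le' tendsto_const_nhds ?_
    (Eventually.of_forall fun _ => zero_le) hbound
  rw [← ENNReal.ofReal_zero]
  apply ENNReal.tendsto_ofReal
  have a1 := tendsto_self_mul_const_pow_of_lt_one hr1 hr1'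
  have a2 := tendsto_self_mul_const_pow_of_lt_one hr2 hr2'
  have c1 := tendsto_pow_atTop_nhds_zero_of_lt_one hr1 hr1'
  have c2 := tendsto_pow_atTop_nhds_zero_of_lt_one hr2 hr2'
  have c3 := tendsto_pow_atTop_nhds_zero_of_lt_one hr3 hr3'
  have tot := (((a1.const_mul C1).add a2).const_mul 4).add
    ((((c1.const_mul C1).add c2).add (c3.const_mul C3)).const_mul (K : ℝ))
  simp only [mul_zero, add_zero] at tot
  refine tot.congr fun N => ?_
  ring
end

section
/- Let J be an N×N GOE random matrix, β > 0, v ∈ ℝ^N a unit vector, 𝓡 ⊂ [0,1] closed, f : [-1,1] → ℝ continuous and g : 𝓡 → ℝ continuous. Define L̃_N = sup_{m ∈ ℝ^N, |m| ∈ 𝓡} { β H_N(m) + N f(v·m) + N g(|m|) } where H_N(m) = √N mᵀ J m, and define 𝓑̃(α,r) = f(rα) + g(r) + β r² √(2(1-α²)) for (α,r) ∈ [-1,1] × 𝓡. Then L̃_N/N converges in probability, as N → ∞, to sup_{r ∈ 𝓡, α ∈ [-1,1]} 𝓑̃(α,r). -/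
open MeasureTheory ProbabilityTheory Filter Matrix

noncomputable abbrev gam (κ : Type*) [Fintype κ] : Measure (κ → ℝ) :=
  Measure.pi (fun _ : κ => gaussianReal 0 1)

lemma hasDerivAt_pdf (x : ℝ) :
    HasDerivAt (gaussianPDFReal 0 1) (-(x * gaussianPDFReal 0 1 x)) x := by
  have h : gaussianPDFReal 0 1 = fun x => (Real.sqrt (2 * Real.pi * (1 : NNReal)))⁻¹ *
      Real.exp (-(x - 0) ^ 2 / (2 * (1 : NNReal))) := by
    ext x; simp [gaussianPDFReal]
  rw [h]
  have h1 : HasDerivAt (fun x : ℝ => -(x - 0) ^ 2 / (2 * (1 : NNReal))) (-x) x := by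
    have := (((hasDerivAt_id x).pow 2).neg.div_const (2 * ((1 : NNReal) : ℝ)))
    refine (this.congr_deriv ?_).congr_of_eventuallyEq ?_
    · simp; ring
    · filter_upwards with y
      simp
  refine (h1.exp.const_mul ((Real.sqrt (2 * Real.pi * (1 : NNReal)))⁻¹)).congr_deriv ?_
  ring

lemma integrable_pdf_iff (f : ℝ → ℝ) (hf : Integrable f (gaussianReal 0 1)) :
    Integrable (fun x => gaussianPDFReal 0 1 x * f x) := by
  rw [gaussianReal_of_var_ne_zero _ one_ne_zero] at hf
  rw [integrable_withDensity_iff_integrable_smul' (measurable_gaussianPDF _ _)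
    (ae_of_all _ fun _ => gaussianPDF_lt_top)] at hf
  simpa using hf

lemma integrable_gauss_id : Integrable (fun x : ℝ => x) (gaussianReal 0 1) := by
  have := (memLp_id_gaussianReal (μ := 0) (v := 1) 1)
  have h2 := this.integrable le_rfl
  exact h2

lemma ibp1 (φ φ' : ℝ → ℝ) (C : ℝ) (h : ∀ x, HasDerivAt φ (φ' x) x)
    (h1 : ∀ x, |φ x| ≤ C) (h2 : ∀ x, |φ' x| ≤ C) (hc : Continuous φ') :
    ∫ x, x * φ x ∂(gaussianReal 0 1) = ∫ x, φ' x ∂(gaussianReal 0 1) := by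
  have hφc : Continuous φ := continuous_iff_continuousAt.2 fun x => (h x).continuousAt
  rw [integral_gaussianReal_eq_integral_smul one_ne_zero,
    integral_gaussianReal_eq_integral_smul one_ne_zero]
  have i1 : Integrable (fun x => x * φ x) (gaussianReal 0 1) :=
    integrable_gauss_id.mul_bdd (c := C) hφc.aestronglyMeasurable (ae_of_all _ h1)
  have i2 : Integrable φ (gaussianReal 0 1) :=
    Integrable.of_bound hφc.aestronglyMeasurable C (ae_of_all _ h1)
  have i3 : Integrable φ' (gaussianReal 0 1) :=
    Integrable.of_bound hc.aestronglyMeasurable C (ae_of_all _ h2)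
  have := integral_mul_deriv_eq_deriv_mul_of_integrable (u := φ) (u' := φ')
    (v := gaussianPDFReal 0 1) (v' := fun x => -(x * gaussianPDFReal 0 1 x))
    (fun x _ => h x) (fun x _ => hasDerivAt_pdf x) ?_ ?_ ?_
  · have e1 : ∀ x, gaussianPDFReal 0 1 x • (x * φ x) = -(φ x * -(x * gaussianPDFReal 0 1 x)) := by
      intro x; simp; ring
    simp_rw [e1]
    rw [integral_neg, this, neg_neg]
    congr 1; ext x; simp; ring
  · have := (integrable_pdf_iff _ i1).neg
    convert this using 1
    ext x; simp; ring
  · convert (integrable_pdf_iff _ i3) using 1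
    ext x; simp; ring
  · convert (integrable_pdf_iff _ i2) using 1
    ext x; simp; ring

lemma map_update {κ : Type*} [Fintype κ] [DecidableEq κ] (k : κ) :
    MeasurePreserving (fun p : (κ → ℝ) × ℝ => Function.update p.1 k p.2)
      ((gam κ).prod (gaussianReal 0 1)) (gam κ) := by
  have hm : Measurable (fun p : (κ → ℝ) × ℝ => Function.update p.1 k p.2) := by
    refine measurable_pi_iff.2 fun j => ?_
    by_cases hj : j = k
    · subst hj; simpa using measurable_snd
    · simp only [Function.update_of_ne hj]
      exact (measurable_pi_apply j).comp measurable_fst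
  refine ⟨hm, ?_⟩
  symm
  apply Measure.pi_eq
  intro s hs
  rw [Measure.map_apply hm (MeasurableSet.univ_pi hs)]
  have : (fun p : (κ → ℝ) × ℝ => Function.update p.1 k p.2) ⁻¹' (Set.univ.pi s) =
      (Set.univ.pi (Function.update s k Set.univ)) ×ˢ s k := by
    ext ⟨z, t⟩
    simp only [Set.mem_preimage, Set.mem_pi, Set.mem_univ, true_imp_iff, Set.mem_prod]
    constructor
    · intro h
      refine ⟨fun j => ?_, by simpa using h k⟩
      by_cases hj : j = k
      · subst hj; simp
      · simpa [Function.update_of_ne hj] using h j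
    · rintro ⟨h, h'⟩ j
      by_cases hj : j = k
      · subst hj; simpa using h'
      · simpa [Function.update_of_ne hj] using h j
  rw [this, Measure.prod_prod, Measure.pi_pi,
    ← Finset.mul_prod_erase _ _ (Finset.mem_univ k),
    ← Finset.mul_prod_erase _ (fun i => gaussianReal 0 1 (s i)) (Finset.mem_univ k)]
  simp only [Function.update_self, measure_univ, one_mul]
  rw [mul_comm]
  congr 1
  refine Finset.prod_congr rfl fun j hj => ?_
  rw [Function.update_of_ne (Finset.ne_of_mem_erase hj)]

lemma integrable_coord {κ : Type*} [Fintype κ] (k : κ) :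
    Integrable (fun z : κ → ℝ => z k) (gam κ) :=
  (measurePreserving_eval (fun _ : κ => gaussianReal 0 1) k).integrable_comp_of_integrable
    integrable_gauss_id

lemma ibp_pi {κ : Type*} [Fintype κ] [DecidableEq κ] (k : κ) (G G' : (κ → ℝ) → ℝ) (C : ℝ)
    (h : ∀ z, HasDerivAt (fun t => G (Function.update z k t)) (G' z) (z k))
    (hG : Continuous G) (hG' : Continuous G')
    (h1 : ∀ x, |G x| ≤ C) (h2 : ∀ x, |G' x| ≤ C) :
    ∫ z, z k * G z ∂(gam κ) = ∫ z, G' z ∂(gam κ) := by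
  have mp := map_update k
  have i1 : Integrable (fun z => z k * G z) (gam κ) :=
    (integrable_coord k).mul_bdd (c := C) hG.aestronglyMeasurable (ae_of_all _ h1)
  have i3 : Integrable G' (gam κ) :=
    Integrable.of_bound hG'.aestronglyMeasurable C (ae_of_all _ h2)
  have e1 := mp.map_eq
  rw [← e1, integral_map mp.measurable.aemeasurable (by rw [e1]; exact i1.aestronglyMeasurable),
    integral_map mp.measurable.aemeasurable (by rw [e1]; exact i3.aestronglyMeasurable)]
  have j1 := mp.integrable_comp_of_integrable i1
  have j3 := mp.integrable_comp_of_integrable i3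
  simp only [Function.comp_def] at j1 j3
  rw [integral_prod _ j1, integral_prod _ j3]
  congr 1; ext z
  simp only [Function.update_self]
  refine ibp1 (fun t => G (Function.update z k t)) (fun t => G' (Function.update z k t)) C ?_
    (fun _ => h1 _) (fun _ => h2 _) (hG'.comp (continuous_const.update k continuous_id))
  intro x
  have := h (Function.update z k x)
  simpa using this

section slep
set_option linter.unusedSectionVars false
variable {ι κ : Type*} [Fintype ι] [DecidableEq ι] [Fintype κ] [DecidableEq κ]

noncomputable def lin (c : κ → ℝ) (z : κ → ℝ) : ℝ := ∑ k, c k * z k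

lemma continuous_lin (c : κ → ℝ) : Continuous (lin c) := by
  unfold lin; fun_prop

lemma lin_update (c z : κ → ℝ) (k : κ) (t : ℝ) :
    lin c (Function.update z k t) = lin c z + c k * (t - z k) := by
  have : ∀ j, c j * Function.update z k t j = c j * z j + if j = k then c k * (t - z k) else 0 := by
    intro j
    by_cases h : j = k
    · subst h; simp; ring
    · simp [h]
  simp [lin, this, Finset.sum_add_distrib]

lemma hasDerivAt_lin (c z : κ → ℝ) (k : κ) :
    HasDerivAt (fun t => lin c (Function.update z k t)) (c k) (z k) := by
  simp_rw [lin_update]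
  simpa using (((hasDerivAt_id (z k)).sub_const (z k)).const_mul (c k)).const_add (lin c z)

lemma prod_bd (h : ι → ℝ → ℝ) (h01 : ∀ s x, 0 ≤ h s x ∧ h s x ≤ 1) (S : Finset ι) (x : ι → ℝ) :
    0 ≤ ∏ t ∈ S, h t (x t) ∧ ∏ t ∈ S, h t (x t) ≤ 1 :=
  ⟨Finset.prod_nonneg fun t _ => (h01 t _).1,
   Finset.prod_le_one (fun t _ => (h01 t _).1) fun t _ => (h01 t _).2⟩

lemma slep_ibp (h h' h'' : ι → ℝ → ℝ) (C : ℝ)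
    (h01 : ∀ s x, 0 ≤ h s x ∧ h s x ≤ 1)
    (d1 : ∀ s x, HasDerivAt (h s) (h' s x) x) (d2 : ∀ s x, HasDerivAt (h' s) (h'' s x) x)
    (b1 : ∀ s x, |h' s x| ≤ C) (b2 : ∀ s x, |h'' s x| ≤ C) (hc : ∀ s, Continuous (h'' s))
    (c : ι → κ → ℝ) (s : ι) (k : κ) :
    ∫ z, z k * (h' s (lin (c s) z) * ∏ t ∈ Finset.univ.erase s, h t (lin (c t) z)) ∂(gam κ) =
    ∫ z, (h'' s (lin (c s) z) * c s k * (∏ t ∈ Finset.univ.erase s, h t (lin (c t) z)) +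
      h' s (lin (c s) z) * ∑ t ∈ Finset.univ.erase s,
        (∏ u ∈ (Finset.univ.erase s).erase t, h u (lin (c u) z)) * (h' t (lin (c t) z) * c t k))
      ∂(gam κ) := by
  have ch : ∀ s, Continuous (h s) :=
    fun s => continuous_iff_continuousAt.2 fun x => (d1 s x).continuousAt
  have ch' : ∀ s, Continuous (h' s) :=
    fun s => continuous_iff_continuousAt.2 fun x => (d2 s x).continuousAt
  have hC : 0 ≤ C := (abs_nonneg _).trans (b1 s 0)
  have cl := fun s => continuous_lin (c s)
  refine ibp_pi k _ _ (C + C * |c s k| + C * ∑ t, C * |c t k|) ?_ ?_ ?_ ?_ ?_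
  · intro z
    have e : ∀ t, z k = z k → lin (c t) (Function.update z k (z k)) = lin (c t) z := by
      intro t _; simp
    have a1 : HasDerivAt (fun t => h' s (lin (c s) (Function.update z k t)))
        (h'' s (lin (c s) z) * c s k) (z k) := by
      have := d2 s (lin (c s) (Function.update z k (z k)))
      have := this.comp (z k) (hasDerivAt_lin (c s) z k)
      simpa [Function.comp_def] using this
    have a2 : ∀ u, HasDerivAt (fun t => h u (lin (c u) (Function.update z k t)))
        (h' u (lin (c u) z) * c u k) (z k) := by
      intro u
      have := d1 u (lin (c u) (Function.update z k (z k)))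
      have := this.comp (z k) (hasDerivAt_lin (c u) z k)
      simpa [Function.comp_def] using this
    have a3 := a1.mul (HasDerivAt.fun_finsetProd (u := Finset.univ.erase s) fun u _ => a2 u)
    simp only [Function.update_eq_self, smul_eq_mul] at a3
    exact a3
  · exact ((ch' s).comp (cl s)).mul (continuous_finsetProd _ fun t _ => (ch t).comp (cl t))
  · refine ((((hc s).comp (cl s)).mul continuous_const).mul
      (continuous_finsetProd _ fun t _ => (ch t).comp (cl t))).add
      (((ch' s).comp (cl s)).mul (continuous_finsetSum _ fun t _ =>
        (continuous_finsetProd _ fun u _ => (ch u).comp (cl u)).mul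
        (((ch' t).comp (cl t)).mul continuous_const)))
  · intro z
    rw [abs_mul]
    have p := prod_bd h h01 (Finset.univ.erase s) (fun t => lin (c t) z)
    rw [abs_of_nonneg p.1]
    have : |h' s (lin (c s) z)| * ∏ t ∈ Finset.univ.erase s, h t (lin (c t) z) ≤ C * 1 :=
      mul_le_mul (b1 _ _) p.2 p.1 hC
    have q1 : 0 ≤ C * |c s k| := by positivity
    have q2 : 0 ≤ C * ∑ t, C * |c t k| := by positivity
    linarith
  · intro z
    have p := prod_bd h h01 (Finset.univ.erase s) (fun t => lin (c t) z)
    refine (abs_add_le _ _).trans ?_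
    rw [abs_mul, abs_mul, abs_mul, abs_of_nonneg p.1]
    have r1 : |h'' s (lin (c s) z)| * |c s k| * ∏ t ∈ Finset.univ.erase s, h t (lin (c t) z)
        ≤ C * |c s k| * 1 :=
      mul_le_mul (mul_le_mul_of_nonneg_right (b2 _ _) (abs_nonneg _)) p.2 p.1 (by positivity)
    have r2 : |∑ t ∈ Finset.univ.erase s,
        (∏ u ∈ (Finset.univ.erase s).erase t, h u (lin (c u) z)) * (h' t (lin (c t) z) * c t k)|
        ≤ ∑ t, C * |c t k| := by
      refine (Finset.abs_sum_le_sum_abs _ _).trans ?_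
      refine (Finset.sum_le_univ_sum_of_nonneg fun _ => abs_nonneg _).trans ?_
      refine Finset.sum_le_sum fun t _ => ?_
      have p := prod_bd h h01 ((Finset.univ.erase s).erase t) (fun t => lin (c t) z)
      rw [abs_mul, abs_mul, abs_of_nonneg p.1]
      calc _ ≤ 1 * (C * |c t k|) := mul_le_mul p.2
            (mul_le_mul_of_nonneg_right (b1 _ _) (abs_nonneg _)) (by positivity) zero_le_one
        _ = _ := one_mul _
    have r3 := mul_le_mul (b1 s (lin (c s) z)) r2 (abs_nonneg _) hC
    linarith

lemma slep_deriv_nonpos (h h' h'' : ι → ℝ → ℝ) (C : ℝ)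
    (h01 : ∀ s x, 0 ≤ h s x ∧ h s x ≤ 1)
    (d1 : ∀ s x, HasDerivAt (h s) (h' s x) x) (d2 : ∀ s x, HasDerivAt (h' s) (h'' s x) x)
    (b1 : ∀ s x, |h' s x| ≤ C) (b2 : ∀ s x, |h'' s x| ≤ C) (hc : ∀ s, Continuous (h'' s))
    (hneg : ∀ s x, h' s x ≤ 0)
    (c d : ι → κ → ℝ) (hd : ∀ s, ∑ k, d s k * c s k = 0)
    (hdt : ∀ s t, ∑ k, d s k * c t k ≤ 0) :
    ∫ z, ∑ s, (∏ t ∈ Finset.univ.erase s, h t (lin (c t) z)) *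
      (h' s (lin (c s) z) * lin (d s) z) ∂(gam κ) ≤ 0 := by
  have ch : ∀ s, Continuous (h s) :=
    fun s => continuous_iff_continuousAt.2 fun x => (d1 s x).continuousAt
  have ch' : ∀ s, Continuous (h' s) :=
    fun s => continuous_iff_continuousAt.2 fun x => (d2 s x).continuousAt
  have cl := fun s => continuous_lin (c s)
  have I0 : ∀ s k, Integrable (fun z : κ → ℝ => z k * (h' s (lin (c s) z) *
      ∏ t ∈ Finset.univ.erase s, h t (lin (c t) z))) (gam κ) := by
    intro s k
    have hC : 0 ≤ C := (abs_nonneg _).trans (b1 s 0)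
    refine (integrable_coord k).mul_bdd (c := C)
      (((ch' s).comp (cl s)).mul (continuous_finsetProd _ fun t _ =>
        (ch t).comp (cl t))).aestronglyMeasurable (ae_of_all _ fun z => ?_)
    have p := prod_bd h h01 (Finset.univ.erase s) (fun t => lin (c t) z)
    rw [Real.norm_eq_abs, abs_mul, abs_of_nonneg p.1]
    calc _ ≤ C * 1 := mul_le_mul (b1 _ _) p.2 p.1 hC
      _ = _ := mul_one _
  have e1 : ∀ z : κ → ℝ, ∑ s, (∏ t ∈ Finset.univ.erase s, h t (lin (c t) z)) *
      (h' s (lin (c s) z) * lin (d s) z) = ∑ s, ∑ k, d s k * (z k * (h' s (lin (c s) z) *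
      ∏ t ∈ Finset.univ.erase s, h t (lin (c t) z))) := by
    intro z
    refine Finset.sum_congr rfl fun s _ => ?_
    simp only [lin, Finset.mul_sum]
    refine Finset.sum_congr rfl fun k _ => ?_
    ring
  simp_rw [e1]
  rw [integral_finsetSum _ fun s _ => integrable_finsetSum _ fun k _ => (I0 s k).const_mul _]
  refine Finset.sum_nonpos fun s _ => ?_
  rw [integral_finsetSum _ fun k _ => (I0 s k).const_mul _]
  simp_rw [integral_const_mul, slep_ibp h h' h'' C h01 d1 d2 b1 b2 hc c s, ← integral_const_mul]
  have hC : 0 ≤ C := (abs_nonneg _).trans (b1 s 0)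
  rw [← integral_finsetSum]
  · refine integral_nonpos fun z => ?_
    have e2 : ∑ k, d s k * (h'' s (lin (c s) z) * c s k *
        (∏ t ∈ Finset.univ.erase s, h t (lin (c t) z)) +
        h' s (lin (c s) z) * ∑ t ∈ Finset.univ.erase s,
        (∏ u ∈ (Finset.univ.erase s).erase t, h u (lin (c u) z)) * (h' t (lin (c t) z) * c t k)) =
        (∑ k, d s k * c s k) * (h'' s (lin (c s) z) *
          (∏ t ∈ Finset.univ.erase s, h t (lin (c t) z))) +
        ∑ t ∈ Finset.univ.erase s, (∑ k, d s k * c t k) * ((h' s (lin (c s) z) *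
          h' t (lin (c t) z)) * ∏ u ∈ (Finset.univ.erase s).erase t, h u (lin (c u) z)) := by
      simp only [mul_add, Finset.sum_add_distrib, Finset.mul_sum, Finset.sum_mul]
      congr 1
      · refine Finset.sum_congr rfl fun k _ => ?_
        ring
      · rw [Finset.sum_comm]
        refine Finset.sum_congr rfl fun t _ => Finset.sum_congr rfl fun k _ => ?_
        ring
    simp only [Pi.zero_apply]
    rw [e2, hd, zero_mul, zero_add]
    refine Finset.sum_nonpos fun t _ => ?_
    refine mul_nonpos_of_nonpos_of_nonneg (hdt s t) (mul_nonneg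
      (mul_nonneg_of_nonpos_of_nonpos (hneg _ _) (hneg _ _)) ?_)
    exact (prod_bd h h01 _ (fun t => lin (c t) z)).1
  · intro k _
    refine Integrable.const_mul ?_ _
    have B : ∀ (S : Finset ι), Integrable (fun z => ∏ t ∈ S, h t (lin (c t) z)) (gam κ) := by
      intro S
      refine Integrable.of_bound
        (continuous_finsetProd _ fun t _ => (ch t).comp (cl t)).aestronglyMeasurable 1
        (ae_of_all _ fun z => ?_)
      have p := prod_bd h h01 S (fun t => lin (c t) z)
      rw [Real.norm_eq_abs, abs_of_nonneg p.1]
      exact p.2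
    refine Integrable.add ?_ ?_
    · refine Integrable.bdd_mul (c := C * |c s k|) (B _)
        (((hc s).comp (cl s)).mul continuous_const).aestronglyMeasurable
        (ae_of_all _ fun z => ?_)
      rw [norm_mul]
      exact mul_le_mul_of_nonneg_right (b2 _ _) (abs_nonneg _)
    · refine Integrable.bdd_mul (c := C) ?_ ((ch' s).comp (cl s)).aestronglyMeasurable
        (ae_of_all _ fun z => b1 _ _)
      refine integrable_finsetSum _ fun t _ => ?_
      refine Integrable.mul_bdd (c := C * |c t k|) (B _)
        (((ch' t).comp (cl t)).mul continuous_const).aestronglyMeasurable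
        (ae_of_all _ fun z => ?_)
      rw [norm_mul]
      exact mul_le_mul_of_nonneg_right (b1 _ _) (abs_nonneg _)

lemma slep_smooth (h h' h'' : ι → ℝ → ℝ) (C : ℝ)
    (h01 : ∀ s x, 0 ≤ h s x ∧ h s x ≤ 1)
    (d1 : ∀ s x, HasDerivAt (h s) (h' s x) x) (d2 : ∀ s x, HasDerivAt (h' s) (h'' s x) x)
    (b1 : ∀ s x, |h' s x| ≤ C) (b2 : ∀ s x, |h'' s x| ≤ C) (hc : ∀ s, Continuous (h'' s))
    (hneg : ∀ s x, h' s x ≤ 0)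
    (A B : ι → κ → ℝ) (hAB : ∀ s t, ∑ k, A s k * B t k = 0)
    (hv : ∀ s, ∑ k, A s k * A s k = ∑ k, B s k * B s k)
    (hcov : ∀ s t, ∑ k, B s k * B t k ≤ ∑ k, A s k * A t k) :
    ∫ z, ∏ t, h t (lin (B t) z) ∂(gam κ) ≤ ∫ z, ∏ t, h t (lin (A t) z) ∂(gam κ) := by
  have ch : ∀ s, Continuous (h s) :=
    fun s => continuous_iff_continuousAt.2 fun x => (d1 s x).continuousAt
  have ch' : ∀ s, Continuous (h' s) :=
    fun s => continuous_iff_continuousAt.2 fun x => (d2 s x).continuousAt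
  set c : ℝ → ι → κ → ℝ := fun θ s k => Real.cos θ * A s k + Real.sin θ * B s k with hcdef
  set d : ℝ → ι → κ → ℝ := fun θ s k => -Real.sin θ * A s k + Real.cos θ * B s k with hddef
  set Φ : ℝ → ℝ := fun θ => ∫ z, ∏ t, h t (lin (c θ t) z) ∂(gam κ) with hΦ
  have hder : ∀ θ, HasDerivAt Φ (∫ z, ∑ s, (∏ t ∈ Finset.univ.erase s, h t (lin (c θ t) z)) *
      (h' s (lin (c θ s) z) * lin (d θ s) z) ∂(gam κ)) θ := by
    intro θ
    refine (hasDerivAt_integral_of_dominated_loc_of_deriv_le (𝕜 := ℝ) (μ := gam κ)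
      (s := Set.univ) (x₀ := θ) (F := fun θ z => ∏ t, h t (lin (c θ t) z))
      (F' := fun θ z => ∑ s, (∏ t ∈ Finset.univ.erase s, h t (lin (c θ t) z)) *
      (h' s (lin (c θ s) z) * lin (d θ s) z))
      (bound := fun z : κ → ℝ => ∑ s, C * ∑ k, (|A s k| + |B s k|) * |z k|) univ_mem ?_ ?_ ?_ ?_ ?_ ?_).2
    · exact Eventually.of_forall fun x =>
        (continuous_finsetProd _ fun t _ => (ch t).comp (continuous_lin _)).aestronglyMeasurable
    · refine Integrable.of_bound
        (continuous_finsetProd _ fun t _ => (ch t).comp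
          (continuous_lin _)).aestronglyMeasurable 1 (ae_of_all _ fun z => ?_)
      have p := prod_bd h h01 Finset.univ (fun t => lin (c θ t) z)
      rw [Real.norm_eq_abs, abs_of_nonneg p.1]
      exact p.2
    · refine (continuous_finsetSum _ fun s _ => (continuous_finsetProd _ fun t _ =>
        (ch t).comp (continuous_lin _)).mul (((ch' s).comp (continuous_lin _)).mul
          (continuous_lin _))).aestronglyMeasurable
    · refine ae_of_all _ fun z x _ => ?_
      refine (Finset.abs_sum_le_sum_abs _ _).trans (Finset.sum_le_sum fun s _ => ?_)
      have hC : 0 ≤ C := (abs_nonneg _).trans (b1 s 0)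
      have p := prod_bd h h01 (Finset.univ.erase s) (fun t => lin (c x t) z)
      rw [abs_mul, abs_mul, abs_of_nonneg p.1]
      have q : |lin (d x s) z| ≤ ∑ k, (|A s k| + |B s k|) * |z k| := by
        refine (Finset.abs_sum_le_sum_abs _ _).trans (Finset.sum_le_sum fun k _ => ?_)
        rw [abs_mul]
        refine mul_le_mul_of_nonneg_right ?_ (abs_nonneg _)
        refine (abs_add_le _ _).trans ?_
        rw [abs_mul, abs_mul, abs_neg]
        have := mul_le_mul_of_nonneg_right (Real.abs_sin_le_one x) (abs_nonneg (A s k))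
        have := mul_le_mul_of_nonneg_right (Real.abs_cos_le_one x) (abs_nonneg (B s k))
        linarith
      have q2 := mul_le_mul (b1 s (lin (c x s) z)) q (abs_nonneg _) hC
      have q3 := mul_le_mul p.2 q2 (by positivity) zero_le_one
      linarith
    · refine integrable_finsetSum _ fun s _ => Integrable.const_mul
        (integrable_finsetSum _ fun k _ => (integrable_coord k).abs.const_mul _) _
    · refine ae_of_all _ fun z x _ => ?_
      have a0 : ∀ s, HasDerivAt (fun θ => lin (c θ s) z) (lin (d x s) z) x := by
        intro s
        refine HasDerivAt.fun_sum fun k _ => ?_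
        exact (((Real.hasDerivAt_cos x).mul_const _).add
          ((Real.hasDerivAt_sin x).mul_const _)).mul_const _
      have a2 : ∀ u, HasDerivAt (fun θ => h u (lin (c θ u) z))
          (h' u (lin (c x u) z) * lin (d x u) z) x := by
        intro u
        exact (d1 u (lin (c x u) z)).comp x (a0 u)
      have := HasDerivAt.fun_finsetProd (u := Finset.univ) fun u _ => a2 u
      simpa using this
  have key : ∀ θ ∈ Set.Icc 0 (Real.pi / 2), ∀ s t, ∑ k, d θ s k * c θ t k =
      Real.sin θ * Real.cos θ * (∑ k, B s k * B t k - ∑ k, A s k * A t k) := by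
    intro θ _ s t
    have : ∀ k, d θ s k * c θ t k = Real.sin θ * Real.cos θ * (B s k * B t k)
       - Real.sin θ * Real.cos θ * (A s k * A t k) + Real.cos θ ^ 2 * (A t k * B s k)
       - Real.sin θ ^ 2 * (A s k * B t k) := by
      intro k; simp only [hcdef, hddef]; ring
    simp_rw [this, Finset.sum_sub_distrib, Finset.sum_add_distrib, Finset.sum_sub_distrib,
      ← Finset.mul_sum, hAB]
    ring
  have anti : AntitoneOn Φ (Set.Icc 0 (Real.pi / 2)) := by
    refine antitoneOn_of_hasDerivWithinAt_nonpos (convex_Icc _ _)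
      (fun x _ => (hder x).continuousAt.continuousWithinAt)
      (fun x _ => (hder x).hasDerivWithinAt) ?_
    intro x hx
    have hx' := interior_subset hx
    have hsin : 0 ≤ Real.sin x := Real.sin_nonneg_of_nonneg_of_le_pi hx'.1
      (by linarith [hx'.2, Real.pi_pos])
    have hcos : 0 ≤ Real.cos x := Real.cos_nonneg_of_mem_Icc
      ⟨by linarith [hx'.1, Real.pi_pos], hx'.2⟩
    refine slep_deriv_nonpos h h' h'' C h01 d1 d2 b1 b2 hc hneg (c x) (d x) ?_ ?_
    · intro s
      rw [key x hx', hv, sub_self, mul_zero]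
    · intro s t
      rw [key x hx']
      exact mul_nonpos_of_nonneg_of_nonpos (mul_nonneg hsin hcos) (sub_nonpos.2 (hcov s t))
  have hpi : 0 ≤ Real.pi / 2 := by positivity
  have := anti (Set.left_mem_Icc.2 hpi) (Set.right_mem_Icc.2 hpi) hpi
  simpa [hΦ, hcdef] using this

lemma slepian (A B : ι → κ → ℝ) (hAB : ∀ s t, ∑ k, A s k * B t k = 0)
    (hv : ∀ s, ∑ k, A s k * A s k = ∑ k, B s k * B s k)
    (hcov : ∀ s t, ∑ k, B s k * B t k ≤ ∑ k, A s k * A t k) (a : ι → ℝ) :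
    gam κ {z | ∃ s, a s < lin (A s) z} ≤ gam κ {z | ∃ s, a s ≤ lin (B s) z} := by
  have sm : ∀ n : ℕ, ∫ z, ∏ t, Real.sigmoid (n * (a t - lin (B t) z)) ∂(gam κ) ≤
      ∫ z, ∏ t, Real.sigmoid (n * (a t - lin (A t) z)) ∂(gam κ) := by
    intro n
    set σ := Real.sigmoid
    have D : ∀ s x, HasDerivAt (fun x => σ (n * (a s - x)))
        (-(n * (σ (n * (a s - x)) * (1 - σ (n * (a s - x)))))) x := by
      intro s x
      have := (Real.hasDerivAt_sigmoid (n * (a s - x))).comp x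
        (((hasDerivAt_id x).const_sub (a s)).const_mul (n : ℝ))
      refine this.congr_deriv ?_
      simp [σ]; ring
    have σ0 : ∀ x, 0 ≤ σ x := Real.sigmoid_nonneg
    have σ1 : ∀ x, σ x ≤ 1 := Real.sigmoid_le_one
    refine slep_smooth (fun s x => σ (n * (a s - x)))
      (fun s x => -(n * (σ (n * (a s - x)) * (1 - σ (n * (a s - x))))))
      (fun s x => (n * (n * (σ (n * (a s - x)) * (1 - σ (n * (a s - x))) *
        (1 - 2 * σ (n * (a s - x))))))) (n + n * n) ?_ D ?_ ?_ ?_ ?_ ?_ A B hAB hv hcov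
    · exact fun s x => ⟨σ0 _, σ1 _⟩
    · intro s x
      refine (((D s x).mul ((D s x).const_sub 1)).const_mul (n : ℝ)).neg.congr_deriv ?_
      ring
    · intro s x
      have h0 := σ0 (n * (a s - x)); have h1 := σ1 (n * (a s - x))
      have hn : (0 : ℝ) ≤ n := Nat.cast_nonneg n
      rw [abs_neg, abs_mul, abs_of_nonneg hn, abs_of_nonneg (mul_nonneg h0 (by linarith))]
      have : σ (n * (a s - x)) * (1 - σ (n * (a s - x))) ≤ 1 := by nlinarith
      nlinarith [mul_le_mul_of_nonneg_left this hn]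
    · intro s x
      have h0 := σ0 (n * (a s - x)); have h1 := σ1 (n * (a s - x))
      have hn : (0 : ℝ) ≤ n := Nat.cast_nonneg n
      have k0 : 0 ≤ σ (n * (a s - x)) * (1 - σ (n * (a s - x))) := mul_nonneg h0 (by linarith)
      have : σ (n * (a s - x)) * (1 - σ (n * (a s - x))) ≤ 1 := by nlinarith
      have k2 : |1 - 2 * σ (n * (a s - x))| ≤ 1 := abs_le.2 ⟨by linarith, by linarith⟩
      rw [abs_mul, abs_mul, abs_mul, abs_of_nonneg hn, abs_of_nonneg k0]
      have k3 := mul_le_mul this k2 (abs_nonneg _) zero_le_one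
      have k4 := mul_le_mul_of_nonneg_left (mul_le_mul_of_nonneg_left k3 hn) hn
      linarith
    · intro s
      have : Continuous fun x => σ (n * (a s - x)) :=
        continuous_sigmoid.comp (by fun_prop)
      fun_prop
    · intro s x
      have h0 := σ0 (n * (a s - x)); have h1 := σ1 (n * (a s - x))
      have hn : (0 : ℝ) ≤ n := Nat.cast_nonneg n
      have := mul_nonneg hn (mul_nonneg h0 (sub_nonneg.2 h1))
      linarith
  -- limits
  have lim : ∀ y : ℝ, Tendsto (fun n : ℕ => Real.sigmoid (n * y)) atTop
      (nhds (if 0 < y then 1 else if y < 0 then 0 else 2⁻¹)) := by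
    intro y
    rcases lt_trichotomy 0 y with hy | hy | hy
    · simp only [hy, if_true]
      exact Real.tendsto_sigmoid_atTop.comp (tendsto_natCast_atTop_atTop.atTop_mul_const hy)
    · subst hy; simp
    · simp only [hy, if_true, not_lt.2 hy.le, if_false]
      exact Real.tendsto_sigmoid_atBot.comp (tendsto_natCast_atTop_atTop.atTop_mul_const_of_neg hy)
  set q : ℝ → ℝ := fun y => if 0 < y then 1 else if y < 0 then 0 else 2⁻¹ with hq
  have q01 : ∀ y, 0 ≤ q y ∧ q y ≤ 1 := by
    intro y; simp only [hq]; split_ifs <;> norm_num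
  have lim2 : ∀ D : ι → κ → ℝ, Tendsto (fun n : ℕ =>
      ∫ z, ∏ t, Real.sigmoid (n * (a t - lin (D t) z)) ∂(gam κ)) atTop
      (nhds (∫ z, ∏ t, q (a t - lin (D t) z) ∂(gam κ))) := by
    intro D
    refine tendsto_integral_of_dominated_convergence (fun _ => 1) ?_ (integrable_const _) ?_ ?_
    · intro n
      exact (continuous_finsetProd _ fun t _ => continuous_sigmoid.comp
        (continuous_const.mul (continuous_const.sub (continuous_lin _)))).aestronglyMeasurable
    · intro n
      refine ae_of_all _ fun z => ?_
      have p := prod_bd (fun t x => Real.sigmoid (n * (a t - x)))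
        (fun s x => ⟨Real.sigmoid_nonneg _, Real.sigmoid_le_one _⟩) Finset.univ
        (fun t => lin (D t) z)
      rw [Real.norm_eq_abs, abs_of_nonneg p.1]
      exact p.2
    · exact ae_of_all _ fun z => tendsto_finsetProd _ fun t _ => lim _
  have le := le_of_tendsto_of_tendsto' (lim2 B) (lim2 A) sm
  have mq : Measurable q := by
    simp only [hq]
    exact Measurable.ite measurableSet_Ioi measurable_const
      (Measurable.ite measurableSet_Iio measurable_const measurable_const)
  have Iq : ∀ D : ι → κ → ℝ, Integrable (fun z => ∏ t, q (a t - lin (D t) z)) (gam κ) := by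
    intro D
    refine Integrable.of_bound (C := 1) ?_ (ae_of_all _ fun z => ?_)
    · exact (Finset.measurable_fun_prod _ fun t _ => mq.comp
        (measurable_const.sub (continuous_lin _).measurable)).aestronglyMeasurable
    · have p := prod_bd (fun t x => q (a t - x)) (fun s x => q01 _) Finset.univ
        (fun t => lin (D t) z)
      rw [Real.norm_eq_abs, abs_of_nonneg p.1]
      exact p.2
  have mA : MeasurableSet {z | ∃ s, a s < lin (A s) z} := by
    simp only [Set.ofPred_exists]
    exact MeasurableSet.iUnion fun s => measurableSet_lt measurable_const
      (continuous_lin _).measurable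
  have mB : MeasurableSet {z | ∃ s, a s ≤ lin (B s) z} := by
    simp only [Set.ofPred_exists]
    exact MeasurableSet.iUnion fun s => measurableSet_le measurable_const
      (continuous_lin _).measurable
  have uA : ∫ z, ∏ t, q (a t - lin (A t) z) ∂(gam κ) ≤
      ((gam κ).real {z | ∃ s, a s < lin (A s) z}ᶜ) := by
    rw [← integral_indicator_one mA.compl]
    refine integral_mono (Iq A) ((integrable_const (1 : ℝ)).indicator mA.compl) fun z => ?_
    by_cases hz : z ∈ {z | ∃ s, a s < lin (A s) z}
    · obtain ⟨s, hs⟩ := hz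
      have : q (a s - lin (A s) z) = 0 := by
        have : a s - lin (A s) z < 0 := by linarith
        simp [hq, this, hs.le]
      have h0 := Finset.prod_eq_zero (f := fun t => q (a t - lin (A t) z)) (Finset.mem_univ s) this
      simp only [h0]
      exact Set.indicator_nonneg (fun _ _ => zero_le_one) _
    · have hz' : z ∈ {z | ∃ s, a s < lin (A s) z}ᶜ := hz
      rw [Set.indicator_of_mem hz']
      exact (prod_bd (fun t x => q (a t - x)) (fun s x => q01 _) Finset.univ
        (fun t => lin (A t) z)).2
  have uB : ((gam κ).real {z | ∃ s, a s ≤ lin (B s) z}ᶜ) ≤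
      ∫ z, ∏ t, q (a t - lin (B t) z) ∂(gam κ) := by
    rw [← integral_indicator_one mB.compl]
    refine integral_mono ((integrable_const (1 : ℝ)).indicator mB.compl) (Iq B) fun z => ?_
    by_cases hz : z ∈ {z | ∃ s, a s ≤ lin (B s) z}
    · rw [Set.indicator_of_notMem (by simpa using hz)]
      exact (prod_bd (fun t x => q (a t - x)) (fun s x => q01 _) Finset.univ
        (fun t => lin (B t) z)).1
    · have hz' : z ∈ {z | ∃ s, a s ≤ lin (B s) z}ᶜ := hz
      rw [Set.indicator_of_mem hz']
      have : ∀ t, q (a t - lin (B t) z) = 1 := by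
        intro t
        have : lin (B t) z < a t := by
          by_contra hh
          exact hz ⟨t, not_lt.1 hh⟩
        simp [hq, this]
      simp [this]
  have fin := uB.trans (le.trans uA)
  rw [probReal_compl_eq_one_sub mA, probReal_compl_eq_one_sub mB] at fin
  have : (gam κ).real {z | ∃ s, a s < lin (A s) z} ≤ (gam κ).real {z | ∃ s, a s ≤ lin (B s) z} := by
    linarith
  rw [Measure.real, Measure.real, ENNReal.toReal_le_toReal (measure_ne_top _ _)
    (measure_ne_top _ _)] at this
  exact this

end slep

section law
variable {ι κ κ' : Type*} [Fintype ι] [Fintype κ] [Fintype κ']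

lemma cont_toLp_lin (A : ι → κ → ℝ) :
    Continuous (fun z => (WithLp.toLp 2 (fun i => lin (A i) z) : EuclideanSpace ℝ ι)) :=
  (PiLp.continuous_toLp 2 _).comp (continuous_pi fun i => by unfold lin; fun_prop)

lemma sum_sq_gram (A : ι → κ → ℝ) (t : ι → ℝ) : ∑ k, (∑ i, t i * A i k) ^ 2 =
    ∑ i, ∑ j, t i * t j * ∑ k, A i k * A j k := by
  simp_rw [sq, Finset.sum_mul_sum, Finset.mul_sum]
  rw [Finset.sum_comm]
  refine Finset.sum_congr rfl fun i _ => ?_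
  rw [Finset.sum_comm]
  refine Finset.sum_congr rfl fun j _ => Finset.sum_congr rfl fun k _ => ?_
  ring

lemma charFun_lin (A : ι → κ → ℝ) (t : EuclideanSpace ℝ ι) :
    charFun ((gam κ).map (fun z => WithLp.toLp 2 (fun i => lin (A i) z))) t =
      Complex.exp (-((∑ k, (∑ i, t i * A i k) ^ 2 : ℝ) : ℂ) / 2) := by
  set b : EuclideanSpace ℝ κ := WithLp.toLp 2 (fun k => ∑ i, t i * A i k) with hb
  have h1 : charFun ((gam κ).map (WithLp.toLp 2)) b =
      Complex.exp (-((∑ k, (∑ i, t i * A i k) ^ 2 : ℝ) : ℂ) / 2) := by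
    rw [map_pi_eq_stdGaussian, charFun_stdGaussian, ← Complex.ofReal_pow,
      EuclideanSpace.real_norm_sq_eq]
  rw [← h1, charFun_apply, charFun_apply, integral_map, integral_map]
  · congr 1; ext z
    congr 3
    simp only [PiLp.inner_apply, hb, lin, RCLike.inner_apply, conj_trivial, Finset.sum_mul,
      Finset.mul_sum]
    rw [Finset.sum_comm]
    refine Finset.sum_congr rfl fun k _ => Finset.sum_congr rfl fun i _ => ?_
    ring
  · fun_prop
  · exact Continuous.aestronglyMeasurable (by fun_prop)
  · exact (cont_toLp_lin A).aemeasurable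
  · exact Continuous.aestronglyMeasurable (by fun_prop)

lemma law_lin (A : ι → κ → ℝ) (A' : ι → κ' → ℝ)
    (h : ∀ i j, ∑ k, A i k * A j k = ∑ k, A' i k * A' j k) :
    (gam κ).map (fun z i => lin (A i) z) = (gam κ').map (fun z i => lin (A' i) z) := by
  have key : (gam κ).map (fun z => WithLp.toLp 2 (fun i => lin (A i) z)) =
      (gam κ').map (fun z => WithLp.toLp 2 (fun i => lin (A' i) z)) := by
    apply Measure.ext_of_charFun
    ext t
    rw [charFun_lin, charFun_lin]
    congr 4
    rw [sum_sq_gram, sum_sq_gram]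
    simp_rw [h]
  have k2 := congrArg (Measure.map (WithLp.ofLp : EuclideanSpace ℝ ι → ι → ℝ)) key
  rw [Measure.map_map (PiLp.continuous_ofLp 2 _).measurable (cont_toLp_lin _).measurable,
    Measure.map_map (PiLp.continuous_ofLp 2 _).measurable (cont_toLp_lin _).measurable] at k2
  exact k2

lemma lin_single [DecidableEq κ] (i : κ) (z : κ → ℝ) :
    lin (fun k => if i = k then 1 else 0) z = z i := by
  simp [lin]

lemma law_orth [DecidableEq ι] (A : ι → κ → ℝ)
    (h : ∀ i j, ∑ k, A i k * A j k = if i = j then 1 else 0) :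
    (gam κ).map (fun z i => lin (A i) z) = gam ι := by
  rw [law_lin A (fun i k : ι => if i = k then 1 else 0)]
  · simp only [lin_single]
    exact Measure.map_id
  · intro i j; rw [h]; simp
end law

section mom
variable {κ : Type*} [Fintype κ]

lemma indep_coord : iIndepFun (fun (k : κ) (z : κ → ℝ) => z k) (gam κ) :=
  iIndepFun_pi (X := fun _ x => x) fun _ => aemeasurable_id

lemma memLp_coord (k : κ) (p : NNReal) : MemLp (fun z : κ → ℝ => z k) p (gam κ) :=
  (memLp_id_gaussianReal p).comp_measurePreserving
    (measurePreserving_eval (fun _ : κ => gaussianReal 0 1) k)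

lemma int_coord (k : κ) (φ : ℝ → ℝ) (hφ : Measurable φ) :
    ∫ z : κ → ℝ, φ (z k) ∂(gam κ) = ∫ x, φ x ∂(gaussianReal 0 1) := by
  rw [← (measurePreserving_eval (fun _ : κ => gaussianReal 0 1) k).map_eq, integral_map
    (measurable_pi_apply k).aemeasurable hφ.aestronglyMeasurable]

lemma var_coord (k : κ) (φ : ℝ → ℝ) (hφ : Measurable φ) :
    Var[fun z : κ → ℝ => φ (z k); gam κ] = Var[φ; gaussianReal 0 1] :=
  (measurePreserving_eval (fun _ : κ => gaussianReal 0 1) k).variance_fun_comp hφ.aemeasurable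

lemma wlln {Ω : Type*} [MeasurableSpace Ω] (μ : Measure Ω) [IsProbabilityMeasure μ]
    (X : κ → Ω → ℝ) (hX : ∀ k, MemLp (X k) 2 μ) (hi : ∀ i j, i ≠ j → IndepFun (X i) (X j) μ)
    (t : ℝ) (ht : 0 < t) :
    μ {ω | t ≤ |∑ k, X k ω - ∑ k, ∫ ω, X k ω ∂μ|} ≤ ENNReal.ofReal ((∑ k, Var[X k; μ]) / t ^ 2) := by
  have h := meas_ge_le_variance_div_sq (μ := μ) (X := ∑ k, X k) (memLp_finsetSum' _ fun k _ => hX k) ht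
  rw [IndepFun.variance_sum (fun k _ => hX k) (fun i _ j _ hij => hi i j hij)] at h
  simp only [Finset.sum_apply] at h
  rwa [integral_finsetSum _ fun k _ => (hX k).integrable (by norm_num)] at h

lemma cheb_lin (a : κ → ℝ) (t : ℝ) (ht : 0 < t) :
    gam κ {z | t ≤ |lin a z|} ≤ ENNReal.ofReal ((∑ k, a k ^ 2) / t ^ 2) := by
  have h := wlln (gam κ) (fun k z => a k * z k)
    (fun k => (memLp_coord k 2).const_mul _)
    (fun i j hij => ((indep_coord.indepFun hij).comp (φ := fun x => a i * x) (ψ := fun x => a j * x)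
      (by fun_prop) (by fun_prop))) t ht
  have e1 : ∀ k, ∫ z : κ → ℝ, a k * z k ∂(gam κ) = 0 := by
    intro k
    rw [integral_const_mul]
    rw [int_coord k (fun x => x) measurable_id, integral_id_gaussianReal, mul_zero]
  have e2 : ∀ k, Var[fun z : κ → ℝ => a k * z k; gam κ] = a k ^ 2 := by
    intro k
    rw [variance_const_mul, var_coord k (fun x => x) measurable_id, variance_fun_id_gaussianReal]
    simp
  simp only [e1, e2] at h
  simpa [lin] using h

lemma lln : ∃ C : ℝ, ∀ ε > 0, ∀ n : ℕ, 0 < n →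
    gam (Fin n) {z | ε * n ≤ |∑ i, z i ^ 2 - n|} ≤ ENNReal.ofReal (C / (ε ^ 2 * n)) := by
  refine ⟨Var[fun x => x ^ 2; gaussianReal 0 1], fun ε hε n hn => ?_⟩
  have hn' : (0 : ℝ) < n := by exact_mod_cast hn
  have h := wlln (gam (Fin n)) (fun k z => z k ^ 2)
    (fun k => by
      have h4 := memLp_coord (κ := Fin n) k 4
      have := h4.norm_rpow_div 2
      convert this using 1
      · ext z; simp
      · have : ((4 : NNReal) : ENNReal) = 2 * 2 := by norm_num
        rw [this, ENNReal.mul_div_cancel_right (by norm_num) (by norm_num)])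
    (fun i j hij => ((indep_coord.indepFun hij).comp (φ := fun x => x ^ 2) (ψ := fun x => x ^ 2)
      (by fun_prop) (by fun_prop))) (ε * n) (by positivity)
  have e1 : ∀ k, ∫ z : Fin n → ℝ, z k ^ 2 ∂(gam (Fin n)) = 1 := by
    intro k
    rw [int_coord k (fun x => x ^ 2) (by fun_prop)]
    have hv := variance_id_gaussianReal (μ := 0) (v := 1)
    rw [variance_eq_sub (memLp_id_gaussianReal 2)] at hv
    simpa using hv
  have e2 : ∀ k, Var[fun z : Fin n → ℝ => z k ^ 2; gam (Fin n)] =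
      Var[fun x => x ^ 2; gaussianReal 0 1] := by
    intro k
    exact var_coord k (fun x => x ^ 2) (by fun_prop)
  simp only [e1, e2] at h
  simp only [Finset.sum_const, Finset.card_univ, Fintype.card_fin, nsmul_eq_mul, mul_one] at h
  refine h.trans (le_of_eq ?_)
  congr 1
  field_simp
end mom

lemma gauss_diag {U : Type*} [Fintype U] (s : U → ℝ) :
    (gam U).map (fun z p => s p * z p) =
      Measure.pi (fun p => gaussianReal 0 (Real.toNNReal (s p ^ 2))) := by
  rw [Measure.pi_map_pi (f := fun p x => s p * x) (fun p => by fun_prop)]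
  congr 1
  ext1 p
  rw [gaussianReal_map_const_mul]
  congr 1
  · simp
  · ext; simp [Real.coe_toNNReal _ (sq_nonneg (s p))]

noncomputable def symA {N : ℕ} (p k : Fin N × Fin N) : ℝ :=
  ((if p = k then 1 else 0) + (if p.swap = k then 1 else 0)) / 2

lemma lin_symA {N : ℕ} (p : Fin N × Fin N) (z : Fin N × Fin N → ℝ) :
    lin (symA p) z = (z p + z p.swap) / 2 := by
  simp only [lin, symA, add_div, add_mul, Finset.sum_add_distrib, ite_div, zero_div, ite_mul,
    zero_mul, Finset.sum_ite_eq, Finset.mem_univ, if_true]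
  ring

lemma gram_symA {N : ℕ} (p q : Fin N × Fin N) :
    ∑ k, symA p k * symA q k = ((if p = q then 1 else 0) + (if p = q.swap then 1 else 0)) / 2 := by
  have : ∑ k, symA p k * symA q k = lin (symA p) (symA q) := rfl
  rw [this, lin_symA]
  simp only [symA, Prod.swap_inj]
  have e1 : (q.swap = p) = (p = q.swap) := propext eq_comm
  have e2 : (q = p.swap) = (p = q.swap) := by
    apply propext; constructor <;> rintro rfl <;> simp
  have e3 : (q = p) = (p = q) := propext eq_comm
  simp only [e1, e2, e3]
  ring

lemma goe_law {N : ℕ} {Ω : Type*} [MeasurableSpace Ω] (P : Measure Ω) [IsProbabilityMeasure P]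
    (J : Ω → Matrix (Fin N) (Fin N) ℝ) (h : IsGOE P J) :
    P.map (fun ω (p : Fin N × Fin N) => J ω p.1 p.2) =
      (gam (Fin N × Fin N)).map (fun z p => (z p + z p.swap) / 2) := by
  obtain ⟨hs, hm, hi, hl⟩ := h
  let U := {p : Fin N × Fin N // p.1 ≤ p.2}
  let Φ : (U → ℝ) → (Fin N × Fin N → ℝ) := fun x p => x ⟨(min p.1 p.2, max p.1 p.2), min_le_max⟩
  have hΦ : Measurable Φ := by fun_prop
  have e1 : P.map (fun ω (p : U) => J ω p.1.1 p.1.2) =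
      Measure.pi (fun p : U => gaussianReal 0 (if p.1.1 = p.1.2 then 1 else 1 / 2)) := by
    rw [hi.map_fun_eq_pi_map (fun p => (hm _ _).aemeasurable)]
    congr 1; ext1 p
    exact hl _ _ p.2
  let s : U → ℝ := fun p => Real.sqrt (if p.1.1 = p.1.2 then 1 else 1 / 2)
  have hs2 : ∀ p, s p ^ 2 = if p.1.1 = p.1.2 then 1 else 1 / 2 := fun p =>
    Real.sq_sqrt (by split_ifs <;> norm_num)
  have e2 : (gam (Fin N × Fin N)).map (fun z (p : U) => (z p + z p.1.swap) / 2) =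
      Measure.pi (fun p : U => gaussianReal 0 (if p.1.1 = p.1.2 then 1 else 1 / 2)) := by
    have := law_lin (fun p : U => symA p.1) (fun (p : U) k => s p * if p = k then 1 else 0) ?_
    · simp only [lin_symA] at this
      rw [this]
      have : (fun (z : U → ℝ) p => lin (fun k => s p * if p = k then 1 else 0) z) =
          fun z p => s p * z p := by
        ext z p; simp [lin]
      rw [this, gauss_diag]
      congr 1; ext1 p
      rw [hs2]
      congr 1
      split_ifs
      · simp
      · ext; simp
    · intro p q
      rw [gram_symA]
      by_cases hpq : p = q
      · subst hpq
        have : ∀ x, (s p * if p = x then 1 else 0) * (s p * if p = x then 1 else 0) =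
          if p = x then s p ^ 2 else 0 := by intro x; split_ifs <;> ring
        simp only [this, Finset.sum_ite_eq, Finset.mem_univ, if_true, hs2]
        have : (p.1 = p.1.swap) = (p.1.1 = p.1.2) := by
          apply propext; rw [Prod.ext_iff]; simp [eq_comm]
        simp only [this]
        split_ifs <;> norm_num
      · have h1 : ¬ p.1 = q.1 := fun h => hpq (Subtype.ext h)
        have h2 : ¬ p.1 = q.1.swap := by
          intro h
          have a := p.2
          have b := q.2
          rw [h] at a
          simp only [Prod.fst_swap, Prod.snd_swap] at a
          apply h1
          rw [h]
          have := le_antisymm a b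
          ext1 <;> simp [this]
        rw [if_neg h1, if_neg h2]
        symm
        simp only [add_zero, zero_div]
        apply Finset.sum_eq_zero
        intro x _
        by_cases hx : p = x
        · subst hx; simp [Ne.symm hpq]
        · simp [hx]
  have e3 := congrArg (Measure.map Φ) (e1.trans e2.symm)
  rw [Measure.map_map hΦ (by fun_prop), Measure.map_map hΦ (by fun_prop)] at e3
  convert e3 using 2
  · ext ω p
    simp only [Function.comp, Φ]
    rcases le_total p.1 p.2 with h | h
    · simp [h]
    · simp [h, (hs ω).apply]
  · ext z p
    simp only [Function.comp, Φ]
    rcases le_total p.1 p.2 with h | h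
    · simp [h]
    · simp only [h, min_eq_right, max_eq_left, Prod.swap_prod_mk]
      rw [add_comm]; rfl

lemma slepian_sup {E κ : Type*} [TopologicalSpace E] [SecondCountableTopology E]
    [Fintype κ] [DecidableEq κ] (T : Set E) (φ : E → ℝ) (hφ : ContinuousOn φ T)
    (A B : E → κ → ℝ) (hA : ∀ k, Continuous fun m => A m k)
    (hAB : ∀ s t, ∑ k, A s k * B t k = 0)
    (hv : ∀ s, ∑ k, A s k * A s k = ∑ k, B s k * B s k)
    (hcov : ∀ s t, ∑ k, B s k * B t k ≤ ∑ k, A s k * A t k) :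
    gam κ {z | ∃ m ∈ T, φ m < lin (A m) z} ≤ gam κ {z | ∃ m ∈ T, φ m ≤ lin (B m) z} := by
  rcases T.eq_empty_or_nonempty with rfl | hT
  · simp
  have : Nonempty T := hT.to_subtype
  let d : ℕ → T := TopologicalSpace.denseSeq T
  have hd : DenseRange d := TopologicalSpace.denseRange_denseSeq T
  let S : ℕ → Set (κ → ℝ) := fun n => {z | ∃ i : Fin n, φ (d i) < lin (A (d i)) z}
  have h1 : {z | ∃ m ∈ T, φ m < lin (A m) z} ⊆ ⋃ n, S n := by
    rintro z ⟨m, hm, hlt⟩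
    have hc1 : Continuous fun x : T => φ x := continuousOn_iff_continuous_domRestrict.1 hφ
    have hc2 : Continuous fun x : T => lin (A x) z := by
      unfold lin
      exact continuous_finsetSum _ fun k _ => ((hA k).comp continuous_subtype_val).mul continuous_const
    have ho : IsOpen {x : T | φ x < lin (A x) z} := isOpen_lt hc1 hc2
    obtain ⟨n, hn⟩ := hd.exists_mem_open ho ⟨⟨m, hm⟩, hlt⟩
    exact Set.mem_iUnion.2 ⟨n + 1, ⟨n, Nat.lt_succ_self n⟩, hn⟩
  have hmono : Monotone S := by
    rintro a b hab z ⟨i, hi⟩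
    exact ⟨⟨i, i.2.trans_le hab⟩, hi⟩
  refine (measure_mono h1).trans ?_
  rw [hmono.measure_iUnion]
  refine iSup_le fun n => ?_
  refine (slepian (fun i : Fin n => A (d i)) (fun i => B (d i)) (fun s t => hAB _ _) (fun s => hv _)
    (fun s t => hcov _ _) (fun i => φ (d i))).trans (measure_mono ?_)
  rintro z ⟨i, hi⟩
  exact ⟨d i, (d i).2, hi⟩

/-- marginalization along an injection -/
lemma gam_marg {ι κ : Type*} [Fintype ι] [Fintype κ] [DecidableEq κ] (e : ι → κ)
    (he : Function.Injective e) : (gam κ).map (fun z i => z (e i)) = gam ι := by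
  classical
  have := law_orth (fun i k => if e i = k then (1 : ℝ) else 0) (fun i j => by
    simp [he.eq_iff, eq_comm])
  simpa only [lin_single] using this

noncomputable def nrm {n : ℕ} (m : Fin n → ℝ) : ℝ := Real.sqrt (∑ i, m i ^ 2)

lemma nrm_sq {n : ℕ} (m : Fin n → ℝ) : nrm m ^ 2 = ∑ i, m i ^ 2 :=
  Real.sq_sqrt (Finset.sum_nonneg fun i _ => sq_nonneg _)

lemma nrm_nonneg {n : ℕ} (m : Fin n → ℝ) : 0 ≤ nrm m := Real.sqrt_nonneg _

lemma continuous_nrm {n : ℕ} : Continuous (nrm : (Fin n → ℝ) → ℝ) := by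
  unfold nrm; fun_prop

lemma cs {n : ℕ} (x y : Fin n → ℝ) : ∑ i, x i * y i ≤ nrm x * nrm y := by
  refine (Real.sum_mul_le_sqrt_mul_sqrt _ _ _)

lemma proj_bound {n : ℕ} (v m g : Fin n → ℝ) (hv : ∑ i, v i ^ 2 = 1) :
    ∑ i, g i * m i ≤ |∑ i, v i * m i| * |∑ i, v i * g i| +
      nrm g * Real.sqrt (nrm m ^ 2 - (∑ i, v i * m i) ^ 2) := by
  set a := ∑ i, v i * m i with ha
  have h1 : ∑ i, g i * m i = a * ∑ i, v i * g i + ∑ i, g i * (m i - a * v i) := by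
    rw [Finset.mul_sum, ← Finset.sum_add_distrib]
    exact Finset.sum_congr rfl fun i _ => by ring
  have h2 : ∑ i, (m i - a * v i) ^ 2 = nrm m ^ 2 - a ^ 2 := by
    have : ∀ i, (m i - a * v i) ^ 2 = m i ^ 2 - 2 * a * (v i * m i) + a ^ 2 * v i ^ 2 := fun i => by ring
    simp only [this, Finset.sum_add_distrib, Finset.sum_sub_distrib, ← Finset.mul_sum, hv, ← ha,
      nrm_sq]
    ring
  have h3 := cs g (fun i => m i - a * v i)
  have h4 : nrm (fun i => m i - a * v i) = Real.sqrt (nrm m ^ 2 - a ^ 2) := by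
    unfold nrm; rw [h2]; rfl
  rw [h4] at h3
  rw [h1, ← abs_mul]
  exact add_le_add (le_abs_self _) h3

lemma arith1 {x η r q w : ℝ} (hη : 0 < η) (hr0 : 0 ≤ r) (hr1 : r ≤ 1) (hq0 : 0 ≤ q) (hq1 : q ≤ 1)
    (hw0 : 0 ≤ w) (hw1 : w ≤ 3 / 2) (h : x - η * r ^ 2 ≤ w * r ^ 2 * (η + (1 + η) * q)) :
    x ≤ w * r ^ 2 * q + 4 * η := by
  have hr2 : r ^ 2 ≤ 1 := by nlinarith
  have t1 : η * r ^ 2 ≤ η := by nlinarith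
  have t2 : w * r ^ 2 ≤ 3 / 2 := by nlinarith [sq_nonneg r]
  have t3 : w * r ^ 2 * η ≤ 3 / 2 * η := by nlinarith
  have t5 : 0 ≤ w * r ^ 2 * η := by positivity
  have t4 : w * r ^ 2 * η * q ≤ 3 / 2 * η := by nlinarith
  linarith

set_option maxHeartbeats 1000000 in
lemma upper : ∃ K : ℝ, ∀ (β : ℝ), 0 < β → ∀ (R : Set ℝ), R ⊆ Set.Icc 0 1 →
    ∀ (f : ℝ → ℝ), ContinuousOn f (Set.Icc (-1) 1) → ∀ g : ℝ → ℝ, ContinuousOn g R →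
    ∀ S : ℝ, (∀ r ∈ R, ∀ α ∈ Set.Icc (-1 : ℝ) 1,
      f (r * α) + g r + β * r ^ 2 * Real.sqrt (2 * (1 - α ^ 2)) ≤ S) →
    ∀ η > 0, ∀ c, S + 4 * β * η < c → ∀ n : ℕ, 0 < n → ∀ v : Fin n → ℝ, ∑ i, v i ^ 2 = 1 →
    gam (Fin n × Fin n) {Z | ∃ m : Fin n → ℝ, nrm m ∈ R ∧
      n * c < β * (Real.sqrt n * ∑ p : Fin n × Fin n, m p.1 * m p.2 * Z p) +
        n * f (∑ i, v i * m i) + n * g (nrm m)} ≤ 3 * ENNReal.ofReal (K / (η ^ 2 * n)) := by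
  obtain ⟨C, hC⟩ := lln
  refine ⟨max 1 C, ?_⟩
  intro β hβ R hR f hf g hg S hS η hη c hc n hn v hv
  have hn' : (0 : ℝ) < n := by exact_mod_cast hn
  have hsn : 0 < Real.sqrt n := Real.sqrt_pos.2 hn'
  have hsn2 : Real.sqrt n * Real.sqrt n = n := Real.mul_self_sqrt hn'.le
  let T : Set (Fin n → ℝ) := {m | nrm m ∈ R}
  let A : (Fin n → ℝ) → ((Fin n × Fin n) ⊕ (Unit ⊕ Fin n)) → ℝ := fun m => Sum.elim (fun p => m p.1 * m p.2)
    (Sum.elim (fun _ => nrm m ^ 2) (fun _ => 0))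
  let B : (Fin n → ℝ) → ((Fin n × Fin n) ⊕ (Unit ⊕ Fin n)) → ℝ := fun m => Sum.elim (fun _ => 0)
    (Sum.elim (fun _ => 0) (fun i => Real.sqrt 2 * nrm m * m i))
  let φ : (Fin n → ℝ) → ℝ := fun m =>
    Real.sqrt n / β * (c - f (∑ i, v i * m i) - g (nrm m)) - η * Real.sqrt n * nrm m ^ 2
  have hvm : ∀ m : Fin n → ℝ, |∑ i, v i * m i| ≤ nrm m := by
    intro m
    have hnv : nrm v = 1 := by unfold nrm; rw [hv]; simp
    rw [abs_le]; constructor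
    · have := cs v (fun i => - m i)
      have e : nrm (fun i => - m i) = nrm m := by unfold nrm; simp
      rw [e, hnv] at this
      simp at this; linarith
    · have := cs v m
      rw [hnv] at this; linarith
  have hvm2 : ∀ m ∈ T, ∑ i, v i * m i ∈ Set.Icc (-1 : ℝ) 1 := by
    intro m hm
    have := hvm m
    have h1 := (hR hm).2
    exact abs_le.1 (this.trans h1)
  have hφ : ContinuousOn φ T := by
    have c1 : ContinuousOn (fun m : Fin n → ℝ => f (∑ i, v i * m i)) T :=
      hf.comp (Continuous.continuousOn (by fun_prop)) hvm2
    have c2 : ContinuousOn (fun m : Fin n → ℝ => g (nrm m)) T :=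
      hg.comp continuous_nrm.continuousOn (fun m hm => hm)
    have c3 : ContinuousOn (fun m : Fin n → ℝ => nrm m) T := continuous_nrm.continuousOn
    exact (continuousOn_const.mul ((continuousOn_const.sub c1).sub c2)).sub
      (continuousOn_const.mul (c3.pow 2))
  have hA : ∀ k, Continuous fun m => A m k := by
    rintro (p | _ | i)
    · simp only [A, Sum.elim_inl]; fun_prop
    · simp only [A, Sum.elim_inl, Sum.elim_inr]; exact continuous_nrm.pow 2
    · simp only [A, Sum.elim_inr]; fun_prop
  have gA : ∀ s t, ∑ k, A s k * A t k = (∑ i, s i * t i) ^ 2 + nrm s ^ 2 * nrm t ^ 2 := by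
    intro s t
    simp only [A, Fintype.sum_sum_type, Sum.elim_inl, Sum.elim_inr, Fintype.sum_prod_type]
    simp only [mul_zero, Finset.sum_const_zero, add_zero, Finset.univ_unique, Finset.sum_const,
      Finset.card_singleton, one_smul]
    congr 1
    rw [sq, Finset.sum_mul_sum]
    exact Finset.sum_congr rfl fun i _ => Finset.sum_congr rfl fun j _ => by ring
  have gB : ∀ s t, ∑ k, B s k * B t k = 2 * (nrm s * nrm t) * (∑ i, s i * t i) := by
    intro s t
    simp only [B, Fintype.sum_sum_type, Sum.elim_inl, Sum.elim_inr, Finset.mul_sum]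
    have h2 : Real.sqrt 2 * Real.sqrt 2 = 2 := Real.mul_self_sqrt (by norm_num)
    simp only [mul_zero, Finset.sum_const_zero, zero_add]
    refine Finset.sum_congr rfl fun i _ => ?_
    linear_combination (nrm s * nrm t * s i * t i) * h2
  have key := slepian_sup T φ hφ A B hA (fun s t => by
      simp [A, B, Fintype.sum_sum_type]) (fun s => by
      rw [gA, gB]
      have : ∑ i, s i * s i = nrm s ^ 2 := by rw [nrm_sq]; simp [sq]
      rw [this]; ring) (fun s t => by
      rw [gA, gB]; nlinarith [sq_nonneg ((∑ i, s i * t i) - nrm s * nrm t)])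
  -- bad events
  let W : ((Fin n × Fin n) ⊕ (Unit ⊕ Fin n)) → ℝ := Sum.elim (fun _ => 0) (Sum.elim (fun _ => 1) (fun _ => 0))
  let V : ((Fin n × Fin n) ⊕ (Unit ⊕ Fin n)) → ℝ := Sum.elim (fun _ => 0) (Sum.elim (fun _ => 0) v)
  have hW : ∀ z : ((Fin n × Fin n) ⊕ (Unit ⊕ Fin n)) → ℝ, lin W z = z (Sum.inr (Sum.inl ())) := by
    intro z; simp [lin, W, Fintype.sum_sum_type]
  have hV : ∀ z : ((Fin n × Fin n) ⊕ (Unit ⊕ Fin n)) → ℝ, lin V z = ∑ i, v i * z (Sum.inr (Sum.inr i)) := by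
    intro z; simp [lin, V, Fintype.sum_sum_type]
  have hbd : ∀ x : ℝ, x ≤ max 1 C →
      ENNReal.ofReal (x / (η ^ 2 * n)) ≤ ENNReal.ofReal (max 1 C / (η ^ 2 * n)) := by
    intro x hx
    apply ENNReal.ofReal_le_ofReal
    gcongr
  have b1 : gam ((Fin n × Fin n) ⊕ (Unit ⊕ Fin n)) {z | η * Real.sqrt n ≤ |lin W z|} ≤ ENNReal.ofReal (max 1 C / (η ^ 2 * n)) := by
    refine (cheb_lin W _ (by positivity)).trans (le_trans (le_of_eq ?_) (hbd 1 (le_max_left _ _)))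
    congr 2
    · simp [W, Fintype.sum_sum_type]
    · rw [mul_pow, Real.sq_sqrt hn'.le]
  have b2 : gam ((Fin n × Fin n) ⊕ (Unit ⊕ Fin n)) {z | η * Real.sqrt n ≤ |lin V z|} ≤ ENNReal.ofReal (max 1 C / (η ^ 2 * n)) := by
    refine (cheb_lin V _ (by positivity)).trans (le_trans (le_of_eq ?_) (hbd 1 (le_max_left _ _)))
    congr 2
    · simp [V, Fintype.sum_sum_type, hv]
    · rw [mul_pow, Real.sq_sqrt hn'.le]
  have b3 : gam ((Fin n × Fin n) ⊕ (Unit ⊕ Fin n)) {z | η * n ≤ |∑ i : Fin n, z (Sum.inr (Sum.inr i)) ^ 2 - n|} ≤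
      ENNReal.ofReal (max 1 C / (η ^ 2 * n)) := by
    refine le_trans ?_ ((hC η hη n hn).trans (hbd C (le_max_right _ _)))
    rw [← gam_marg (κ := (Fin n × Fin n) ⊕ (Unit ⊕ Fin n)) (fun i : Fin n => Sum.inr (Sum.inr i))
      (Sum.inr_injective.comp Sum.inr_injective)]
    exact Measure.le_map_apply (Measurable.aemeasurable (by fun_prop)) _
  have hopen : MeasurableSet {Z : Fin n × Fin n → ℝ | ∃ m : Fin n → ℝ, nrm m ∈ R ∧
      n * c < β * (Real.sqrt n * ∑ p : Fin n × Fin n, m p.1 * m p.2 * Z p) +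
        n * f (∑ i, v i * m i) + n * g (nrm m)} := by
    apply IsOpen.measurableSet
    have : {Z : Fin n × Fin n → ℝ | ∃ m : Fin n → ℝ, nrm m ∈ R ∧
      n * c < β * (Real.sqrt n * ∑ p : Fin n × Fin n, m p.1 * m p.2 * Z p) +
        n * f (∑ i, v i * m i) + n * g (nrm m)} = ⋃ m ∈ T, {Z | n * c < β * (Real.sqrt n * ∑ p : Fin n × Fin n, m p.1 * m p.2 * Z p) +
        n * f (∑ i, v i * m i) + n * g (nrm m)} := by
      ext Z; simp [T]
    rw [this]
    exact isOpen_biUnion fun m _ => isOpen_lt continuous_const (by fun_prop)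
  rw [← gam_marg (κ := (Fin n × Fin n) ⊕ (Unit ⊕ Fin n)) (fun p : Fin n × Fin n => Sum.inl p) Sum.inl_injective,
    Measure.map_apply (by fun_prop) hopen]
  have hsub : ((fun z (p : Fin n × Fin n) => z (Sum.inl p)) ⁻¹' {Z : Fin n × Fin n → ℝ | ∃ m : Fin n → ℝ, nrm m ∈ R ∧
      n * c < β * (Real.sqrt n * ∑ p : Fin n × Fin n, m p.1 * m p.2 * Z p) +
        n * f (∑ i, v i * m i) + n * g (nrm m)} : Set (((Fin n × Fin n) ⊕ (Unit ⊕ Fin n)) → ℝ)) ⊆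
      {z | ∃ m ∈ T, φ m < lin (A m) z} ∪ {z | η * Real.sqrt n ≤ |lin W z|} := by
    rintro z ⟨m, hm, hlt⟩
    by_cases hz : η * Real.sqrt n ≤ |lin W z|
    · exact Or.inr hz
    left
    refine ⟨m, hm, ?_⟩
    rw [hW, not_le, abs_lt] at hz
    have e : lin (A m) z = ∑ p : Fin n × Fin n, m p.1 * m p.2 * z (Sum.inl p) +
        nrm m ^ 2 * z (Sum.inr (Sum.inl ())) := by
      simp [lin, A, Fintype.sum_sum_type]
    rw [e]
    have h1 : -(η * Real.sqrt n) * nrm m ^ 2 ≤ nrm m ^ 2 * z (Sum.inr (Sum.inl ())) := by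
      nlinarith [sq_nonneg (nrm m), hz.1]
    have h2 : Real.sqrt n / β * (c - f (∑ i, v i * m i) - g (nrm m)) <
        ∑ p : Fin n × Fin n, m p.1 * m p.2 * z (Sum.inl p) := by
      rw [div_mul_eq_mul_div, div_lt_iff₀ hβ]
      have : Real.sqrt n * (Real.sqrt n * (c - f (∑ i, v i * m i) - g (nrm m))) <
        Real.sqrt n * ((∑ p : Fin n × Fin n, m p.1 * m p.2 * z (Sum.inl p)) * β) := by
        rw [← mul_assoc, hsn2]
        linarith
      exact lt_of_mul_lt_mul_left this hsn.le
    simp only [φ]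
    linarith
  have hsub2 : {z | ∃ m ∈ T, φ m ≤ lin (B m) z} ⊆ {z | η * Real.sqrt n ≤ |lin V z|} ∪
      {z | η * n ≤ |∑ i : Fin n, z (Sum.inr (Sum.inr i)) ^ 2 - n|} := by
    rintro z ⟨m, hm, hle⟩
    by_contra hcon
    rw [Set.mem_union, not_or] at hcon
    obtain ⟨z1, z2⟩ := hcon
    simp only [Set.mem_ofPred_eq, not_le] at z1 z2
    rw [hV] at z1
    set G : Fin n → ℝ := fun i => z (Sum.inr (Sum.inr i)) with hG
    have e : lin (B m) z = Real.sqrt 2 * nrm m * ∑ i, G i * m i := by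
      simp only [lin, B, Fintype.sum_sum_type, Sum.elim_inl, Sum.elim_inr, Finset.mul_sum]
      simp only [zero_mul, Finset.sum_const_zero, zero_add]
      exact Finset.sum_congr rfl fun i _ => by simp [hG]; ring
    rw [e] at hle
    have hp := proj_bound v m G hv
    have hGn : nrm G ≤ (1 + η) * Real.sqrt n := by
      apply Real.sqrt_le_iff.2
      refine ⟨by positivity, ?_⟩
      rw [mul_pow, Real.sq_sqrt hn'.le]
      have := (abs_lt.1 z2).2
      nlinarith [mul_pos hη hn', mul_pos (mul_pos hη hη) hn']
    set r := nrm m with hr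
    set a := ∑ i, v i * m i with ha
    have hr0 : 0 ≤ r := nrm_nonneg m
    have hr1 : r ≤ 1 := (hR hm).2
    -- angle
    obtain ⟨α, hα, hrα⟩ : ∃ α ∈ Set.Icc (-1 : ℝ) 1, r * α = a := by
      rcases hr0.eq_or_lt with h | h
      · refine ⟨0, by norm_num, ?_⟩
        have := hvm m
        rw [← hr, ← h, abs_nonpos_iff] at this
        rw [ha, this]; simp
      · refine ⟨a / r, ?_, by field_simp⟩
        have := hvm m
        rw [abs_le] at this
        constructor
        · rw [le_div_iff₀ h]; linarith [this.1]
        · rw [div_le_one h]; exact this.2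
    have hSα := hS r hm α hα
    rw [hrα] at hSα
    have hα2 : 0 ≤ 1 - α ^ 2 := by nlinarith [hα.1, hα.2]
    have hs1 : Real.sqrt (r ^ 2 - a ^ 2) = r * Real.sqrt (1 - α ^ 2) := by
      rw [← hrα, show r ^ 2 - (r * α) ^ 2 = r ^ 2 * (1 - α ^ 2) by ring,
        Real.sqrt_mul (sq_nonneg r), Real.sqrt_sq hr0]
    rw [hs1] at hp
    rw [Real.sqrt_mul (by norm_num)] at hSα
    set q := Real.sqrt (1 - α ^ 2) with hq
    have hq0 : 0 ≤ q := Real.sqrt_nonneg _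
    have hq1 : q ≤ 1 := Real.sqrt_le_one.2 (by nlinarith)
    set w := Real.sqrt 2 with hw
    have hw0 : 0 ≤ w := Real.sqrt_nonneg _
    have hw1 : w ≤ 3 / 2 := Real.sqrt_le_iff.2 ⟨by norm_num, by norm_num⟩
    have har : |a| ≤ r := hvm m
    have hp2 : ∑ i, G i * m i ≤ r * (η * Real.sqrt n) + (1 + η) * Real.sqrt n * (r * q) := by
      refine hp.trans (add_le_add ?_ ?_)
      · exact mul_le_mul har z1.le (abs_nonneg _) hr0
      · exact mul_le_mul_of_nonneg_right hGn (by positivity)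
    have h3 : w * r * ∑ i, G i * m i ≤
        Real.sqrt n * (w * r ^ 2 * (η + (1 + η) * q)) := by
      calc _ ≤ w * r * (r * (η * Real.sqrt n) + (1 + η) * Real.sqrt n * (r * q)) :=
            mul_le_mul_of_nonneg_left hp2 (by positivity)
        _ = _ := by ring
    have h4 : Real.sqrt n * ((c - f a - g r) / β - η * r ^ 2) ≤
        Real.sqrt n * (w * r ^ 2 * (η + (1 + η) * q)) := by
      refine le_trans (le_of_eq ?_) (hle.trans h3)
      simp only [φ]
      ring
    have h5 := le_of_mul_le_mul_left h4 hsn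
    have h6 : (c - f a - g r) / β ≤ w * r ^ 2 * q + 4 * η := by
      exact arith1 hη hr0 hr1 hq0 hq1 hw0 hw1 h5
    rw [div_le_iff₀ hβ] at h6
    nlinarith
  calc _ ≤ gam ((Fin n × Fin n) ⊕ (Unit ⊕ Fin n)) {z | ∃ m ∈ T, φ m < lin (A m) z} + gam ((Fin n × Fin n) ⊕ (Unit ⊕ Fin n)) {z | η * Real.sqrt n ≤ |lin W z|} :=
        (measure_mono hsub).trans (measure_union_le _ _)
    _ ≤ (gam ((Fin n × Fin n) ⊕ (Unit ⊕ Fin n)) {z | η * Real.sqrt n ≤ |lin V z|} +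
      gam ((Fin n × Fin n) ⊕ (Unit ⊕ Fin n)) {z | η * n ≤ |∑ i : Fin n, z (Sum.inr (Sum.inr i)) ^ 2 - n|}) +
        gam ((Fin n × Fin n) ⊕ (Unit ⊕ Fin n)) {z | η * Real.sqrt n ≤ |lin W z|} := by
        gcongr
        exact key.trans ((measure_mono hsub2).trans (measure_union_le _ _))
    _ ≤ (ENNReal.ofReal (max 1 C / (η ^ 2 * n)) + ENNReal.ofReal (max 1 C / (η ^ 2 * n))) +
      ENNReal.ofReal (max 1 C / (η ^ 2 * n)) := by gcongr
    _ = _ := by ring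

lemma ev_div (C η δ : ℝ) (hη : 0 < η) (hδ : 0 < δ) :
    ∀ᶠ n : ℕ in atTop, C / (η ^ 2 * n) ≤ δ := by
  have h : Tendsto (fun n : ℕ => C / (η ^ 2 * n)) atTop (nhds 0) :=
    tendsto_const_nhds.div_atTop
      (tendsto_natCast_atTop_atTop.const_mul_atTop (by positivity))
  exact h.eventually_le_const hδ

lemma exists_onb (n : ℕ) (h : Fin (n + 1) → ℝ) : ∃ b : Fin (n + 1) → Fin (n + 1) → ℝ,
    (∀ a c, ∑ i, b a i * b c i = if a = c then 1 else 0) ∧ ∀ i, h i = nrm h * b 0 i := by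
  by_cases hh : nrm h = 0
  · refine ⟨fun a i => if a = i then 1 else 0, by simp [eq_comm], fun i => ?_⟩
    have h2 := nrm_sq h
    rw [hh] at h2
    have := (Finset.sum_eq_zero_iff_of_nonneg (fun i _ => sq_nonneg (h i))).1
      (by rw [← h2]; norm_num) i (Finset.mem_univ i)
    rw [hh]; simpa using this
  · let v : Fin (n + 1) → EuclideanSpace ℝ (Fin (n + 1)) := fun _ =>
      WithLp.toLp 2 (fun i => h i / nrm h)
    have hv : Orthonormal ℝ (({0} : Set (Fin (n + 1))).domRestrict v) := by
      constructor
      · intro i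
        have : ‖v 0‖ ^ 2 = 1 := by
          rw [EuclideanSpace.real_norm_sq_eq]
          simp only [v, div_pow, ← Finset.sum_div, ← nrm_sq]
          field_simp
        have h0 := norm_nonneg (v 0)
        show ‖v 0‖ = 1
        nlinarith
      · intro i j hij
        exact absurd (Subsingleton.elim i j) hij
    obtain ⟨b, hb⟩ := hv.exists_orthonormalBasis_extension_of_card_eq (by simp)
    refine ⟨fun a i => b a i, fun a c => ?_, fun i => ?_⟩
    · have := (orthonormal_iff_ite.1 b.orthonormal) c a
      simp only [PiLp.inner_apply, RCLike.inner_apply, conj_trivial] at this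
      rw [this]; simp [eq_comm]
    · show h i = nrm h * b 0 i
      rw [hb 0 rfl]
      simp only [v]
      field_simp

lemma ten {n : ℕ} (x y x' y' : Fin n → ℝ) :
    ∑ p : Fin n × Fin n, (x p.1 * y p.2) * (x' p.1 * y' p.2) =
      (∑ i, x i * x' i) * (∑ i, y i * y' i) := by
  rw [Fintype.sum_prod_type, Finset.sum_mul_sum]
  exact Finset.sum_congr rfl fun i _ => Finset.sum_congr rfl fun j _ => by ring

/-- set of good matrices -/
def good (α : ℝ) {n : ℕ} (h : Fin n → ℝ) (c : ℝ) : Set (Fin n × Fin n → ℝ) :=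
  {Z | ∃ w : Fin n → ℝ, ∑ i, w i ^ 2 = 1 ∧ ∑ i, w i * h i = α * nrm h ∧
    c ≤ ∑ p : Fin n × Fin n, w p.1 * w p.2 * Z p}

lemma compact_sphere (n : ℕ) : IsCompact {w : Fin n → ℝ | ∑ i, w i ^ 2 = 1} := by
  refine (isCompact_univ_pi (fun _ : Fin n => isCompact_Icc (a := (-1 : ℝ)) (b := 1))).of_isClosed_subset
    (isClosed_eq (by fun_prop) continuous_const) ?_
  intro w hw i _
  have : w i ^ 2 ≤ 1 := by
    rw [← (show ∑ i, w i ^ 2 = 1 from hw)]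
    exact Finset.single_le_sum (f := fun i => w i ^ 2) (fun i _ => sq_nonneg _) (Finset.mem_univ i)
  exact abs_le.1 ((sq_le_one_iff_abs_le_one _).1 this)

lemma closed_good (α : ℝ) (n : ℕ) (c : ℝ) :
    IsClosed {x : (Fin n → ℝ) × (Fin n × Fin n → ℝ) | x.2 ∈ good α x.1 c} := by
  let K := {w : Fin n → ℝ | ∑ i, w i ^ 2 = 1}
  have : CompactSpace K := isCompact_iff_compactSpace.1 (compact_sphere n)
  let S : Set (K × ((Fin n → ℝ) × (Fin n × Fin n → ℝ))) :=
    {y | ∑ i, y.1.1 i * y.2.1 i = α * nrm y.2.1} ∩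
      {y | c ≤ ∑ p : Fin n × Fin n, y.1.1 p.1 * y.1.1 p.2 * y.2.2 p}
  have hc : ∀ i, Continuous fun y : K × ((Fin n → ℝ) × (Fin n × Fin n → ℝ)) => y.1.1 i := fun i =>
    (continuous_apply i).comp (continuous_subtype_val.comp continuous_fst)
  have hS : IsClosed S := by
    apply IsClosed.inter
    · exact isClosed_eq (continuous_finsetSum _ fun i _ => (hc i).mul (by fun_prop))
        (continuous_const.mul (continuous_nrm.comp (by fun_prop)))
    · exact isClosed_le continuous_const
        (continuous_finsetSum _ fun p _ => ((hc p.1).mul (hc p.2)).mul (by fun_prop))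
  have := isClosedMap_snd_of_compactSpace S hS
  convert this using 1
  ext x
  constructor
  · rintro ⟨w, h1, h2, h3⟩
    exact ⟨(⟨w, h1⟩, x), ⟨h2, h3⟩, rfl⟩
  · rintro ⟨⟨w, y⟩, ⟨h2, h3⟩, rfl⟩
    exact ⟨w.1, w.2, h2, h3⟩

lemma fub (α : ℝ) (n : ℕ) (c : ℝ) (δ : ENNReal)
    (h : ∀ h : Fin n → ℝ, gam (Fin n × Fin n) {Z | Z ∉ good α h c} ≤ δ) :
    gam (Fin n ⊕ (Fin n × Fin n)) {z | (fun p => z (Sum.inr p)) ∉ good α (fun i => z (Sum.inl i)) c}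
      ≤ δ := by
  have hmp := measurePreserving_sumPiEquivProdPi
    (fun _ : Fin n ⊕ (Fin n × Fin n) => gaussianReal 0 1)
  let S : Set ((Fin n → ℝ) × (Fin n × Fin n → ℝ)) := {x | x.2 ∈ good α x.1 c}ᶜ
  have hS : MeasurableSet S := (closed_good α n c).measurableSet.compl
  have h1 := hmp.measure_preimage hS.nullMeasurableSet
  have h2 : ((gam (Fin n)).prod (gam (Fin n × Fin n))) S ≤ δ := by
    rw [Measure.prod_apply hS]
    calc _ ≤ ∫⁻ _, δ ∂(gam (Fin n)) := lintegral_mono fun x => h x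
      _ = δ := by simp
  exact (le_of_eq h1).trans h2

section comb
variable {n : ℕ} (b : Fin (n + 1) → Fin (n + 1) → ℝ)
  (hb : ∀ a c, ∑ i, b a i * b c i = if a = c then 1 else 0) (c : Fin (n + 1) → ℝ)

lemma comb1 (hb : ∀ a c, ∑ i, b a i * b c i = if a = c then 1 else 0) :
    ∑ i, (∑ a, c a * b a i) ^ 2 = ∑ a, c a ^ 2 := by
  rw [sum_sq_gram]
  simp [hb, sq]

lemma comb2 (hb : ∀ a c, ∑ i, b a i * b c i = if a = c then 1 else 0)
    (h : Fin (n + 1) → ℝ) (hh : ∀ i, h i = nrm h * b 0 i) :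
    ∑ i, (∑ a, c a * b a i) * h i = c 0 * nrm h := by
  have : ∀ i, (∑ a, c a * b a i) * h i = ∑ a, c a * nrm h * (b a i * b 0 i) := by
    intro i
    rw [Finset.sum_mul]
    refine Finset.sum_congr rfl fun a _ => ?_
    rw [hh i]; ring
  simp only [this]
  rw [Finset.sum_comm]
  simp [← Finset.mul_sum, hb]

lemma comb3 (Z : Fin (n + 1) × Fin (n + 1) → ℝ) :
    ∑ p : Fin (n + 1) × Fin (n + 1), (∑ a, c a * b a p.1) * (∑ a, c a * b a p.2) * Z p =
      ∑ a, ∑ e, c a * c e * lin (fun p => b a p.1 * b e p.2) Z := by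
  simp_rw [Finset.sum_mul_sum, Finset.sum_mul, lin, Finset.mul_sum]
  rw [Finset.sum_comm]
  refine Finset.sum_congr rfl fun a _ => ?_
  rw [Finset.sum_comm]
  refine Finset.sum_congr rfl fun e _ => Finset.sum_congr rfl fun p _ => ?_
  ring
end comb

noncomputable def VV (α ρ : ℝ) : ℕ → ℝ
  | 0 => 0
  | k + 1 => Real.sqrt 2 * α ^ 2 * ρ + ρ ^ 2 * VV α ρ k

def LC (α V : ℝ) : Prop := ∀ ε > 0, ∀ δ > 0, ∀ᶠ n : ℕ in atTop, ∀ h : Fin n → ℝ,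
  gam (Fin n × Fin n) {Z | Z ∉ good α h (Real.sqrt n * (V - ε))} ≤ ENNReal.ofReal δ

lemma LC_zero (α ρ : ℝ) (hαρ : α ^ 2 + ρ ^ 2 = 1) : LC α 0 := by
  intro ε hε δ hδ
  filter_upwards [ev_div 1 ε δ hε hδ, eventually_ge_atTop 2] with n h1 hn h
  obtain ⟨n, rfl⟩ := Nat.exists_eq_add_of_le' hn
  obtain ⟨b, hb, hh⟩ := exists_onb (n + 1) h
  let c : Fin (n + 1 + 1) → ℝ := Fin.cons α (Fin.cons ρ fun _ => 0)
  let w : Fin (n + 1 + 1) → ℝ := fun i => ∑ a, c a * b a i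
  have hw1 : ∑ i, w i ^ 2 = 1 := by
    rw [comb1 b c hb, Fin.sum_univ_succ, Fin.sum_univ_succ]
    simp [c, hαρ]
  have hw2 : ∑ i, w i * h i = α * nrm h := by
    rw [comb2 b c hb h hh]; simp [c]
  have hn' : (0 : ℝ) < ((n + 2 : ℕ) : ℝ) := by positivity
  have hsub : {Z | Z ∉ good α h (Real.sqrt ((n + 2 : ℕ) : ℝ) * (0 - ε))} ⊆
      {Z | ε * Real.sqrt ((n + 2 : ℕ) : ℝ) ≤ |lin (fun p => w p.1 * w p.2) Z|} := by
    intro Z hZ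
    by_contra hc
    apply hZ
    refine ⟨w, hw1, hw2, ?_⟩
    rw [Set.mem_ofPred_eq, not_le] at hc
    have := (abs_lt.1 hc).1
    unfold lin at this
    linarith
  refine (measure_mono hsub).trans ((cheb_lin _ _ (by positivity)).trans ?_)
  apply ENNReal.ofReal_le_ofReal
  refine le_trans (le_of_eq ?_) h1
  congr 1
  · have := ten w w w w
    simp only [← sq] at this
    rw [this, hw1]; norm_num
  · rw [mul_pow, Real.sq_sqrt hn'.le]

lemma arith2 {α ρ V η s t d H wG : ℝ} (hρ0 : 0 ≤ ρ) (hαρ : α ^ 2 + ρ ^ 2 = 1)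
    (hV0 : 0 ≤ V) (hV2 : V ≤ 2) (hη : 0 < η) (hs : 0 ≤ s) (hts : t ≤ s)
    (ht : (1 - η) * s ≤ t) (ht0 : 0 ≤ t) (hd : -(η * s) ≤ d) (hH : (1 - η) * s ≤ H) (hG : t * (V - η) ≤ wG) :
    s * (Real.sqrt 2 * α ^ 2 * ρ + ρ ^ 2 * V - 6 * η) ≤
      α ^ 2 * d + Real.sqrt 2 * α * ρ * (α * H) + ρ ^ 2 * wG := by
  have hw0 : 0 ≤ Real.sqrt 2 := Real.sqrt_nonneg _
  have hw1 : Real.sqrt 2 ≤ 3 / 2 := Real.sqrt_le_iff.2 ⟨by norm_num, by norm_num⟩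
  have hα1 : α ^ 2 ≤ 1 := by nlinarith [sq_nonneg ρ]
  have hρ1 : ρ ^ 2 ≤ 1 := by nlinarith [sq_nonneg α]
  have hρ2 : ρ ≤ 1 := by nlinarith
  have hηs : 0 ≤ η * s := by positivity
  have h1 : -(η * s) ≤ α ^ 2 * d := by nlinarith [sq_nonneg α]
  have hk0 : 0 ≤ Real.sqrt 2 * α ^ 2 * ρ := by positivity
  have hk1 : Real.sqrt 2 * α ^ 2 * ρ ≤ 2 := by
    have : Real.sqrt 2 * α ^ 2 ≤ 3 / 2 := by nlinarith [sq_nonneg α]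
    have h0 : 0 ≤ Real.sqrt 2 * α ^ 2 := by positivity
    nlinarith
  have h2 : Real.sqrt 2 * α ^ 2 * ρ * s - 2 * (η * s) ≤ Real.sqrt 2 * α ^ 2 * ρ * H := by
    nlinarith
  have h3 : s * V - 3 * (η * s) ≤ wG := by nlinarith
  have h4 : ρ ^ 2 * (s * V) - 3 * (η * s) ≤ ρ ^ 2 * wG := by
    nlinarith [sq_nonneg ρ]
  nlinarith

set_option maxHeartbeats 1000000 in
lemma LC_succ (α ρ V : ℝ) (hρ0 : 0 ≤ ρ) (hαρ : α ^ 2 + ρ ^ 2 = 1) (hV0 : 0 ≤ V) (hV2 : V ≤ 2)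
    (ih : LC α V) : LC α (Real.sqrt 2 * α ^ 2 * ρ + ρ ^ 2 * V) := by
  obtain ⟨C, hC⟩ := lln
  intro ε hε δ hδ
  set η := min (ε / 6) 1 with hηdef
  have hη : 0 < η := by positivity
  have hη1 : η ≤ 1 := min_le_right _ _
  have hη6 : 6 * η ≤ ε := by have := min_le_left (ε / 6) 1; linarith
  have hev := ((ih η hη (δ / 3) (by positivity)).and (ev_div 1 η (δ / 3) hη (by positivity))).and
    ((ev_div C η (δ / 3) hη (by positivity)).and
      ((eventually_ge_atTop 1).and (tendsto_natCast_atTop_atTop.eventually_ge_atTop (1 / η))))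
  obtain ⟨N0, hN0⟩ := eventually_atTop.1 hev
  refine eventually_atTop.2 ⟨N0 + 1, fun n1 hn1 => ?_⟩
  obtain ⟨n, rfl⟩ : ∃ n, n1 = n + 1 := ⟨n1 - 1, by omega⟩
  have hn := hN0 n (by omega)
  intro h
  clear hn1
  obtain ⟨⟨hn1, hn2⟩, hn3, hn4, hn5⟩ := hn
  have hn5' : 1 ≤ η * n := by rwa [div_le_iff₀ hη, mul_comm] at hn5
  obtain ⟨b, hb, hh⟩ := exists_onb n h
  have hn' : (0 : ℝ) < n := by exact_mod_cast hn4
  set s := Real.sqrt ((n + 1 : ℕ) : ℝ) with hs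
  set t := Real.sqrt (n : ℝ) with ht
  have hs0 : 0 ≤ s := Real.sqrt_nonneg _
  have ht0 : 0 < t := Real.sqrt_pos.2 hn'
  have hs2 : s ^ 2 = n + 1 := by rw [hs, Real.sq_sqrt (by positivity)]; push_cast; ring
  have ht2 : t ^ 2 = n := Real.sq_sqrt hn'.le
  have hts : t ≤ s := by apply Real.sqrt_le_sqrt; push_cast; linarith
  have hst : (1 - η) * s ≤ t := by
    apply Real.le_sqrt_of_sq_le
    rw [mul_pow, hs2]
    nlinarith
  -- orthonormal forms
  let w2 := Real.sqrt 2
  have hw2 : w2 * w2 = 2 := Real.mul_self_sqrt (by norm_num)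
  have hw20 : w2 ≠ 0 := by intro h; rw [h] at hw2; norm_num at hw2
  let D : Unit ⊕ (Fin n ⊕ (Fin n × Fin n)) → (Fin (n + 1) × Fin (n + 1) → ℝ) :=
    Sum.elim (fun _ p => b 0 p.1 * b 0 p.2)
      (Sum.elim (fun j p => (b 0 p.1 * b j.succ p.2 + b j.succ p.1 * b 0 p.2) / w2)
        (fun q p => b q.1.succ p.1 * b q.2.succ p.2))
  have gr : ∀ a e a' e', ∑ p : Fin (n + 1) × Fin (n + 1), (b a p.1 * b e p.2) * (b a' p.1 * b e' p.2) =
      (if a = a' then 1 else 0) * (if e = e' then 1 else 0) := by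
    intro a e a' e'
    rw [ten, hb, hb]
  have hD : ∀ i j, ∑ k, D i k * D j k = if i = j then 1 else 0 := by
    have x1 : ∀ (x y z w : ℝ), (x + y) / w2 * ((z + w) / w2) = (x * z + x * w + y * z + y * w) / 2 := by
      intro x y z w
      rw [← hw2]; field_simp; ring
    have x2 : ∀ x y z : ℝ, x * ((y + z) / w2) = (x * y + x * z) / w2 := by intros; ring
    have x3 : ∀ x y z : ℝ, ((y + z) / w2) * x = (y * x + z * x) / w2 := by intros; ring
    rintro (_ | i | ⟨i, i'⟩) (_ | j | ⟨j, j'⟩) <;>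
      simp only [D, Sum.elim_inl, Sum.elim_inr, x1, x2, x3, ← Finset.sum_div, Finset.sum_add_distrib, gr]
    · simp
    · simp [Fin.succ_ne_zero, (Fin.succ_ne_zero _).symm]
    · simp [Fin.succ_ne_zero, (Fin.succ_ne_zero _).symm]
    · simp [Fin.succ_ne_zero, (Fin.succ_ne_zero _).symm]
    · by_cases hij : i = j <;> simp [hij, Fin.succ_ne_zero, (Fin.succ_ne_zero _).symm]
    · simp [Fin.succ_ne_zero, (Fin.succ_ne_zero _).symm]
    · simp [Fin.succ_ne_zero, (Fin.succ_ne_zero _).symm]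
    · simp [Fin.succ_ne_zero, (Fin.succ_ne_zero _).symm]
    · simp only [Fin.succ_inj, Sum.inr.injEq, Prod.mk.injEq]
      by_cases h1 : i = j <;> by_cases h2 : i' = j' <;> simp [h1, h2]
  have hlaw := law_orth D hD
  let b1 : Set (Unit ⊕ (Fin n ⊕ (Fin n × Fin n)) → ℝ) := {z | η * s ≤ |z (Sum.inl ())|}
  let b2 : Set (Unit ⊕ (Fin n ⊕ (Fin n × Fin n)) → ℝ) :=
    {z | η * n ≤ |∑ i, z (Sum.inr (Sum.inl i)) ^ 2 - n|}
  let b3 : Set (Unit ⊕ (Fin n ⊕ (Fin n × Fin n)) → ℝ) :=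
    {z | (fun p => z (Sum.inr (Sum.inr p))) ∉ good α (fun i => z (Sum.inr (Sum.inl i))) (t * (V - η))}
  have m1 : gam _ b1 ≤ ENNReal.ofReal (δ / 3) := by
    have := cheb_lin (fun k : Unit ⊕ (Fin n ⊕ (Fin n × Fin n)) => if Sum.inl () = k then 1 else 0)
      (η * s) (by positivity)
    simp only [lin_single] at this
    refine this.trans (ENNReal.ofReal_le_ofReal (le_trans ?_ hn2))
    rw [mul_pow, hs2]
    have : ∑ k : Unit ⊕ (Fin n ⊕ (Fin n × Fin n)), (if Sum.inl () = k then (1 : ℝ) else 0) ^ 2 = 1 := by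
      simp
    rw [this]
    gcongr
    linarith
  have m2 : gam _ b2 ≤ ENNReal.ofReal (δ / 3) := by
    refine le_trans ?_ ((hC η hη n hn4).trans (ENNReal.ofReal_le_ofReal hn3))
    rw [← gam_marg (κ := Unit ⊕ (Fin n ⊕ (Fin n × Fin n))) (fun i : Fin n => Sum.inr (Sum.inl i))
      (Sum.inr_injective.comp Sum.inl_injective)]
    exact Measure.le_map_apply (Measurable.aemeasurable (by fun_prop)) _
  have m3 : gam _ b3 ≤ ENNReal.ofReal (δ / 3) := by
    refine le_trans ?_ (fub α n (t * (V - η)) _ hn1)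
    rw [← gam_marg (κ := Unit ⊕ (Fin n ⊕ (Fin n × Fin n))) (fun i => Sum.inr i)
      Sum.inr_injective]
    exact Measure.le_map_apply (Measurable.aemeasurable (by fun_prop)) _
  have hsub : {Z | Z ∉ good α h (s * (Real.sqrt 2 * α ^ 2 * ρ + ρ ^ 2 * V - ε))} ⊆
      (fun z i => lin (D i) z) ⁻¹' (b1 ∪ b2 ∪ b3) := by
    intro Z hZ
    by_contra hcon
    rw [Set.mem_preimage, Set.mem_union, Set.mem_union, not_or, not_or] at hcon
    obtain ⟨⟨c1, c2⟩, c3⟩ := hcon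
    apply hZ
    simp only [b1, b2, b3, Set.mem_ofPred_eq, not_le, not_not] at c1 c2 c3
    obtain ⟨w, hw1, hww, hwG⟩ := c3
    set H : Fin n → ℝ := fun i => lin (D (Sum.inr (Sum.inl i))) Z with hH
    let c : Fin (n + 1) → ℝ := Fin.cons α (fun j => ρ * w j)
    refine ⟨fun i => ∑ a, c a * b a i, ?_, ?_, ?_⟩
    · rw [comb1 b c hb, Fin.sum_univ_succ]
      simp only [c, Fin.cons_zero, Fin.cons_succ, mul_pow, ← Finset.mul_sum, hw1]
      linarith
    · rw [comb2 b c hb h hh]; simp [c]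
    · rw [comb3 b c Z]
      have hval : ∑ a, ∑ e, c a * c e * lin (fun p => b a p.1 * b e p.2) Z =
          α ^ 2 * lin (D (Sum.inl ())) Z + Real.sqrt 2 * α * ρ * (∑ i, w i * H i) +
            ρ ^ 2 * ∑ p : Fin n × Fin n, w p.1 * w p.2 * lin (D (Sum.inr (Sum.inr p))) Z := by
        have hHi : ∀ i, w2 * H i = lin (fun p => b 0 p.1 * b i.succ p.2) Z +
            lin (fun p => b i.succ p.1 * b 0 p.2) Z := by
          intro i
          simp only [hH, lin, D, Sum.elim_inl, Sum.elim_inr, Finset.mul_sum, ← Finset.sum_add_distrib]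
          refine Finset.sum_congr rfl fun p _ => ?_
          field_simp
        have e1 : Real.sqrt 2 * α * ρ * (∑ i, w i * H i) = ∑ i, α * ρ * w i * (w2 * H i) := by
          rw [Finset.mul_sum]
          exact Finset.sum_congr rfl fun i _ => by simp only [w2]; ring
        rw [e1]
        simp only [hHi, mul_add, Finset.sum_add_distrib]
        rw [Fin.sum_univ_succ]
        simp only [Fin.sum_univ_succ (n := n), c, Fin.cons_zero, Fin.cons_succ, Finset.sum_add_distrib]
        rw [Fintype.sum_prod_type]
        simp only [Finset.mul_sum, D, Sum.elim_inl, Sum.elim_inr]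
        have a1 : ∀ i j : Fin n, ρ * w i * (ρ * w j) * lin (fun p => b i.succ p.1 * b j.succ p.2) Z =
          ρ ^ 2 * (w i * w j * lin (fun p => b i.succ p.1 * b j.succ p.2) Z) := by intros; ring
        have a2 : ∀ i : Fin n, ρ * w i * α * lin (fun p => b i.succ p.1 * b 0 p.2) Z =
          α * ρ * w i * lin (fun p => b i.succ p.1 * b 0 p.2) Z := by intros; ring
        have a3 : ∀ i : Fin n, α * (ρ * w i) * lin (fun p => b 0 p.1 * b i.succ p.2) Z =
          α * ρ * w i * lin (fun p => b 0 p.1 * b i.succ p.2) Z := by intros; ring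
        simp only [a1, a2, a3]
        ring
      rw [hval, hww]
      have hnH : (1 - η) * s ≤ nrm H := by
        apply Real.le_sqrt_of_sq_le
        have := (abs_lt.1 c2).1
        rw [mul_pow, hs2]
        nlinarith
      have := arith2 hρ0 hαρ hV0 hV2 hη hs0 hts hst ht0.le (abs_lt.1 c1).1.le hnH hwG
      refine le_trans ?_ this
      apply mul_le_mul_of_nonneg_left _ hs0
      linarith
  refine (measure_mono hsub).trans ?_
  refine (Measure.le_map_apply (Measurable.aemeasurable
    (by unfold lin; fun_prop)) _).trans ?_
  rw [hlaw]
  calc _ ≤ gam _ b1 + gam _ b2 + gam _ b3 :=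
        (measure_union_le _ _).trans (by gcongr; exact measure_union_le _ _)
    _ ≤ ENNReal.ofReal (δ / 3) + ENNReal.ofReal (δ / 3) + ENNReal.ofReal (δ / 3) := by gcongr
    _ = ENNReal.ofReal δ := by
      rw [← ENNReal.ofReal_add (by positivity) (by positivity),
        ← ENNReal.ofReal_add (by positivity) (by positivity)]
      congr 1; ring

lemma VV_bd (α ρ : ℝ) (hρ0 : 0 ≤ ρ) (hαρ : α ^ 2 + ρ ^ 2 = 1) (k : ℕ) :
    0 ≤ VV α ρ k ∧ VV α ρ k = Real.sqrt 2 * ρ * (1 - (ρ ^ 2) ^ k) := by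
  induction k with
  | zero => simp [VV]
  | succ k ih =>
    refine ⟨?_, ?_⟩
    · have := ih.1
      simp only [VV]; positivity
    · simp only [VV]
      rw [ih.2]
      have : α ^ 2 = 1 - ρ ^ 2 := by linarith
      rw [this]; ring

lemma LC_lim (α ρ : ℝ) (hρ0 : 0 ≤ ρ) (hαρ : α ^ 2 + ρ ^ 2 = 1) (hα : α ≠ 0) :
    LC α (Real.sqrt 2 * ρ) := by
  have hw1 : Real.sqrt 2 ≤ 3 / 2 := Real.sqrt_le_iff.2 ⟨by norm_num, by norm_num⟩
  have hw0 : 0 ≤ Real.sqrt 2 := Real.sqrt_nonneg _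
  have hα2 : 0 < α ^ 2 := by positivity
  have hρ1 : ρ ≤ 1 := by nlinarith
  have hk : ∀ k, LC α (VV α ρ k) := by
    intro k
    induction k with
    | zero => exact LC_zero α ρ hαρ
    | succ k ih =>
      refine LC_succ α ρ _ hρ0 hαρ (VV_bd α ρ hρ0 hαρ k).1 ?_ ih
      rw [(VV_bd α ρ hρ0 hαρ k).2]
      have : 0 ≤ (ρ ^ 2) ^ k := by positivity
      have h2 : 0 ≤ Real.sqrt 2 * ρ := by positivity
      nlinarith
  intro ε hε δ hδ
  have hlim : Tendsto (fun k => Real.sqrt 2 * ρ * (1 - (ρ ^ 2) ^ k)) atTop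
      (nhds (Real.sqrt 2 * ρ * (1 - 0))) :=
    tendsto_const_nhds.mul (tendsto_const_nhds.sub
      (tendsto_pow_atTop_nhds_zero_of_lt_one (sq_nonneg ρ) (by linarith)))
  rw [sub_zero, mul_one] at hlim
  obtain ⟨k, hkε⟩ := (hlim.eventually_const_le (show Real.sqrt 2 * ρ - ε / 2 < Real.sqrt 2 * ρ by linarith)).exists
  rw [← (VV_bd α ρ hρ0 hαρ k).2] at hkε
  filter_upwards [hk k (ε / 2) (by positivity) δ hδ] with n hn h
  refine (measure_mono ?_).trans (hn h)
  intro Z hZ hg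
  apply hZ
  obtain ⟨w, h1, h2, h3⟩ := hg
  refine ⟨w, h1, h2, le_trans ?_ h3⟩
  apply mul_le_mul_of_nonneg_left _ (Real.sqrt_nonneg _)
  linarith

lemma quad_sym {n : ℕ} (m : Fin n → ℝ) (Z : Fin n × Fin n → ℝ) :
    ∑ p : Fin n × Fin n, m p.1 * m p.2 * ((Z p + Z p.swap) / 2) =
      ∑ p : Fin n × Fin n, m p.1 * m p.2 * Z p := by
  have h : ∑ p : Fin n × Fin n, m p.1 * m p.2 * Z p.swap =
      ∑ p : Fin n × Fin n, m p.1 * m p.2 * Z p := by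
    rw [← (Equiv.prodComm (Fin n) (Fin n)).sum_comp]
    refine Finset.sum_congr rfl fun p _ => ?_
    simp [mul_comm]
  have h2 : ∀ p : Fin n × Fin n, m p.1 * m p.2 * ((Z p + Z p.swap) / 2) =
      (m p.1 * m p.2 * Z p) / 2 + (m p.1 * m p.2 * Z p.swap) / 2 := fun p => by ring
  simp only [h2, Finset.sum_add_distrib, ← Finset.sum_div]
  rw [h]; ring

lemma quad_eq {n : ℕ} (m : Fin n → ℝ) (J : Matrix (Fin n) (Fin n) ℝ) :
    m ⬝ᵥ J *ᵥ m = ∑ p : Fin n × Fin n, m p.1 * m p.2 * J p.1 p.2 := by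
  simp only [dotProduct, mulVec, Fintype.sum_prod_type, Finset.mul_sum]
  exact Finset.sum_congr rfl fun i _ => Finset.sum_congr rfl fun j _ => by ring

lemma transfer {n : ℕ} {Ω : Type*} [MeasurableSpace Ω] (P : Measure Ω) [IsProbabilityMeasure P]
    (J : Ω → Matrix (Fin n) (Fin n) ℝ) (h : IsGOE P J) (E : Set (Fin n × Fin n → ℝ))
    (hE : MeasurableSet E)
    (hsym : ∀ Z, (fun p : Fin n × Fin n => (Z p + Z p.swap) / 2) ∈ E → Z ∈ E) :
    P {ω | (fun p : Fin n × Fin n => J ω p.1 p.2) ∈ E} ≤ gam (Fin n × Fin n) E := by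
  have h1 : Measurable (fun ω (p : Fin n × Fin n) => J ω p.1 p.2) :=
    measurable_pi_lambda _ fun p => h.2.1 _ _
  have := Measure.le_map_apply (μ := P) h1.aemeasurable E
  rw [goe_law P J h, Measure.map_apply (by fun_prop) hE] at this
  exact this.trans (measure_mono hsym)

lemma meas_upper {n : ℕ} (β c : ℝ) (R : Set ℝ) (f g : ℝ → ℝ) (v : Fin n → ℝ) :
    MeasurableSet {Z : Fin n × Fin n → ℝ | ∃ m : Fin n → ℝ, nrm m ∈ R ∧
      n * c < β * (Real.sqrt n * ∑ p : Fin n × Fin n, m p.1 * m p.2 * Z p) +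
        n * f (∑ i, v i * m i) + n * g (nrm m)} := by
  apply IsOpen.measurableSet
  have : {Z : Fin n × Fin n → ℝ | ∃ m : Fin n → ℝ, nrm m ∈ R ∧
      n * c < β * (Real.sqrt n * ∑ p : Fin n × Fin n, m p.1 * m p.2 * Z p) +
        n * f (∑ i, v i * m i) + n * g (nrm m)} = ⋃ m ∈ {m : Fin n → ℝ | nrm m ∈ R},
        {Z | n * c < β * (Real.sqrt n * ∑ p : Fin n × Fin n, m p.1 * m p.2 * Z p) +
        n * f (∑ i, v i * m i) + n * g (nrm m)} := by
    ext Z; simp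
  rw [this]
  exact isOpen_biUnion fun m _ => isOpen_lt continuous_const (by fun_prop)

lemma meas_good (α : ℝ) {n : ℕ} (h : Fin n → ℝ) (c : ℝ) :
    MeasurableSet {Z | Z ∉ good α h c} := by
  have := (closed_good α n c).preimage (Continuous.prodMk_right h)
  exact this.measurableSet.compl

lemma nrm_smul {n : ℕ} (r : ℝ) (hr : 0 ≤ r) (w : Fin n → ℝ) (hw : ∑ i, w i ^ 2 = 1) :
    nrm (fun i => r * w i) = r := by
  unfold nrm
  simp only [mul_pow, ← Finset.mul_sum, hw, mul_one]
  exact Real.sqrt_sq hr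

lemma abs_dot_le {n : ℕ} (v m : Fin n → ℝ) (hv : ∑ i, v i ^ 2 = 1) :
    |∑ i, v i * m i| ≤ nrm m := by
  have hnv : nrm v = 1 := by unfold nrm; rw [hv]; simp
  rw [abs_le]; constructor
  · have := cs v (fun i => - m i)
    have e : nrm (fun i => - m i) = nrm m := by unfold nrm; simp
    rw [e, hnv] at this
    simp at this; linarith
  · have := cs v m
    rw [hnv] at this; linarith

lemma bdd_L {n : ℕ} (β : ℝ) (R : Set ℝ) (hR1 : R ⊆ Set.Icc 0 1) (hR2 : IsClosed R)
    (f : ℝ → ℝ) (hf : ContinuousOn f (Set.Icc (-1) 1))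
    (g : ℝ → ℝ) (hg : ContinuousOn g R) (v : Fin n → ℝ) (hv : ∑ i, v i ^ 2 = 1)
    (Z : Fin n × Fin n → ℝ) :
    BddAbove ((fun m : Fin n → ℝ => β * (Real.sqrt n * ∑ p : Fin n × Fin n, m p.1 * m p.2 * Z p) +
        n * f (∑ i, v i * m i) + n * g (nrm m)) '' {m | nrm m ∈ R}) := by
  have hvm2 : ∀ m ∈ {m : Fin n → ℝ | nrm m ∈ R}, ∑ i, v i * m i ∈ Set.Icc (-1 : ℝ) 1 := by
    intro m hm
    exact abs_le.1 ((abs_dot_le v m hv).trans (hR1 hm).2)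
  apply IsCompact.bddAbove_image
  · refine (isCompact_univ_pi (fun _ : Fin n => isCompact_Icc (a := (-1 : ℝ)) (b := 1))).of_isClosed_subset
      (hR2.preimage continuous_nrm) ?_
    intro w hw i _
    have h1 : w i ^ 2 ≤ 1 := by
      have : w i ^ 2 ≤ nrm w ^ 2 := by
        rw [nrm_sq]
        exact Finset.single_le_sum (f := fun i => w i ^ 2) (fun i _ => sq_nonneg _) (Finset.mem_univ i)
      have h3 := (hR1 hw).2
      have h4 := nrm_nonneg w
      nlinarith
    exact abs_le.1 ((sq_le_one_iff_abs_le_one _).1 h1)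
  · have c1 : ContinuousOn (fun m : Fin n → ℝ => f (∑ i, v i * m i)) {m | nrm m ∈ R} :=
      hf.comp (Continuous.continuousOn (by fun_prop)) hvm2
    have c2 : ContinuousOn (fun m : Fin n → ℝ => g (nrm m)) {m | nrm m ∈ R} :=
      hg.comp continuous_nrm.continuousOn (fun m hm => hm)
    have c3 : ContinuousOn (fun m : Fin n → ℝ => β * (Real.sqrt n * ∑ p : Fin n × Fin n, m p.1 * m p.2 * Z p))
      {m | nrm m ∈ R} := Continuous.continuousOn (by fun_prop)
    exact (c3.add (continuousOn_const.mul c1)).add (continuousOn_const.mul c2)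

lemma mem_mul_Icc {r α : ℝ} (hr : r ∈ Set.Icc (0 : ℝ) 1) (hα : α ∈ Set.Icc (-1 : ℝ) 1) :
    r * α ∈ Set.Icc (-1 : ℝ) 1 := by
  obtain ⟨a, b⟩ := hr
  obtain ⟨c, d⟩ := hα
  constructor <;> nlinarith

lemma bdd_B (β : ℝ) (R : Set ℝ) (hR1 : R ⊆ Set.Icc 0 1) (hR2 : IsClosed R)
    (f : ℝ → ℝ) (hf : ContinuousOn f (Set.Icc (-1) 1))
    (g : ℝ → ℝ) (hg : ContinuousOn g R) :
    BddAbove {y : ℝ | ∃ r ∈ R, ∃ α ∈ Set.Icc (-1 : ℝ) 1,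
          y = f (r * α) + g r + β * r ^ 2 * Real.sqrt (2 * (1 - α ^ 2))} := by
  have hK : IsCompact R := isCompact_Icc.of_isClosed_subset hR2 hR1
  have h : BddAbove ((fun x : ℝ × ℝ => f (x.1 * x.2) + g x.1 +
      β * x.1 ^ 2 * Real.sqrt (2 * (1 - x.2 ^ 2))) '' (R ×ˢ Set.Icc (-1 : ℝ) 1)) := by
    apply (hK.prod isCompact_Icc).bddAbove_image
    have c1 : ContinuousOn (fun x : ℝ × ℝ => f (x.1 * x.2)) (R ×ˢ Set.Icc (-1 : ℝ) 1) :=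
      hf.comp (Continuous.continuousOn (by fun_prop)) (fun x hx => mem_mul_Icc (hR1 hx.1) hx.2)
    have c2 : ContinuousOn (fun x : ℝ × ℝ => g x.1) (R ×ˢ Set.Icc (-1 : ℝ) 1) :=
      hg.comp continuous_fst.continuousOn (fun x hx => hx.1)
    exact (c1.add c2).add (Continuous.continuousOn (by fun_prop))
  refine h.mono ?_
  rintro y ⟨r, hr, α, hα, rfl⟩
  exact ⟨(r, α), ⟨hr, hα⟩, rfl⟩

lemma perturb (β : ℝ) (f g : ℝ → ℝ) (hf : ContinuousOn f (Set.Icc (-1) 1)) (s r : ℝ)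
    (hr : r ∈ Set.Icc (0 : ℝ) 1) (α : ℝ) (hα : α ∈ Set.Icc (-1 : ℝ) 1)
    (h : s < f (r * α) + g r + β * r ^ 2 * Real.sqrt (2 * (1 - α ^ 2))) :
    ∃ α' ∈ Set.Icc (-1 : ℝ) 1, α' ≠ 0 ∧
      s < f (r * α') + g r + β * r ^ 2 * Real.sqrt (2 * (1 - α' ^ 2)) := by
  by_cases h0 : α = 0
  · subst h0
    have hn : Set.Icc (-1 : ℝ) 1 ∈ nhds (0 : ℝ) := Icc_mem_nhds (by norm_num) (by norm_num)
    have c1 : ContinuousOn (fun x : ℝ => f (r * x)) (Set.Icc (-1 : ℝ) 1) :=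
      hf.comp (Continuous.continuousOn (by fun_prop)) (fun x hx => mem_mul_Icc hr hx)
    have c2 : ContinuousAt (fun x : ℝ => f (r * x) + g r + β * r ^ 2 * Real.sqrt (2 * (1 - x ^ 2))) 0 :=
      ((c1.continuousAt hn).add continuousAt_const).add (Continuous.continuousAt (by fun_prop))
    have ev := (c2.eventually_const_lt h).and hn
    have ev2 : ∀ᶠ x in nhdsWithin (0 : ℝ) {0}ᶜ, _ := ev.filter_mono nhdsWithin_le_nhds
    obtain ⟨x, ⟨h1, h2⟩, h3⟩ := (ev2.and self_mem_nhdsWithin).exists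
    exact ⟨x, h2, h3, h1⟩
  · exact ⟨α, hα, h0, h⟩

/-- Theorem: Maximum on ball, leading order:
`L̃_N / N` converges in probability to `sup_{r ∈ 𝓡, α ∈ [-1,1]} 𝓑̃(α,r)`. -/
theorem stmt_2
    (Ω : ℕ → Type*) [∀ N, MeasurableSpace (Ω N)]
    (P : ∀ N, Measure (Ω N)) (hP : ∀ N, IsProbabilityMeasure (P N))
    (J : ∀ N, Ω N → Matrix (Fin N) (Fin N) ℝ)
    (hJ : ∀ N, 1 ≤ N → IsGOE (P N) (J N))
    (β : ℝ) (hβ : 0 < β)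
    (v : ∀ N, Fin N → ℝ) (hv : ∀ N, 1 ≤ N → ∑ i, v N i ^ 2 = 1)
    (R : Set ℝ) (hR1 : R ⊆ Set.Icc 0 1) (hR2 : IsClosed R)
    (f : ℝ → ℝ) (hf : ContinuousOn f (Set.Icc (-1) 1))
    (g : ℝ → ℝ) (hg : ContinuousOn g R)
    (L : ∀ N, Ω N → ℝ)
    (hL : ∀ N ω, L N ω =
      sSup {y : ℝ | ∃ m : Fin N → ℝ, Real.sqrt (∑ i, m i ^ 2) ∈ R ∧
        y = β * (Real.sqrt N * (m ⬝ᵥ (J N ω) *ᵥ m)) + N * f (v N ⬝ᵥ m) +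
          N * g (Real.sqrt (∑ i, m i ^ 2))}) :
    ∀ ε > 0, Tendsto
      (fun N => P N {ω | ε ≤ |L N ω / N -
        sSup {y : ℝ | ∃ r ∈ R, ∃ α ∈ Set.Icc (-1 : ℝ) 1,
          y = f (r * α) + g r + β * r ^ 2 * Real.sqrt (2 * (1 - α ^ 2))}|})
      atTop (nhds 0) := by
  intro ε hε
  rcases R.eq_empty_or_nonempty with rfl | ⟨r0, hr0⟩
  · have h : ∀ N ω, L N ω = 0 := by
      intro N ω; rw [hL]; simp
    simp [h, not_le.2 hε]
  set BS := {y : ℝ | ∃ r ∈ R, ∃ α ∈ Set.Icc (-1 : ℝ) 1,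
          y = f (r * α) + g r + β * r ^ 2 * Real.sqrt (2 * (1 - α ^ 2))} with hBS
  set S := sSup BS with hSdef
  have hbdd : BddAbove BS := bdd_B β R hR1 hR2 f hf g hg
  have hS : ∀ r ∈ R, ∀ α ∈ Set.Icc (-1 : ℝ) 1,
      f (r * α) + g r + β * r ^ 2 * Real.sqrt (2 * (1 - α ^ 2)) ≤ S := fun r hr α hα =>
    le_csSup hbdd ⟨r, hr, α, hα, rfl⟩
  have hne : BS.Nonempty := ⟨_, r0, hr0, 0, by norm_num, rfl⟩
  obtain ⟨y, ⟨r, hr, α0, hα0, rfl⟩, hy⟩ := exists_lt_of_lt_csSup hne (show S - ε / 3 < S by linarith)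
  obtain ⟨α, hα, hαne, hαS⟩ := perturb β f g hf _ r (hR1 hr) α0 hα0 hy
  set ρ := Real.sqrt (1 - α ^ 2) with hρ
  have hα2 : 0 ≤ 1 - α ^ 2 := by nlinarith [hα.1, hα.2]
  have hρ0 : 0 ≤ ρ := Real.sqrt_nonneg _
  have hρ2 : ρ ^ 2 = 1 - α ^ 2 := Real.sq_sqrt hα2
  rw [Real.sqrt_mul (by norm_num)] at hαS
  obtain ⟨K, hK⟩ := upper
  rw [ENNReal.tendsto_nhds_zero]
  intro δ0 hδ0
  obtain ⟨δ, hδ1, hδ2⟩ := ENNReal.lt_iff_exists_nnreal_btwn.1 hδ0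
  have hδ : (0 : ℝ) < δ := by exact_mod_cast hδ1
  let η := ε / (16 * β)
  have hη : 0 < η := by positivity
  let ε1 := ε / (3 * β)
  have hε1 : 0 < ε1 := by positivity
  filter_upwards [eventually_ge_atTop 1, ev_div K η (δ / 6) hη (by positivity),
    LC_lim α ρ hρ0 (by linarith) hαne ε1 hε1 (δ / 2) (by positivity)] with N hN hNK hNL
  refine le_trans ?_ hδ2.le
  have hNr : (0 : ℝ) < N := by exact_mod_cast hN
  have hvN := hv N hN
  have hnv : nrm (v N) = 1 := by unfold nrm; rw [hvN]; simp
  have hPN := hP N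
  have hLim : ∀ ω, L N ω = sSup ((fun m : Fin N → ℝ => β * (Real.sqrt N *
      ∑ p : Fin N × Fin N, m p.1 * m p.2 * (fun p : Fin N × Fin N => J N ω p.1 p.2) p) +
        N * f (∑ i, v N i * m i) + N * g (nrm m)) '' {m | nrm m ∈ R}) := by
    intro ω
    rw [hL]
    congr 1
    ext y
    constructor
    · rintro ⟨m, h1, h2⟩
      refine ⟨m, h1, ?_⟩
      rw [h2, quad_eq]; rfl
    · rintro ⟨m, h1, h2⟩
      refine ⟨m, h1, ?_⟩
      rw [← h2, quad_eq]; rfl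
  let E1 : Set (Fin N × Fin N → ℝ) := {Z | ∃ m : Fin N → ℝ, nrm m ∈ R ∧
      N * (S + ε / 2) < β * (Real.sqrt N * ∑ p : Fin N × Fin N, m p.1 * m p.2 * Z p) +
        N * f (∑ i, v N i * m i) + N * g (nrm m)}
  let E2 : Set (Fin N × Fin N → ℝ) :=
    {Z | Z ∉ good α (v N) (Real.sqrt N * (Real.sqrt 2 * ρ - ε1))}
  have hm1 : P N {ω | (fun p : Fin N × Fin N => J N ω p.1 p.2) ∈ E1} ≤ ENNReal.ofReal (δ / 2) := by
    refine (transfer (P N) (J N) (hJ N hN) E1 (meas_upper _ _ _ _ _ _) ?_).trans ?_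
    · rintro Z ⟨m, h1, h2⟩
      refine ⟨m, h1, ?_⟩
      rwa [quad_sym] at h2
    · refine (hK β hβ R hR1 f hf g hg S hS η hη (S + ε / 2) ?_ N hN (v N) hvN).trans ?_
      · have : 4 * β * η = ε / 4 := by simp only [η]; field_simp; norm_num
        linarith
      · rw [show (3 : ENNReal) = ENNReal.ofReal 3 by simp, ← ENNReal.ofReal_mul (by norm_num)]
        apply ENNReal.ofReal_le_ofReal
        linarith
  have hm2 : P N {ω | (fun p : Fin N × Fin N => J N ω p.1 p.2) ∈ E2} ≤ ENNReal.ofReal (δ / 2) := by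
    refine (transfer (P N) (J N) (hJ N hN) E2 (meas_good _ _ _) ?_).trans (hNL (v N))
    intro Z hZ hg
    apply hZ
    obtain ⟨w, h1, h2, h3⟩ := hg
    refine ⟨w, h1, h2, ?_⟩
    rwa [quad_sym]
  have hsub : {ω | ε ≤ |L N ω / N - S|} ⊆
      {ω | (fun p : Fin N × Fin N => J N ω p.1 p.2) ∈ E1} ∪
      {ω | (fun p : Fin N × Fin N => J N ω p.1 p.2) ∈ E2} := by
    intro ω hω
    by_contra hcon
    rw [Set.mem_union, not_or] at hcon
    obtain ⟨n1, n2⟩ := hcon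
    simp only [Set.mem_ofPred_eq, E1, E2, not_not, not_exists, not_and, not_lt] at n1 n2 hω
    have hup : L N ω ≤ N * (S + ε / 2) := by
      rw [hLim]
      apply csSup_le
      · refine Set.Nonempty.image _ ⟨fun i => r * v N i, ?_⟩
        show nrm _ ∈ R
        rw [nrm_smul r (hR1 hr).1 _ hvN]; exact hr
      · rintro y ⟨m, hm, rfl⟩
        exact n1 m hm
    have hlow : N * (S - 2 * ε / 3) ≤ L N ω := by
      obtain ⟨w, h1, h2, h3⟩ := n2
      rw [hnv, mul_one] at h2
      have hnm := nrm_smul r (hR1 hr).1 w h1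
      have hle : _ ≤ L N ω := (le_csSup (bdd_L β R hR1 hR2 f hf g hg (v N) hvN
        (fun p : Fin N × Fin N => J N ω p.1 p.2))
        ⟨fun i => r * w i, by show nrm _ ∈ R; rw [hnm]; exact hr, rfl⟩).trans_eq (hLim ω).symm
      refine le_trans ?_ hle
      simp only [hnm]
      have e1 : ∑ i, v N i * (r * w i) = r * α := by
        rw [← h2, Finset.mul_sum]
        exact Finset.sum_congr rfl fun i _ => by ring
      have e2 : ∑ p : Fin N × Fin N, r * w p.1 * (r * w p.2) * J N ω p.1 p.2 =
          r ^ 2 * ∑ p : Fin N × Fin N, w p.1 * w p.2 * J N ω p.1 p.2 := by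
        rw [Finset.mul_sum]
        exact Finset.sum_congr rfl fun i _ => by ring
      rw [e1, e2]
      have h4 : β * (Real.sqrt N * (r ^ 2 * (Real.sqrt N * (Real.sqrt 2 * ρ - ε1)))) ≤
          β * (Real.sqrt N * (r ^ 2 * ∑ p : Fin N × Fin N, w p.1 * w p.2 * J N ω p.1 p.2)) := by
        gcongr
      have h5 : β * (Real.sqrt N * (r ^ 2 * (Real.sqrt N * (Real.sqrt 2 * ρ - ε1)))) =
          N * (β * r ^ 2 * (Real.sqrt 2 * ρ) - r ^ 2 * (β * ε1)) := by
        linear_combination (β * r ^ 2 * (Real.sqrt 2 * ρ - ε1)) * (Real.mul_self_sqrt hNr.le)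
      have h6 : β * ε1 = ε / 3 := by simp only [ε1]; field_simp
      have hr2 : r ^ 2 ≤ 1 := by nlinarith [(hR1 hr).1, (hR1 hr).2]
      have h7 : r ^ 2 * (β * ε1) ≤ ε / 3 := by rw [h6]; nlinarith
      have h8 : N * (S - 2 * ε / 3) ≤ N * ((β * r ^ 2 * (Real.sqrt 2 * ρ) - r ^ 2 * (β * ε1)) +
          f (r * α) + g r) := by
        apply mul_le_mul_of_nonneg_left _ hNr.le
        linarith
      linarith
    have hlt : |L N ω / N - S| < ε := by
      rw [abs_lt]
      have a1 : L N ω / N ≤ S + ε / 2 := by rw [div_le_iff₀ hNr]; linarith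
      have a2 : S - 2 * ε / 3 ≤ L N ω / N := by rw [le_div_iff₀ hNr]; linarith
      constructor <;> linarith
    linarith
  calc _ ≤ _ := (measure_mono hsub).trans (measure_union_le _ _)
    _ ≤ ENNReal.ofReal (δ / 2) + ENNReal.ofReal (δ / 2) := add_le_add hm1 hm2
    _ = δ := by
      rw [← ENNReal.ofReal_add (by positivity) (by positivity), add_halves]
      simp
end
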